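/- Let G be a finite simple graph with |V(G)| ≥ 3 and let γ be an automorphism of G with γ³ = id. The following are equivalent: (i) there exists an isostatic framework (G,p) in ℝ² that is C₃-symmetric of type γ; (ii) G satisfies the Laman conditions and γ(v) ≠ v for every vertex v of G; (iii) there exists a (C₃,Φ) construction sequence for (G,γ); (iv) G has a proper (C₃,γ) 3Tree2 partition. -/

import Mathlib

open Matrix

noncomputable section

namespace C3Laman

variable {V : Type*} [Fintype V] [DecidableEq V]

/-- Rotation of the plane about the origin by the angle 2π/3. -/
def R3 : Matrix (Fin 2) (Fin 2) ℝ :=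
  !![-(1/2 : ℝ), -(Real.sqrt 3 / 2); Real.sqrt 3 / 2, -(1/2)]

/-- `(G, p)` is a framework: adjacent vertices get distinct points. -/
def IsFramework (G : SimpleGraph V) (p : V → Fin 2 → ℝ) : Prop :=
  ∀ u w, G.Adj u w → p u ≠ p w

/-- `m` is an infinitesimal motion of the framework `(G, p)`. -/
def IsInfMotion (G : SimpleGraph V) (p m : V → Fin 2 → ℝ) : Prop :=
  ∀ u w, G.Adj u w → (p u - p w) ⬝ᵥ (m u - m w) = 0

/-- `m` is an infinitesimal rigid motion of `p`: it comes from a skew-symmetric matrix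
`S` and a translation vector `t`. -/
def IsInfRigidMotion (p m : V → Fin 2 → ℝ) : Prop :=
  ∃ S : Matrix (Fin 2) (Fin 2) ℝ, Sᵀ = -S ∧ ∃ t : Fin 2 → ℝ,
    ∀ v, m v = S.mulVec (p v) + t

/-- `(G, p)` is infinitesimally rigid. -/
def InfRigid (G : SimpleGraph V) (p : V → Fin 2 → ℝ) : Prop :=
  ∀ m, IsInfMotion G p m → IsInfRigidMotion p m

/-- The row of the rigidity matrix corresponding to the edge `e`: at an endpoint `u` of
`e = {u, w}` it has the entries of `p u - p w` (note `p u - p w = 2 • p u - (p u + p w)`),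
at the other endpoint `w` it has the entries of `p w - p u`, and `0` elsewhere. -/
def rigidityRow (p : V → Fin 2 → ℝ) (e : Sym2 V) : V → Fin 2 → ℝ :=
  fun x => if x ∈ e then
    (2 : ℝ) • p x - Sym2.lift ⟨fun u w => p u + p w, fun _ _ => add_comm _ _⟩ e
  else 0

/-- `(G, p)` is independent: the rows of the rigidity matrix are linearly independent. -/
def Independent (G : SimpleGraph V) (p : V → Fin 2 → ℝ) : Prop :=
  LinearIndependent ℝ (fun e : G.edgeSet => rigidityRow p (e : Sym2 V))

/-- `(G, p)` is isostatic: it is a framework that is infinitesimally rigid and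
independent. -/
def Isostatic (G : SimpleGraph V) (p : V → Fin 2 → ℝ) : Prop :=
  IsFramework G p ∧ InfRigid G p ∧ Independent G p

/-- `(G, p)` is `C₃`-symmetric of type `γ`. -/
def C3Symmetric (G : SimpleGraph V) (γ : G ≃g G) (p : V → Fin 2 → ℝ) : Prop :=
  ∀ v, p (γ v) = R3.mulVec (p v)

/-- The Laman conditions: `|E(G)| = 2|V(G)| - 3`, and `|E(H)| ≤ 2|V(H)| - 3` for every
subgraph `H` of `G` with at least two vertices. -/
def Laman (G : SimpleGraph V) : Prop :=
  (G.edgeSet.ncard : ℤ) = 2 * Fintype.card V - 3 ∧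
  ∀ H : G.Subgraph, 2 ≤ H.verts.ncard →
    (H.edgeSet.ncard : ℤ) ≤ 2 * (H.verts.ncard : ℤ) - 3

/-- A 3Tree2 partition of `G`: three subtrees of `G` such that every edge of `G` lies in
exactly one of them, and every vertex of `G` lies in exactly two of them. -/
def Is3Tree2Partition (G : SimpleGraph V) (T : Fin 3 → G.Subgraph) : Prop :=
  (∀ i, (T i).coe.IsTree) ∧
  (∀ e ∈ G.edgeSet, ∃! i : Fin 3, e ∈ (T i).edgeSet) ∧
  ∀ v : V, ({i : Fin 3 | v ∈ (T i).verts}).ncard = 2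

/-- A proper 3Tree2 partition: no non-trivial subtrees of distinct trees have the same
vertex set. -/
def IsProper3Tree2Partition (G : SimpleGraph V) (T : Fin 3 → G.Subgraph) : Prop :=
  Is3Tree2Partition G T ∧
  ∀ i j : Fin 3, i ≠ j → ∀ Si Sj : G.Subgraph, Si ≤ T i → Sj ≤ T j →
    Si.coe.IsTree → Sj.coe.IsTree →
    2 ≤ Si.verts.ncard → 2 ≤ Sj.verts.ncard → Si.verts ≠ Sj.verts

/-- A `(C₃, γ)` 3Tree2 partition: a 3Tree2 partition with `γ(Tᵢ) = T_{i+1}` (mod 3). -/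
def IsC3_3Tree2Partition (G : SimpleGraph V) (γ : G ≃g G) (T : Fin 3 → G.Subgraph) : Prop :=
  Is3Tree2Partition G T ∧ ∀ i : Fin 3, (T i).map γ.toHom = T (i + 1)

/-- `H'` is a `(C₃, γ)` vertex addition of `H` (with vertex set `S`) by the new
vertices `v, w, z`. -/
def VertexAdditionStep (γ : V → V) (S : Finset V) (H H' : SimpleGraph V)
    (v w z : V) : Prop :=
  ∃ v₁ ∈ S, ∃ v₂ ∈ S, v₁ ≠ v₂ ∧
    H'.edgeSet = H.edgeSet ∪
      {s(v, v₁), s(v, v₂), s(w, γ v₁), s(w, γ v₂), s(z, γ (γ v₁)), s(z, γ (γ v₂))}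

/-- `H'` is a `(C₃, γ)` edge split of `H` (with vertex set `S`) by the new
vertices `v, w, z`. -/
def EdgeSplitStep (γ : V → V) (S : Finset V) (H H' : SimpleGraph V)
    (v w z : V) : Prop :=
  ∃ v₁ ∈ S, ∃ v₂ ∈ S, ∃ v₃ ∈ S, v₁ ≠ v₂ ∧ v₂ ≠ v₃ ∧ v₁ ≠ v₃ ∧
    H.Adj v₁ v₂ ∧ ¬(γ v₁ = v₁ ∧ γ v₂ = v₂) ∧
    H'.edgeSet = (H.edgeSet \ {s(v₁, v₂), s(γ v₁, γ v₂), s(γ (γ v₁), γ (γ v₂))}) ∪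
      {s(v, v₁), s(v, v₂), s(v, v₃),
       s(w, γ v₁), s(w, γ v₂), s(w, γ v₃),
       s(z, γ (γ v₁)), s(z, γ (γ v₂)), s(z, γ (γ v₃))}

/-- `H'` is a `(C₃, γ)` Δ extension of `H` (with vertex set `S`) by the new
vertices `v, w, z`. -/
def DeltaExtensionStep (γ : V → V) (S : Finset V) (H H' : SimpleGraph V)
    (v w z : V) : Prop :=
  ∃ v₀ ∈ S, γ v₀ ≠ v₀ ∧
    H'.edgeSet = H.edgeSet ∪
      {s(v, w), s(w, z), s(z, v), s(v, v₀), s(w, γ v₀), s(z, γ (γ v₀))}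

/-- A `(C₃, Φ)` construction sequence for `(G, γ)`:  a sequence of graphs `H i` on the
vertex sets `S i ⊆ V(G)`, starting with a triangle `K₃` on which `γ` acts as a 3-cycle,
each graph obtained from its predecessor by a `(C₃, γᵢ)` vertex addition, edge split, or
Δ extension by three new vertices permuted cyclically by `γ` (here `γᵢ` is the
restriction of `γ` to `S i`, which is required to be an automorphism of `H i`),
and ending with `G` itself. -/
def C3ConstructionSeq (G : SimpleGraph V) (γ : V → V) : Prop :=
  ∃ (k : ℕ) (S : ℕ → Finset V) (H : ℕ → SimpleGraph V),
    (S 0).card = 3 ∧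
    (∀ a b, (H 0).Adj a b ↔ a ∈ S 0 ∧ b ∈ S 0 ∧ a ≠ b) ∧
    (∀ u ∈ S 0, γ u ∈ S 0 ∧ γ u ≠ u) ∧
    (∀ i ≤ k,
      (∀ u ∈ S i, γ u ∈ S i) ∧
      (∀ a b, (H i).Adj a b → a ∈ S i ∧ b ∈ S i) ∧
      (∀ a b, (H i).Adj a b → (H i).Adj (γ a) (γ b))) ∧
    (∀ i < k, ∃ v w z : V,
      v ∉ S i ∧ w ∉ S i ∧ z ∉ S i ∧ v ≠ w ∧ w ≠ z ∧ v ≠ z ∧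
      γ v = w ∧ γ w = z ∧ γ z = v ∧
      S (i + 1) = S i ∪ {v, w, z} ∧
      (VertexAdditionStep γ (S i) (H i) (H (i + 1)) v w z ∨
       EdgeSplitStep γ (S i) (H i) (H (i + 1)) v w z ∨
       DeltaExtensionStep γ (S i) (H i) (H (i + 1)) v w z)) ∧
    S k = Finset.univ ∧ H k = G

set_option linter.unusedSectionVars false
set_option linter.unusedVariables false

theorem exists_rep {α : Type*} (f : α → α) (hf : ∀ x, f (f (f x)) = x) :
    ∃ r : α → α, (∀ x, r (f x) = r x) ∧ ∀ x, r x = x ∨ r x = f x ∨ r x = f (f x) := by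
  classical
  let s : Setoid α :=
    { r := fun x y => y = x ∨ y = f x ∨ y = f (f x)
      iseqv := ⟨fun x => Or.inl rfl, by
        rintro x y (h | h | h) <;> subst h <;> simp [hf], by
        rintro x y z (h | h | h) (h' | h' | h') <;> subst h <;> subst h' <;> simp [hf]⟩ }
  refine ⟨fun x => (Quotient.mk s x).out, fun x => ?_, fun x => ?_⟩
  · have : Quotient.mk s (f x) = Quotient.mk s x := by
      apply Quotient.sound
      change x = f x ∨ x = f (f x) ∨ x = f (f (f x))
      simp [hf]
    simp only [this]
  · have h := s.symm (Quotient.mk_out (s := s) x)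
    exact h

theorem inj_of_three {α : Type*} {f : α → α} (hf : ∀ x, f (f (f x)) = x) :
    Function.Injective f := fun x y h => by
  rw [← hf x, ← hf y, h]

theorem card_rep {α : Type*} [DecidableEq α] (f r : α → α) (hf : ∀ x, f (f (f x)) = x)
    (h1 : ∀ x, r (f x) = r x) (h2 : ∀ x, r x = x ∨ r x = f x ∨ r x = f (f x))
    (X : Finset α) (hX : ∀ x ∈ X, f x ∈ X) (hfree : ∀ x ∈ X, f x ≠ x) :
    (X.image r).card * 3 = X.card := by
  rw [Finset.card_eq_sum_card_fiberwise (f := r) (t := X.image r)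
    (fun x hx => Finset.mem_coe.2 (Finset.mem_image_of_mem r hx))]
  rw [Finset.sum_const_nat (m := 3)]
  intro y hy
  obtain ⟨x, hx, rfl⟩ := Finset.mem_image.1 hy
  have : X.filter (fun a => r a = r x) = {x, f x, f (f x)} := by
    ext a
    simp only [Finset.mem_filter, Finset.mem_insert, Finset.mem_singleton]
    constructor
    · rintro ⟨ha, h⟩
      have e1 := h2 a
      have e2 := h2 x
      have e3 := hf a
      have e4 := hf x
      grind
    · rintro (h | h | h) <;> subst h <;> simp_all
  rw [this, Finset.card_eq_three]
  refine ⟨x, f x, f (f x), ?_, ?_, ?_, rfl⟩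
  · exact (hfree x hx).symm
  · intro h
    apply hfree x hx
    have := congrArg f h
    rw [hf] at this; exact this
  · exact (hfree (f x) (hX x hx)).symm

theorem three_dvd_card {α : Type*} [DecidableEq α] (f : α → α) (hf : ∀ x, f (f (f x)) = x)
    (X : Finset α) (hX : ∀ x ∈ X, f x ∈ X) (hfree : ∀ x ∈ X, f x ≠ x) : 3 ∣ X.card := by
  obtain ⟨r, h1, h2⟩ := exists_rep f hf
  exact ⟨_, by rw [← card_rep f r hf h1 h2 X hX hfree, mul_comm]⟩

theorem map3 {g : V → V} (hg : ∀ v, g (g (g v)) = v) (e : Sym2 V) :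
    Sym2.map g (Sym2.map g (Sym2.map g e)) = e := by
  induction e using Sym2.ind with | _ a b => simp [hg]

theorem map_free {g : V → V} (hg : ∀ v, g (g (g v)) = v) (e : Sym2 V)
    (h : ∀ a ∈ e, g a ≠ a) : Sym2.map g e ≠ e := by
  induction e using Sym2.ind with | _ a b =>
  have h1 := h a (by simp)
  have h2 := h b (by simp)
  have := hg a
  intro h3
  simp only [Sym2.map_mk, Sym2.eq_iff] at h3
  grind

/-- number of edges spanned by `X` -/
def cnt (E : Finset (Sym2 V)) (X : Finset V) : ℕ := (E.filter (fun e => e ∈ X.sym2)).card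

/-- slack -/
def slk (E : Finset (Sym2 V)) (X : Finset V) : ℤ := 2 * (X.card : ℤ) - 3 - cnt E X

theorem slk_submod (E : Finset (Sym2 V)) (X Y : Finset V) :
    slk E (X ∪ Y) + slk E (X ∩ Y) ≤ slk E X + slk E Y := by
  have h1 : cnt E X + cnt E Y ≤ cnt E (X ∪ Y) + cnt E (X ∩ Y) := by
    unfold cnt
    rw [← Finset.card_union_add_card_inter]
    apply Nat.add_le_add
    · apply Finset.card_le_card
      intro e
      simp only [Finset.mem_union, Finset.mem_filter, Finset.mem_sym2_iff]
      grind
    · apply Finset.card_le_card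
      intro e
      simp only [Finset.mem_inter, Finset.mem_filter, Finset.mem_sym2_iff]
      grind
  have h2 := Finset.card_union_add_card_inter X Y
  unfold slk
  omega

structure LamanOn (S : Finset V) (E : Finset (Sym2 V)) : Prop where
  sub : ∀ a b, s(a, b) ∈ E → a ∈ S ∧ b ∈ S ∧ a ≠ b
  card : E.card + 3 = 2 * S.card
  sparse : ∀ X ⊆ S, 2 ≤ X.card → 0 ≤ slk E X

theorem cnt_image {g : V → V} (hg : ∀ v, g (g (g v)) = v) (E : Finset (Sym2 V))
    (hE : ∀ e ∈ E, Sym2.map g e ∈ E) (X : Finset V) : cnt E (X.image g) = cnt E X := by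
  have hi := inj_of_three hg
  unfold cnt
  symm
  apply Finset.card_bij (fun e _ => Sym2.map g e)
  · intro e he
    simp only [Finset.mem_filter] at he ⊢
    refine ⟨hE e he.1, ?_⟩
    have := he.2
    induction e using Sym2.ind with | _ a b =>
    simp only [Sym2.map_mk, Finset.mk_mem_sym2_iff] at this ⊢
    exact ⟨Finset.mem_image_of_mem g this.1, Finset.mem_image_of_mem g this.2⟩
  · intro a _ b _ h
    exact Sym2.map.injective hi h
  · intro e he
    simp only [Finset.mem_filter] at he
    refine ⟨Sym2.map g (Sym2.map g e), ?_, map3 hg e⟩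
    simp only [Finset.mem_filter]
    refine ⟨hE _ (hE _ he.1), ?_⟩
    have := he.2
    induction e using Sym2.ind with | _ a b =>
    simp only [Sym2.map_mk, Finset.mk_mem_sym2_iff, Finset.mem_image] at this ⊢
    obtain ⟨⟨a', h1, rfl⟩, ⟨b', h2, rfl⟩⟩ := this
    rw [hg, hg]; exact ⟨h1, h2⟩

theorem slk_image {g : V → V} (hg : ∀ v, g (g (g v)) = v) (E : Finset (Sym2 V))
    (hE : ∀ e ∈ E, Sym2.map g e ∈ E) (X : Finset V) : slk E (X.image g) = slk E X := by
  unfold slk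
  rw [cnt_image hg E hE, Finset.card_image_of_injective _ (inj_of_three hg)]

/-- A set containing a full orbit of a pair that lies in no tight set has slack at least 3. -/
theorem slk_full {g : V → V} (hg : ∀ v, g (g (g v)) = v) (S : Finset V) (E : Finset (Sym2 V))
    (hS : ∀ v ∈ S, g v ∈ S) (hfree : ∀ v ∈ S, g v ≠ v)
    (hE : ∀ e ∈ E, Sym2.map g e ∈ E) (hsub : ∀ a b, s(a, b) ∈ E → a ∈ S ∧ b ∈ S ∧ a ≠ b)
    (a b : V) (hn : ∀ X ⊆ S, a ∈ X → b ∈ X → 1 ≤ slk E X)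
    (X : Finset V) (hX : X ⊆ S)
    (hO : {a, b, g a, g b, g (g a), g (g b)} ⊆ X) : 3 ≤ slk E X := by
  -- pick a minimiser
  let C := S.powerset.filter (fun Y => {a, b, g a, g b, g (g a), g (g b)} ⊆ Y)
  have hXC : X ∈ C := by simp [C, hX, hO]
  obtain ⟨M, hMC, hM⟩ := Finset.exists_min_image C (slk E) ⟨X, hXC⟩
  have hC : ∀ Y, Y ∈ C ↔ Y ⊆ S ∧ {a, b, g a, g b, g (g a), g (g b)} ⊆ Y := by
    intro Y; simp [C]
  have himg : ∀ Y, Y ∈ C → Y.image g ∈ C := by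
    intro Y hY
    rw [hC] at hY ⊢
    refine ⟨?_, ?_⟩
    · intro y hy
      obtain ⟨z, hz, rfl⟩ := Finset.mem_image.1 hy
      exact hS z (hY.1 hz)
    · intro y hy
      rw [Finset.mem_image]
      refine ⟨g (g y), ?_, hg y⟩
      apply hY.2
      simp only [Finset.mem_insert, Finset.mem_singleton] at hy ⊢
      rcases hy with h | h | h | h | h | h <;> subst h <;> simp [hg]
  have hun : ∀ Y Z, Y ∈ C → Z ∈ C → slk E Y = slk E M → slk E Z = slk E M →
      Y ∪ Z ∈ C ∧ slk E (Y ∪ Z) = slk E M := by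
    intro Y Z hY hZ h1 h2
    have hu : Y ∪ Z ∈ C := by
      rw [hC] at *
      exact ⟨Finset.union_subset hY.1 hZ.1, hY.2.trans Finset.subset_union_left⟩
    have hi : Y ∩ Z ∈ C := by
      rw [hC] at *
      exact ⟨Finset.inter_subset_left.trans hY.1, Finset.subset_inter hY.2 hZ.2⟩
    refine ⟨hu, ?_⟩
    have := slk_submod E Y Z
    have := hM _ hu
    have := hM _ hi
    omega
  have h1 := himg M hMC
  have h2 := himg _ h1
  have s1 := slk_image hg E hE M
  have s2 := (slk_image hg E hE (M.image g)).trans s1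
  obtain ⟨h3, s3⟩ := hun _ _ hMC h1 rfl s1
  obtain ⟨h4, s4⟩ := hun _ _ h3 h2 s3 s2
  set W := M ∪ M.image g ∪ (M.image g).image g with hW
  have hWinv : ∀ x ∈ W, g x ∈ W := by
    intro x hx
    simp only [hW, Finset.mem_union, Finset.mem_image] at hx ⊢
    rcases hx with (h | ⟨y, hy, rfl⟩) | ⟨y, ⟨z, hz, rfl⟩, rfl⟩
    · exact Or.inl (Or.inr ⟨x, h, rfl⟩)
    · exact Or.inr ⟨g y, ⟨y, hy, rfl⟩, rfl⟩
    · rw [hg]; exact Or.inl (Or.inl hz)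
  have hWS := ((hC W).1 h4).1
  have d1 : 3 ∣ W.card := three_dvd_card g hg W hWinv (fun x hx => hfree x (hWS hx))
  have d2 : 3 ∣ cnt E W := by
    apply three_dvd_card (Sym2.map g) (map3 hg)
    · intro e he
      simp only [Finset.mem_filter] at he ⊢
      refine ⟨hE e he.1, ?_⟩
      have := he.2
      induction e using Sym2.ind with | _ a b =>
      simp only [Sym2.map_mk, Finset.mk_mem_sym2_iff] at this ⊢
      exact ⟨hWinv _ this.1, hWinv _ this.2⟩
    · intro e he
      simp only [Finset.mem_filter, Finset.mem_sym2_iff] at he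
      exact map_free hg e (fun a ha => hfree a (hWS (he.2 a ha)))
  have h5 : 1 ≤ slk E W := hn W hWS (((hC W).1 h4).2 (by simp)) (((hC W).1 h4).2 (by simp))
  have h6 := hM X hXC
  have : slk E W = 2 * (W.card : ℤ) - 3 - cnt E W := rfl
  omega

/-- The three orbit edges. -/
def orb (g : V → V) (a b : V) : Finset (Sym2 V) :=
  {s(a, b), s(g a, g b), s(g (g a), g (g b))}

theorem sparse_add_orbit {g : V → V} (hg : ∀ v, g (g (g v)) = v) (S : Finset V)
    (E : Finset (Sym2 V))
    (hS : ∀ v ∈ S, g v ∈ S) (hfree : ∀ v ∈ S, g v ≠ v)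
    (hE : ∀ e ∈ E, Sym2.map g e ∈ E) (hsub : ∀ a b, s(a, b) ∈ E → a ∈ S ∧ b ∈ S ∧ a ≠ b)
    (hsp : ∀ X ⊆ S, 2 ≤ X.card → 0 ≤ slk E X)
    (a b : V) (hn : ∀ X ⊆ S, a ∈ X → b ∈ X → 1 ≤ slk E X)
    (X : Finset V) (hX : X ⊆ S) (hc : 2 ≤ X.card) : 0 ≤ slk (E ∪ orb g a b) X := by
  have himS : ∀ Y ⊆ S, Y.image g ⊆ S := by
    intro Y hY y hy
    obtain ⟨z, hz, rfl⟩ := Finset.mem_image.1 hy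
    exact hS z (hY hz)
  have hn1 : ∀ X ⊆ S, g a ∈ X → g b ∈ X → 1 ≤ slk E X := by
    intro Y hY h1 h2
    rw [← slk_image hg E hE Y, ← slk_image hg E hE]
    apply hn _ (himS _ (himS _ hY))
    · exact Finset.mem_image.2 ⟨_, Finset.mem_image.2 ⟨_, h1, rfl⟩, hg a⟩
    · exact Finset.mem_image.2 ⟨_, Finset.mem_image.2 ⟨_, h2, rfl⟩, hg b⟩
  have hn2 : ∀ X ⊆ S, g (g a) ∈ X → g (g b) ∈ X → 1 ≤ slk E X := by
    intro Y hY h1 h2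
    rw [← slk_image hg E hE Y]
    apply hn _ (himS _ hY)
    · exact Finset.mem_image.2 ⟨_, h1, hg a⟩
    · exact Finset.mem_image.2 ⟨_, h2, hg b⟩
  -- two consecutive edges: slack at least two
  have htwo : ∀ c d, (∀ X ⊆ S, g c ∈ X → g d ∈ X → 1 ≤ slk E X) →
      {a, b, g a, g b, g (g a), g (g b)} ⊆ ({c, d, g c, g d, g (g c), g (g d)} : Finset V) →
      ∀ X ⊆ S, c ∈ X → d ∈ X → g c ∈ X → g d ∈ X → 2 ≤ slk E X := by
    intro c d hcd hsubs X hX h1 h2 h3 h4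
    have hsm := slk_submod E X (X.image g)
    have himg := slk_image hg E hE X
    have m1 : g c ∈ X.image g := Finset.mem_image_of_mem g h1
    have m2 : g d ∈ X.image g := Finset.mem_image_of_mem g h2
    have m3 : g (g c) ∈ X.image g := Finset.mem_image_of_mem g h3
    have m4 : g (g d) ∈ X.image g := Finset.mem_image_of_mem g h4
    have hfull := slk_full hg S E hS hfree hE hsub a b hn (X ∪ X.image g)
      (Finset.union_subset hX (himS X hX)) (hsubs.trans (by
        intro y hy
        simp only [Finset.mem_insert, Finset.mem_singleton] at hy
        rw [Finset.mem_union]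
        rcases hy with h | h | h | h | h | h <;> subst h
        exacts [Or.inl h1, Or.inl h2, Or.inl h3, Or.inl h4, Or.inr m3, Or.inr m4]))
    have := hcd (X ∩ X.image g) (Finset.inter_subset_left.trans hX)
      (Finset.mem_inter.2 ⟨h3, m1⟩) (Finset.mem_inter.2 ⟨h4, m2⟩)
    omega
  have hcnt : cnt (E ∪ orb g a b) X ≤ cnt E X + ((orb g a b).filter (fun e => e ∈ X.sym2)).card := by
    unfold cnt
    rw [Finset.filter_union]
    exact Finset.card_union_le _ _
  have hdef : slk (E ∪ orb g a b) X = 2 * (X.card : ℤ) - 3 - cnt (E ∪ orb g a b) X := rfl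
  have hdef' : slk E X = 2 * (X.card : ℤ) - 3 - cnt E X := rfl
  suffices h : (((orb g a b).filter (fun e => e ∈ X.sym2)).card : ℤ) ≤ slk E X by omega
  have hcase : ((orb g a b).filter (fun e => e ∈ X.sym2)).card ≤
      (if a ∈ X ∧ b ∈ X then 1 else 0) + ((if g a ∈ X ∧ g b ∈ X then 1 else 0) +
      (if g (g a) ∈ X ∧ g (g b) ∈ X then 1 else 0)) := by
    unfold orb
    rw [Finset.filter_insert, Finset.filter_insert, Finset.filter_singleton]
    simp only [Finset.mk_mem_sym2_iff]
    split_ifs <;> simp <;> first | exact Finset.card_le_two | exact Finset.card_le_three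
  have h0 := hsp X hX hc
  have e01 := htwo a b hn1 (by simp)
  have e12 := htwo (g a) (g b) hn2 (by
    intro y hy
    simp only [hg, Finset.mem_insert, Finset.mem_singleton] at hy ⊢
    tauto)
  have e20 := htwo (g (g a)) (g (g b)) (by rw [hg, hg]; exact hn) (by
    intro y hy
    simp only [hg, Finset.mem_insert, Finset.mem_singleton] at hy ⊢
    tauto)
  rw [hg, hg] at e20
  have e012 := slk_full hg S E hS hfree hE hsub a b hn X hX
  have f0 := hn X hX
  have f1 := hn1 X hX
  have f2 := hn2 X hX
  have e01 := e01 X hX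
  have e12 := e12 X hX
  have e20 := e20 X hX
  have e012 : a ∈ X ∧ b ∈ X → g a ∈ X ∧ g b ∈ X → g (g a) ∈ X ∧ g (g b) ∈ X → 3 ≤ slk E X := by
    intro h1 h2 h3
    apply e012
    intro y hy
    simp only [Finset.mem_insert, Finset.mem_singleton] at hy
    rcases hy with h | h | h | h | h | h <;> subst h
    exacts [h1.1, h1.2, h2.1, h2.2, h3.1, h3.2]
  split_ifs at hcase with c1 c2 c3 c3 c2 c3 c3
  · have := e012 c1 c2 c3; omega
  · have := e01 c1.1 c1.2 c2.1 c2.2; omega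
  · have := e20 c3.1 c3.2 c1.1 c1.2; omega
  · have := f0 c1.1 c1.2; omega
  · have := e12 c2.1 c2.2 c3.1 c3.2; omega
  · have := f1 c2.1 c2.2; omega
  · have := f2 c3.1 c3.2; omega
  · omega

theorem exists_free_pair (S : Finset V) (E : Finset (Sym2 V))
    (hsp : ∀ X ⊆ S, 2 ≤ X.card → 0 ≤ slk E X)
    (hsub : ∀ a b, s(a, b) ∈ E → a ∈ S ∧ b ∈ S ∧ a ≠ b)
    (a b c : V) (hab : a ≠ b) (hbc : b ≠ c) (hac : a ≠ c)
    (habc : ∀ X ⊆ S, a ∈ X → b ∈ X → c ∈ X → 1 ≤ slk E X) :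
    (∀ X ⊆ S, a ∈ X → b ∈ X → 1 ≤ slk E X) ∨ (∀ X ⊆ S, b ∈ X → c ∈ X → 1 ≤ slk E X) ∨
    (∀ X ⊆ S, a ∈ X → c ∈ X → 1 ≤ slk E X) := by
  by_contra! hcon
  obtain ⟨⟨X, hX, aX, bX, tX⟩, ⟨Y, hY, bY, cY, tY⟩, ⟨Z, hZ, aZ, cZ, tZ⟩⟩ := hcon
  have key : ∀ P Q : Finset V, P ⊆ S → Q ⊆ S → slk E P < 1 → slk E Q < 1 →
      a ∈ P ∪ Q → b ∈ P ∪ Q → c ∈ P ∪ Q → ∀ x, x ∈ P ∩ Q → P ∩ Q = {x} := by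
    intro P Q hP hQ tP tQ h1 h2 h3 x hx
    by_contra hne
    have : 2 ≤ (P ∩ Q).card := by
      by_contra hlt
      apply hne
      symm
      apply Finset.eq_of_subset_of_card_le (Finset.singleton_subset_iff.2 hx)
      rw [Finset.card_singleton]; omega
    have h4 := hsp (P ∩ Q) (Finset.inter_subset_left.trans hP) this
    have h5 := habc (P ∪ Q) (Finset.union_subset hP hQ) h1 h2 h3
    have := slk_submod E P Q
    omega
  have iXY := key X Y hX hY tX tY (by simp [aX]) (by simp [bX]) (by simp [cY]) b (by simp [bX, bY])
  have iYZ := key Y Z hY hZ tY tZ (by simp [aZ]) (by simp [bY]) (by simp [cY]) c (by simp [cY, cZ])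
  have iXZ := key X Z hX hZ tX tZ (by simp [aX]) (by simp [bX]) (by simp [cZ]) a (by simp [aX, aZ])
  have i2 : (X ∪ Y) ∩ Z = {a, c} := by
    rw [Finset.union_inter_distrib_right, iXZ, iYZ]; rfl
  have c1 := Finset.card_union_add_card_inter X Y
  have c2 := Finset.card_union_add_card_inter (X ∪ Y) Z
  rw [iXY, Finset.card_singleton] at c1
  rw [i2, Finset.card_pair hac] at c2
  have hdis : cnt E X + cnt E Y + cnt E Z ≤ cnt E (X ∪ Y ∪ Z) := by
    unfold cnt
    have d1 : Disjoint (E.filter (fun e => e ∈ X.sym2)) (E.filter (fun e => e ∈ Y.sym2)) := by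
      rw [Finset.disjoint_left]
      intro e h1 h2
      simp only [Finset.mem_filter] at h1 h2
      induction e using Sym2.ind with | _ u w =>
      simp only [Finset.mk_mem_sym2_iff] at h1 h2
      have := (hsub u w h1.1).2.2
      have m1 : u ∈ X ∩ Y := Finset.mem_inter.2 ⟨h1.2.1, h2.2.1⟩
      have m2 : w ∈ X ∩ Y := Finset.mem_inter.2 ⟨h1.2.2, h2.2.2⟩
      rw [iXY, Finset.mem_singleton] at m1 m2
      exact this (m1.trans m2.symm)
    have d2 : Disjoint ((E.filter (fun e => e ∈ X.sym2)) ∪ (E.filter (fun e => e ∈ Y.sym2)))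
        (E.filter (fun e => e ∈ Z.sym2)) := by
      rw [Finset.disjoint_left]
      intro e h1 h2
      simp only [Finset.mem_filter, Finset.mem_union] at h1 h2
      induction e using Sym2.ind with | _ u w =>
      simp only [Finset.mk_mem_sym2_iff] at h1 h2
      have := (hsub u w h2.1).2.2
      rcases h1 with h1 | h1
      · have m1 : u ∈ X ∩ Z := Finset.mem_inter.2 ⟨h1.2.1, h2.2.1⟩
        have m2 : w ∈ X ∩ Z := Finset.mem_inter.2 ⟨h1.2.2, h2.2.2⟩
        rw [iXZ, Finset.mem_singleton] at m1 m2
        exact this (m1.trans m2.symm)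
      · have m1 : u ∈ Y ∩ Z := Finset.mem_inter.2 ⟨h1.2.1, h2.2.1⟩
        have m2 : w ∈ Y ∩ Z := Finset.mem_inter.2 ⟨h1.2.2, h2.2.2⟩
        rw [iYZ, Finset.mem_singleton] at m1 m2
        exact this (m1.trans m2.symm)
    rw [← Finset.card_union_of_disjoint d1, ← Finset.card_union_of_disjoint d2]
    apply Finset.card_le_card
    intro e
    simp only [Finset.mem_union, Finset.mem_filter, Finset.mem_sym2_iff]
    grind
  have := habc (X ∪ Y ∪ Z) (Finset.union_subset (Finset.union_subset hX hY) hZ)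
    (by simp [aX]) (by simp [bX]) (by simp [cY])
  unfold slk at *
  omega

def GInv (g : V → V) (S : Finset V) (H : SimpleGraph V) : Prop :=
  (∀ u ∈ S, g u ∈ S) ∧
      (∀ a b, H.Adj a b → a ∈ S ∧ b ∈ S) ∧
      (∀ a b, H.Adj a b → H.Adj (g a) (g b))

def Stp (g : V → V) (S : Finset V) (H : SimpleGraph V) (S' : Finset V) (H' : SimpleGraph V) : Prop :=
  ∃ v w z : V,
      v ∉ S ∧ w ∉ S ∧ z ∉ S ∧ v ≠ w ∧ w ≠ z ∧ v ≠ z ∧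
      g v = w ∧ g w = z ∧ g z = v ∧
      S' = S ∪ {v, w, z} ∧
      (VertexAdditionStep g S H H' v w z ∨
       EdgeSplitStep g S H H' v w z ∨
       DeltaExtensionStep g S H H' v w z)

def Sq (g : V → V) (S₁ : Finset V) (G : SimpleGraph V) : Prop :=
  ∃ (k : ℕ) (S : ℕ → Finset V) (H : ℕ → SimpleGraph V),
    (S 0).card = 3 ∧
    (∀ a b, (H 0).Adj a b ↔ a ∈ S 0 ∧ b ∈ S 0 ∧ a ≠ b) ∧
    (∀ u ∈ S 0, g u ∈ S 0 ∧ g u ≠ u) ∧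
    (∀ i ≤ k, GInv g (S i) (H i)) ∧
    (∀ i < k, Stp g (S i) (H i) (S (i + 1)) (H (i + 1))) ∧
    S k = S₁ ∧ H k = G

theorem sq_iff (G : SimpleGraph V) (g : V → V) :
    C3ConstructionSeq G g ↔ Sq g Finset.univ G := Iff.rfl

theorem Sq.step {g : V → V} {S : Finset V} {H : SimpleGraph V} {S' : Finset V} {H' : SimpleGraph V}
    (h : Sq g S H) (hi : GInv g S' H') (hs : Stp g S H S' H') : Sq g S' H' := by
  obtain ⟨k, A, B, h1, h2, h3, h4, h5, rfl, rfl⟩ := h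
  refine ⟨k + 1, fun i => if i ≤ k then A i else S', fun i => if i ≤ k then B i else H',
    by simpa using h1, by simpa using h2, by simpa using h3, ?_, ?_, by simp, by simp⟩
  · intro i hik
    by_cases h : i ≤ k
    · simpa [h] using h4 i h
    · simpa [h] using hi
  · intro i hik
    by_cases h : i < k
    · have h' : i + 1 ≤ k := h
      simpa [h.le, h'] using h5 i h
    · have h' : i = k := by omega
      subst h'
      simpa using hs

def gr (E : Finset (Sym2 V)) : SimpleGraph V := SimpleGraph.fromEdgeSet (E : Set (Sym2 V))

theorem gr_edgeSet (E : Finset (Sym2 V)) (h : ∀ a b, s(a, b) ∈ E → a ≠ b) :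
    (gr E).edgeSet = (E : Set (Sym2 V)) := by
  unfold gr
  ext e
  induction e using Sym2.ind with | _ a b =>
  simp only [SimpleGraph.mem_edgeSet, SimpleGraph.fromEdgeSet_adj, Finset.mem_coe]
  exact ⟨fun h => h.1, fun h' => ⟨h', h a b h'⟩⟩

theorem gr_adj (E : Finset (Sym2 V)) (h : ∀ a b, s(a, b) ∈ E → a ≠ b) (a b : V) :
    (gr E).Adj a b ↔ s(a, b) ∈ E := by
  unfold gr
  simp only [SimpleGraph.fromEdgeSet_adj, Finset.mem_coe]
  exact ⟨fun h => h.1, fun h' => ⟨h', h a b h'⟩⟩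

theorem slk_mono {E E' : Finset (Sym2 V)} (h : E' ⊆ E) (X : Finset V) : slk E X ≤ slk E' X := by
  have : cnt E' X ≤ cnt E X := Finset.card_le_card (Finset.filter_subset_filter _ h)
  unfold slk; omega

theorem exists_low (S : Finset V) (E : Finset (Sym2 V)) (L : LamanOn S E) :
    ∃ v ∈ S, (Finset.univ.filter (fun x => s(v, x) ∈ E)).card ≤ 3 := by
  classical
  have hd : ∀ a b, s(a, b) ∈ E → a ≠ b := fun a b h => (L.sub a b h).2.2
  by_contra! hcon
  have h1 := (gr E).sum_degrees_eq_twice_card_edges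
  have h2 : (gr E).edgeFinset = E := by
    apply Finset.coe_injective
    rw [SimpleGraph.coe_edgeFinset, gr_edgeSet E hd]
  have h3 : ∀ x, (gr E).degree x = (Finset.univ.filter (fun y => s(x, y) ∈ E)).card := by
    intro x
    rw [← SimpleGraph.card_neighborFinset_eq_degree]
    congr 1
    ext y
    simp [gr_adj E hd]
  rw [h2] at h1
  have h4 : ∑ v ∈ S, 4 ≤ ∑ v, (gr E).degree v := by
    calc ∑ v ∈ S, 4 ≤ ∑ v ∈ S, (gr E).degree v :=
          Finset.sum_le_sum (fun x hx => by rw [h3]; exact hcon x hx)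
      _ ≤ _ := Finset.sum_le_sum_of_subset (Finset.subset_univ S)
  have := L.card
  simp only [Finset.sum_const, smul_eq_mul] at h4
  omega

theorem deg_ge (S : Finset V) (E : Finset (Sym2 V)) (L : LamanOn S E) (hS : 3 ≤ S.card)
    (v : V) (hv : v ∈ S) : 2 ≤ (Finset.univ.filter (fun x => s(v, x) ∈ E)).card := by
  set N := Finset.univ.filter (fun x => s(v, x) ∈ E)
  have h1 : E ⊆ E.filter (fun e => e ∈ (S.erase v).sym2) ∪ N.image (fun x => s(v, x)) := by
    intro e he
    induction e using Sym2.ind with | _ a b =>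
    have := L.sub a b he
    have he' : s(b, a) ∈ E := by rw [Sym2.eq_swap]; exact he
    simp only [Finset.mem_union, Finset.mem_filter, Finset.mk_mem_sym2_iff, Finset.mem_erase,
      Finset.mem_image, N, Finset.mem_univ, true_and]
    by_cases ha : a = v
    · subst ha; exact Or.inr ⟨b, he, rfl⟩
    · by_cases hb : b = v
      · subst hb; exact Or.inr ⟨a, he', Sym2.eq_swap⟩
      · exact Or.inl ⟨he, ⟨ha, this.1⟩, hb, this.2.1⟩
  have h2 := (Finset.card_le_card h1).trans (Finset.card_union_le _ _)
  have h3 : (N.image (fun x => s(v, x))).card ≤ N.card := Finset.card_image_le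
  have h4 := Finset.card_erase_of_mem hv
  have h5 := L.sparse (S.erase v) (Finset.erase_subset _ _) (by omega)
  have h6 := L.card
  have h7 : slk E (S.erase v) = 2 * ((S.erase v).card : ℤ) - 3 -
    (E.filter (fun e => e ∈ (S.erase v).sym2)).card := rfl
  omega

theorem gInv_gr {g : V → V} {S : Finset V} {E : Finset (Sym2 V)} (hS : ∀ v ∈ S, g v ∈ S)
    (hE : ∀ e ∈ E, Sym2.map g e ∈ E) (hsub : ∀ a b, s(a, b) ∈ E → a ∈ S ∧ b ∈ S ∧ a ≠ b) :
    GInv g S (gr E) := by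
  have hd : ∀ a b, s(a, b) ∈ E → a ≠ b := fun a b h => (hsub a b h).2.2
  refine ⟨hS, fun a b h => ?_, fun a b h => ?_⟩
  · rw [gr_adj E hd] at h
    exact ⟨(hsub a b h).1, (hsub a b h).2.1⟩
  · rw [gr_adj E hd] at h ⊢
    exact hE _ h

theorem reduce_base {g : V → V} (hg : ∀ v, g (g (g v)) = v) (S : Finset V) (E : Finset (Sym2 V))
    (L : LamanOn S E) (hS : ∀ v ∈ S, g v ∈ S) (hfree : ∀ v ∈ S, g v ≠ v)
    (hE : ∀ e ∈ E, Sym2.map g e ∈ E) (h3 : S.card = 3) : Sq g S (gr E) := by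
  have hd : ∀ a b, s(a, b) ∈ E → a ≠ b := fun a b h => (L.sub a b h).2.2
  have hEe : E = S.offDiag.image Sym2.mk.uncurry := by
    apply Finset.eq_of_subset_of_card_le
    · intro e he
      induction e using Sym2.ind with | _ a b =>
      rw [Finset.mem_image]
      exact ⟨(a, b), by simpa using L.sub a b he, rfl⟩
    · have := L.card
      rw [Sym2.card_image_offDiag, h3]
      rw [h3] at this
      simp [Nat.choose]
      omega
  refine ⟨0, fun _ => S, fun _ => gr E, h3, ?_, fun u hu => ⟨hS u hu, hfree u hu⟩,
    fun _ _ => gInv_gr hS hE L.sub, by simp, rfl, rfl⟩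
  intro a b
  rw [gr_adj E hd]
  refine ⟨L.sub a b, fun h => ?_⟩
  rw [hEe, Finset.mem_image]
  exact ⟨(a, b), by simpa using h, rfl⟩

set_option maxHeartbeats 4000000 in
theorem reduce {g : V → V} (hg : ∀ v, g (g (g v)) = v) : ∀ n, ∀ (S : Finset V) (E : Finset (Sym2 V)),
    S.card = n → LamanOn S E → (∀ v ∈ S, g v ∈ S) → (∀ v ∈ S, g v ≠ v) →
    (∀ e ∈ E, Sym2.map g e ∈ E) → Sq g S (gr E) := by
  intro n
  induction n using Nat.strong_induction_on with | _ n ih => ?_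
  intro S E hn L hS hfree hE
  have hgi := inj_of_three hg
  have hd : ∀ a b, s(a, b) ∈ E → a ≠ b := fun a b h => (L.sub a b h).2.2
  have hdvd := three_dvd_card g hg S hS hfree
  have hLc := L.card
  by_cases h3 : S.card = 3
  · exact reduce_base hg S E L hS hfree hE h3
  have h6 : 6 ≤ S.card := by omega
  obtain ⟨v, hv, hdeg⟩ := exists_low S E L
  have hdeg2 := deg_ge S E L (by omega) v hv
  set N := Finset.univ.filter (fun x => s(v, x) ∈ E) with hN
  have memN : ∀ x, x ∈ N ↔ s(v, x) ∈ E := by intro x; simp [hN]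
  have hE1 : ∀ a b, s(a, b) ∈ E → s(g a, g b) ∈ E := fun a b h => hE _ h
  obtain ⟨w, hw⟩ : ∃ w, g v = w := ⟨_, rfl⟩
  obtain ⟨z, hz⟩ : ∃ z, g w = z := ⟨_, rfl⟩
  have hzv : g z = v := by rw [← hz, ← hw, hg]
  have hvw : v ≠ w := by rw [← hw]; exact (hfree v hv).symm
  have hwS : w ∈ S := hw ▸ hS v hv
  have hzS : z ∈ S := hz ▸ hS w hwS
  have hwz : w ≠ z := by rw [← hz]; exact (hfree w hwS).symm
  have hvz : v ≠ z := by
    intro h; rw [← h] at hz hzv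
    exact hfree v hv hzv
  set S' := S \ {v, w, z} with hS'
  have memS' : ∀ x, x ∈ S' ↔ x ∈ S ∧ x ≠ v ∧ x ≠ w ∧ x ≠ z := by intro x; simp [hS']
  have hS'c : S'.card + 3 = S.card := by
    have hsub3 : ({v, w, z} : Finset V) ⊆ S := by
      intro x hx; simp only [Finset.mem_insert, Finset.mem_singleton] at hx
      rcases hx with h | h | h <;> subst h <;> assumption
    have := Finset.card_sdiff_add_card_eq_card hsub3
    rw [Finset.card_eq_three.2 ⟨v, w, z, hvw, hvz, hwz, rfl⟩] at this
    exact this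
  have hS'sub : S' ⊆ S := Finset.sdiff_subset
  have hS'inv : ∀ x ∈ S', g x ∈ S' := by
    intro x hx
    rw [memS'] at hx ⊢
    refine ⟨hS x hx.1, ?_, ?_, ?_⟩
    · rw [← hzv]; exact fun h => hx.2.2.2 (hgi h)
    · rw [← hw]; exact fun h => hx.2.1 (hgi h)
    · rw [← hz]; exact fun h => hx.2.2.1 (hgi h)
  have hS'free : ∀ x ∈ S', g x ≠ x := fun x hx => hfree x (hS'sub hx)
  have hSun : S = S' ∪ {v, w, z} := by
    ext x
    simp only [Finset.mem_union, memS', Finset.mem_insert, Finset.mem_singleton]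
    constructor
    · intro h; by_cases x = v <;> by_cases x = w <;> by_cases x = z <;> simp_all
    · rintro (h | h | h | h)
      · exact h.1
      all_goals subst h; assumption
  have nv : v ∉ S' := by simp [memS']
  have nw : w ∉ S' := by simp [memS']
  have nz : z ∉ S' := by simp [memS']
  set F := E.filter (fun e => e ∈ S'.sym2) with hF
  have memF : ∀ a b, s(a, b) ∈ F ↔ s(a, b) ∈ E ∧ a ∈ S' ∧ b ∈ S' := by
    intro a b; simp [hF]
  have hFE : F ⊆ E := Finset.filter_subset _ _
  have hFsub : ∀ a b, s(a, b) ∈ F → a ∈ S' ∧ b ∈ S' ∧ a ≠ b := by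
    intro a b h
    have := (memF a b).1 h
    exact ⟨this.2.1, this.2.2, hd a b this.1⟩
  have hFinv : ∀ e ∈ F, Sym2.map g e ∈ F := by
    intro e he
    induction e using Sym2.ind with | _ a b =>
    rw [Sym2.map_mk, memF]
    have := (memF a b).1 he
    exact ⟨hE1 a b this.1, hS'inv a this.2.1, hS'inv b this.2.2⟩
  have hFsp : ∀ X ⊆ S', 2 ≤ X.card → 0 ≤ slk F X := fun X hX hc =>
    (L.sparse X (hX.trans hS'sub) hc).trans (slk_mono hFE X)
  have hFtot : (F.card : ℤ) ≤ 2 * S'.card - 3 := by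
    have := L.sparse S' hS'sub (by omega)
    have h' : slk E S' = 2 * (S'.card : ℤ) - 3 - F.card := rfl
    omega
  -- adjacency of w and z
  have adjw : ∀ x, s(w, g x) ∈ E ↔ x ∈ N := by
    intro x
    rw [memN]
    refine ⟨fun h => ?_, fun h => hw ▸ hE1 _ _ h⟩
    have := hE1 _ _ (hE1 _ _ h)
    rwa [hg, hz, hzv] at this
  have adjz : ∀ x, s(z, g (g x)) ∈ E ↔ x ∈ N := by
    intro x
    rw [← adjw]
    refine ⟨fun h => ?_, fun h => hz ▸ hE1 _ _ h⟩
    have := hE1 _ _ (hE1 _ _ h)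
    rwa [hg, hzv, hw] at this
  have dec : ∀ e ∈ E, e ∈ F ∨ ∃ x ∈ N, e = s(v, x) ∨ e = s(w, g x) ∨ e = s(z, g (g x)) := by
    intro e he
    induction e using Sym2.ind with | _ a b =>
    have he' : s(b, a) ∈ E := by rw [Sym2.eq_swap]; exact he
    have hab := L.sub a b he
    have aux : ∀ a b, s(a, b) ∈ E → (a = v ∨ a = w ∨ a = z) →
        ∃ x ∈ N, s(a, b) = s(v, x) ∨ s(a, b) = s(w, g x) ∨ s(a, b) = s(z, g (g x)) := by
      rintro a b he (h | h | h) <;> subst h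
      · exact ⟨b, (memN b).2 he, Or.inl rfl⟩
      · have hb : b = g (g (g b)) := (hg b).symm
        refine ⟨g (g b), ?_, Or.inr (Or.inl (by rw [hg]))⟩
        rw [← adjw, hg]; exact he
      · refine ⟨g b, ?_, Or.inr (Or.inr (by rw [hg]))⟩
        rw [← adjz, hg]; exact he
    by_cases ha : a = v ∨ a = w ∨ a = z
    · exact Or.inr (aux a b he ha)
    · by_cases hb : b = v ∨ b = w ∨ b = z
      · have := aux b a he' hb
        rw [Sym2.eq_swap] at this
        exact Or.inr this
      · left
        rw [memF, memS', memS']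
        push Not at ha hb
        exact ⟨he, ⟨hab.1, ha⟩, hab.2.1, hb⟩
  have hGI : GInv g S (gr E) := gInv_gr hS hE L.sub
  have hEset := gr_edgeSet E hd
  have hFd : ∀ a b, s(a, b) ∈ F → a ≠ b := fun a b h => (hFsub a b h).2.2
  have hFset := gr_edgeSet F hFd
  by_cases hwN : w ∈ N
  · -- triangle case
    have hvwE : s(v, w) ∈ E := (memN w).1 hwN
    have hwzE : s(w, z) ∈ E := by have := hE1 _ _ hvwE; rwa [hw, hz] at this
    have hzvE : s(z, v) ∈ E := by have := hE1 _ _ hwzE; rwa [hz, hzv] at this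
    have hzN : z ∈ N := by rw [memN, Sym2.eq_swap]; exact hzvE
    have hsubN : ({w, z} : Finset V) ⊆ N := by
      intro x hx; simp only [Finset.mem_insert, Finset.mem_singleton] at hx
      rcases hx with h | h <;> subst h <;> assumption
    have hc := Finset.card_sdiff_add_card_eq_card hsubN
    rw [Finset.card_pair hwz] at hc
    by_cases h2 : N.card = 2
    · exfalso
      have hNe : ({w, z} : Finset V) = N :=
        Finset.eq_of_subset_of_card_le hsubN (by rw [Finset.card_pair hwz, h2])
      have : E ⊆ F ∪ {s(v, w), s(w, z), s(z, v)} := by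
        intro e he
        rcases dec e he with h | ⟨x, hx, h⟩
        · exact Finset.mem_union_left _ h
        · apply Finset.mem_union_right
          rw [← hNe] at hx
          simp only [Finset.mem_insert, Finset.mem_singleton] at hx ⊢
          rcases hx with hx | hx <;> subst hx <;> simp only [hw, hz, hzv] at h
          · rcases h with h | h | h <;> simp [h]
          · rcases h with h | h | h
            · right; right; rw [h, Sym2.eq_swap]
            · left; rw [h, Sym2.eq_swap]
            · right; left; rw [h, Sym2.eq_swap]
      have c1 := (Finset.card_le_card this).trans (Finset.card_union_le _ _)
      have c2 : ({s(v, w), s(w, z), s(z, v)} : Finset (Sym2 V)).card ≤ 3 := Finset.card_le_three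
      omega
    · have h1 : (N \ {w, z}).card = 1 := by omega
      obtain ⟨v₀, hv₀⟩ := Finset.card_eq_one.1 h1
      have hv₀m : v₀ ∈ N ∧ v₀ ≠ w ∧ v₀ ≠ z := by
        have : v₀ ∈ N \ {w, z} := by rw [hv₀]; simp
        simpa using this
      have hNc : ∀ x ∈ N, x = w ∨ x = z ∨ x = v₀ := by
        intro x hx
        by_cases h : x = w
        · exact Or.inl h
        by_cases h' : x = z
        · exact Or.inr (Or.inl h')
        have : x ∈ N \ {w, z} := by simp [hx, h, h']
        rw [hv₀, Finset.mem_singleton] at this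
        exact Or.inr (Or.inr this)
      have hv₀E := (memN v₀).1 hv₀m.1
      have hv₀S : v₀ ∈ S' := by
        rw [memS']
        exact ⟨(L.sub _ _ hv₀E).2.1, (hd _ _ hv₀E).symm, hv₀m.2⟩
      have hEeq : E = F ∪ {s(v, w), s(w, z), s(z, v), s(v, v₀), s(w, g v₀), s(z, g (g v₀))} := by
        apply Finset.Subset.antisymm
        · intro e he
          rcases dec e he with h | ⟨x, hx, h⟩
          · exact Finset.mem_union_left _ h
          · apply Finset.mem_union_right
            simp only [Finset.mem_insert, Finset.mem_singleton]
            rcases hNc x hx with hx | hx | hx <;> subst hx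
            · simp only [hw, hz, hzv] at h
              rcases h with h | h | h <;> simp [h]
            · simp only [hw, hz, hzv] at h
              rcases h with h | h | h
              · right; right; left; rw [h, Sym2.eq_swap]
              · left; rw [h, Sym2.eq_swap]
              · right; left; rw [h, Sym2.eq_swap]
            · rcases h with h | h | h <;> simp [h]
        · apply Finset.union_subset hFE
          intro e he
          simp only [Finset.mem_insert, Finset.mem_singleton] at he
          rcases he with h | h | h | h | h | h <;> subst h
          exacts [hvwE, hwzE, hzvE, hv₀E, (adjw _).2 hv₀m.1, (adjz _).2 hv₀m.1]
      have c1 := Finset.card_union_le F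
        {s(v, w), s(w, z), s(z, v), s(v, v₀), s(w, g v₀), s(z, g (g v₀))}
      rw [← hEeq] at c1
      have c2 : ({s(v, w), s(w, z), s(z, v), s(v, v₀), s(w, g v₀), s(z, g (g v₀))} :
        Finset (Sym2 V)).card ≤ 6 := Finset.card_le_six
      have hrec := ih S'.card (by omega) S' F rfl ⟨hFsub, by omega, hFsp⟩ hS'inv hS'free hFinv
      refine hrec.step hGI ⟨v, w, z, nv, nw, nz, hvw, hwz, hvz, hw, hz, hzv, hSun,
        Or.inr (Or.inr ⟨v₀, hv₀S, hS'free _ hv₀S, ?_⟩)⟩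
      rw [hEset, hFset, hEeq]
      simp only [Finset.coe_union, Finset.coe_insert, Finset.coe_singleton]
  have hzN : z ∉ N := by
    intro h
    apply hwN
    rw [memN] at h ⊢
    have := hE1 _ _ h
    rw [hw, hzv, Sym2.eq_swap] at this
    exact this
  have hNS : ∀ x ∈ N, x ∈ S' := by
    intro x hx
    have := (memN x).1 hx
    rw [memS']
    refine ⟨(L.sub _ _ this).2.1, (hd _ _ this).symm, ?_, ?_⟩
    · rintro rfl; exact hwN hx
    · rintro rfl; exact hzN hx
  by_cases h2 : N.card = 2
  · obtain ⟨a, b, hab, hNab⟩ := Finset.card_eq_two.1 h2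
    have ha : a ∈ N := by simp [hNab]
    have hb : b ∈ N := by simp [hNab]
    have hEeq : E = F ∪ {s(v, a), s(v, b), s(w, g a), s(w, g b), s(z, g (g a)), s(z, g (g b))} := by
      apply Finset.Subset.antisymm
      · intro e he
        rcases dec e he with h | ⟨x, hx, h⟩
        · exact Finset.mem_union_left _ h
        · apply Finset.mem_union_right
          simp only [Finset.mem_insert, Finset.mem_singleton]
          simp only [hNab, Finset.mem_insert, Finset.mem_singleton] at hx
          rcases hx with hx | hx <;> subst hx <;> rcases h with h | h | h <;> simp [h]
      · apply Finset.union_subset hFE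
        intro e he
        simp only [Finset.mem_insert, Finset.mem_singleton] at he
        rcases he with h | h | h | h | h | h <;> subst h
        exacts [(memN _).1 ha, (memN _).1 hb, (adjw _).2 ha, (adjw _).2 hb,
          (adjz _).2 ha, (adjz _).2 hb]
    have c1 := Finset.card_union_le F
      {s(v, a), s(v, b), s(w, g a), s(w, g b), s(z, g (g a)), s(z, g (g b))}
    rw [← hEeq] at c1
    have c2 : ({s(v, a), s(v, b), s(w, g a), s(w, g b), s(z, g (g a)), s(z, g (g b))} :
      Finset (Sym2 V)).card ≤ 6 := Finset.card_le_six
    have hrec := ih S'.card (by omega) S' F rfl ⟨hFsub, by omega, hFsp⟩ hS'inv hS'free hFinv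
    refine hrec.step hGI ⟨v, w, z, nv, nw, nz, hvw, hwz, hvz, hw, hz, hzv, hSun,
      Or.inl ⟨a, hNS a ha, b, hNS b hb, hab, ?_⟩⟩
    rw [hEset, hFset, hEeq]
    simp only [Finset.coe_union, Finset.coe_insert, Finset.coe_singleton]
  -- degree three
  have h3N : N.card = 3 := by omega
  have hmain : ∃ a b c, a ≠ b ∧ b ≠ c ∧ a ≠ c ∧ N = {a, b, c} ∧
      ∀ X ⊆ S', a ∈ X → b ∈ X → 1 ≤ slk F X := by
    obtain ⟨a, b, c, hab, hac, hbc, hNabc⟩ := Finset.card_eq_three.1 h3N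
    have hX : ∀ X ⊆ S', a ∈ X → b ∈ X → c ∈ X → 1 ≤ slk F X := by
      intro X hX ha hb hc
      have nvX : v ∉ X := fun h => nv (hX h)
      have h1 := L.sparse (insert v X) (Finset.insert_subset hv (hX.trans hS'sub)) (by
        rw [Finset.card_insert_of_notMem nvX]
        have : X.card ≠ 0 := Finset.card_ne_zero_of_mem ha
        omega)
      have h2 : cnt F X + 3 ≤ cnt E (insert v X) := by
        have hdis : Disjoint (F.filter (fun e => e ∈ X.sym2)) (N.image (fun x => s(v, x))) := by
          rw [Finset.disjoint_left]
          intro e h1 h2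
          obtain ⟨x, hx, rfl⟩ := Finset.mem_image.1 h2
          simp only [Finset.mem_filter, Finset.mk_mem_sym2_iff] at h1
          exact nvX h1.2.1
        have hci : (N.image (fun x => s(v, x))).card = 3 := by
          rw [Finset.card_image_of_injective, h3N]
          intro x y hxy
          exact Sym2.congr_right.1 hxy
        unfold cnt
        rw [← hci, ← Finset.card_union_of_disjoint hdis]
        apply Finset.card_le_card
        intro e he
        rcases Finset.mem_union.1 he with he | he
        · simp only [Finset.mem_filter, Finset.mem_sym2_iff] at he ⊢
          exact ⟨hFE he.1, fun a ha => Finset.mem_insert_of_mem (he.2 a ha)⟩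
        · obtain ⟨x, hx, rfl⟩ := Finset.mem_image.1 he
          simp only [Finset.mem_filter, Finset.mk_mem_sym2_iff]
          refine ⟨(memN x).1 hx, Finset.mem_insert_self _ _, Finset.mem_insert_of_mem ?_⟩
          simp only [hNabc, Finset.mem_insert, Finset.mem_singleton] at hx
          rcases hx with h | h | h <;> subst h <;> assumption
      have h3 : slk E (insert v X) = 2 * ((insert v X).card : ℤ) - 3 - cnt E (insert v X) := rfl
      rw [Finset.card_insert_of_notMem nvX] at h3
      have h4 : slk F X = 2 * (X.card : ℤ) - 3 - cnt F X := rfl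
      push_cast at h3
      omega
    rcases exists_free_pair S' F hFsp hFsub a b c hab hbc hac hX with h | h | h
    · exact ⟨a, b, c, hab, hbc, hac, hNabc, h⟩
    · refine ⟨b, c, a, hbc, hac.symm, hab.symm, ?_, h⟩
      rw [hNabc]; ext x; simp only [Finset.mem_insert, Finset.mem_singleton]; tauto
    · refine ⟨a, c, b, hac, hbc.symm, hab, ?_, h⟩
      rw [hNabc]; ext x; simp only [Finset.mem_insert, Finset.mem_singleton]; tauto
  obtain ⟨a, b, c, hab, hbc, hac, hNabc, hfr⟩ := hmain
  have ha : a ∈ N := by simp [hNabc]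
  have hb : b ∈ N := by simp [hNabc]
  have hc : c ∈ N := by simp [hNabc]
  have haS := hNS a ha
  have hbS := hNS b hb
  have habF : s(a, b) ∉ F := by
    intro h
    have h1 := hfr {a, b} (by
      intro x hx; simp only [Finset.mem_insert, Finset.mem_singleton] at hx
      rcases hx with h | h <;> subst h <;> assumption) (by simp) (by simp)
    have h2 : 0 < cnt F {a, b} := by
      unfold cnt
      apply Finset.card_pos.2
      exact ⟨s(a, b), by simp [h]⟩
    have h3 : slk F {a, b} = 2 * (({a, b} : Finset V).card : ℤ) - 3 - cnt F {a, b} := rfl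
    rw [Finset.card_pair hab] at h3
    push_cast at h3
    omega
  have habF1 : s(g a, g b) ∉ F := by
    intro h
    have := hFinv _ (hFinv _ h)
    simp only [Sym2.map_mk, hg] at this
    exact habF this
  have habF2 : s(g (g a), g (g b)) ∉ F := by
    intro h
    have := hFinv _ h
    simp only [Sym2.map_mk, hg] at this
    exact habF this
  set O := orb g a b with hO
  have memO : ∀ e, e ∈ O ↔ e = s(a, b) ∨ e = s(g a, g b) ∨ e = s(g (g a), g (g b)) := by
    intro e; simp [hO, orb]
  have hOF : Disjoint F O := by
    rw [Finset.disjoint_right]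
    intro e he
    rcases (memO e).1 he with h | h | h <;> subst h <;> assumption
  have hOc : O.card = 3 := by
    have hmf : ∀ x ∈ S', ∀ y ∈ S', s(g x, g y) ≠ s(x, y) := by
      intro x hx y hy
      apply map_free hg s(x, y)
      intro u hu
      rcases Sym2.mem_iff.1 hu with h | h <;> subst h
      exacts [hS'free _ hx, hS'free _ hy]
    apply Finset.card_eq_three.2
    refine ⟨_, _, _, ?_, ?_, ?_, rfl⟩
    · exact (hmf a haS b hbS).symm
    · have := hmf _ (hS'inv _ (hS'inv a haS)) _ (hS'inv _ (hS'inv b hbS))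
      rwa [hg, hg] at this
    · exact (hmf _ (hS'inv a haS) _ (hS'inv b hbS)).symm
  have hEeq : E = F ∪ {s(v, a), s(v, b), s(v, c), s(w, g a), s(w, g b), s(w, g c),
      s(z, g (g a)), s(z, g (g b)), s(z, g (g c))} := by
    apply Finset.Subset.antisymm
    · intro e he
      rcases dec e he with h | ⟨x, hx, h⟩
      · exact Finset.mem_union_left _ h
      · apply Finset.mem_union_right
        simp only [Finset.mem_insert, Finset.mem_singleton]
        simp only [hNabc, Finset.mem_insert, Finset.mem_singleton] at hx
        rcases hx with hx | hx | hx <;> subst hx <;> rcases h with h | h | h <;> simp [h]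
    · apply Finset.union_subset hFE
      intro e he
      simp only [Finset.mem_insert, Finset.mem_singleton] at he
      rcases he with h | h | h | h | h | h | h | h | h <;> subst h
      exacts [(memN _).1 ha, (memN _).1 hb, (memN _).1 hc, (adjw _).2 ha, (adjw _).2 hb,
        (adjw _).2 hc, (adjz _).2 ha, (adjz _).2 hb, (adjz _).2 hc]
  have c1 : E.card ≤ F.card + 9 := by
    have h1 : E ⊆ F ∪ (N.image (fun x => s(v, x)) ∪ (N.image (fun x => s(w, g x)) ∪
        N.image (fun x => s(z, g (g x))))) := by
      intro e he
      simp only [Finset.mem_union, Finset.mem_image]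
      rcases dec e he with h | ⟨x, hx, h | h | h⟩
      · exact Or.inl h
      · exact Or.inr (Or.inl ⟨x, hx, h.symm⟩)
      · exact Or.inr (Or.inr (Or.inl ⟨x, hx, h.symm⟩))
      · exact Or.inr (Or.inr (Or.inr ⟨x, hx, h.symm⟩))
    have h2 := (Finset.card_le_card h1).trans ((Finset.card_union_le _ _).trans
      (Nat.add_le_add_left ((Finset.card_union_le _ _).trans
        (Nat.add_le_add_left (Finset.card_union_le _ _) _)) _))
    have i1 : (N.image (fun x => s(v, x))).card ≤ N.card := Finset.card_image_le
    have i2 : (N.image (fun x => s(w, g x))).card ≤ N.card := Finset.card_image_le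
    have i3 : (N.image (fun x => s(z, g (g x)))).card ≤ N.card := Finset.card_image_le
    omega
  have hKsp := sparse_add_orbit hg S' F hS'inv hS'free hFinv hFsub hFsp a b hfr
  rw [← hO] at hKsp
  have hKc := Finset.card_union_of_disjoint hOF
  have hKsub : ∀ x y, s(x, y) ∈ F ∪ O → x ∈ S' ∧ y ∈ S' ∧ x ≠ y := by
    intro x y h
    rcases Finset.mem_union.1 h with h | h
    · exact hFsub x y h
    · have aux : ∀ p q, p ∈ S' → q ∈ S' → p ≠ q → s(x, y) = s(p, q) →
          x ∈ S' ∧ y ∈ S' ∧ x ≠ y := by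
        intro p q hp hq hpq h
        rcases Sym2.eq_iff.1 h with ⟨rfl, rfl⟩ | ⟨rfl, rfl⟩
        · exact ⟨hp, hq, hpq⟩
        · exact ⟨hq, hp, hpq.symm⟩
      rcases (memO _).1 h with h | h | h
      · exact aux _ _ haS hbS hab h
      · exact aux _ _ (hS'inv _ haS) (hS'inv _ hbS) (fun h => hab (hgi h)) h
      · exact aux _ _ (hS'inv _ (hS'inv _ haS)) (hS'inv _ (hS'inv _ hbS))
          (fun h => hab (hgi (hgi h))) h
  have hKinv : ∀ e ∈ F ∪ O, Sym2.map g e ∈ F ∪ O := by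
    intro e h
    rcases Finset.mem_union.1 h with h | h
    · exact Finset.mem_union_left _ (hFinv e h)
    · apply Finset.mem_union_right
      rw [memO] at h ⊢
      rcases h with h | h | h <;> subst h <;> simp [hg]
  have hKtot : ((F ∪ O).card : ℤ) ≤ 2 * S'.card - 3 := by
    have := hKsp S' (Finset.Subset.refl _) (by omega)
    have h' : slk (F ∪ O) S' = 2 * (S'.card : ℤ) - 3 - cnt (F ∪ O) S' := rfl
    have h'' : cnt (F ∪ O) S' = (F ∪ O).card := by
      unfold cnt
      congr 1
      apply Finset.filter_true_of_mem
      intro e he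
      induction e using Sym2.ind with | _ x y =>
      have := hKsub x y he
      simp [this.1, this.2.1]
    omega
  have hrec := ih S'.card (by omega) S' (F ∪ O) rfl ⟨hKsub, by omega, hKsp⟩ hS'inv hS'free hKinv
  have hKd : ∀ x y, s(x, y) ∈ F ∪ O → x ≠ y := fun x y h => (hKsub x y h).2.2
  refine hrec.step hGI ⟨v, w, z, nv, nw, nz, hvw, hwz, hvz, hw, hz, hzv, hSun,
      Or.inr (Or.inl ⟨a, haS, b, hbS, c, hNS c hc, hab, hbc, hac, ?_, fun h => hS'free a haS h.1, ?_⟩)⟩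
  · rw [gr_adj _ hKd]
    exact Finset.mem_union_right _ ((memO _).2 (Or.inl rfl))
  · rw [hEset, gr_edgeSet _ hKd]
    have hset : ((F ∪ O : Finset (Sym2 V)) : Set (Sym2 V)) \
        {s(a, b), s(g a, g b), s(g (g a), g (g b))} = (F : Set (Sym2 V)) := by
      ext e
      simp only [Set.mem_sdiff, Finset.mem_coe, Finset.mem_union, memO, Set.mem_insert_iff,
        Set.mem_singleton_iff]
      constructor
      · rintro ⟨h | h, h'⟩
        · exact h
        · exact absurd h h'
      · intro h
        refine ⟨Or.inl h, fun h' => ?_⟩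
        exact (Finset.disjoint_left.1 hOF h) ((memO e).2 h')
    rw [hset, hEeq]
    simp only [Finset.coe_union, Finset.coe_insert, Finset.coe_singleton]

/-- (ii) ⇒ (iii) -/
theorem two_three (G : SimpleGraph V) (hV : 3 ≤ Fintype.card V) (γ : G ≃g G)
    (hγ : ∀ v, γ (γ (γ v)) = v) (hL : Laman G) (hfree : ∀ v, γ v ≠ v) :
    C3ConstructionSeq G (fun v => γ v) := by
  classical
  rw [sq_iff]
  have hGe : G = gr G.edgeFinset := by
    unfold gr; rw [SimpleGraph.coe_edgeFinset, SimpleGraph.fromEdgeSet_edgeSet]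
  suffices h : Sq (fun v => γ v) Finset.univ (gr G.edgeFinset) by
    rw [← hGe] at h; exact h
  apply reduce (g := fun v => γ v) hγ _ _ _ rfl
  · refine ⟨?_, ?_, ?_⟩
    · intro a b h
      have : G.Adj a b := by simpa using h
      exact ⟨Finset.mem_univ _, Finset.mem_univ _, this.ne⟩
    · have := hL.1
      rw [← SimpleGraph.coe_edgeFinset, Set.ncard_coe_finset] at this
      rw [Finset.card_univ]; omega
    · intro X _ hX
      have := hL.2 ((⊤ : G.Subgraph).induce (X : Set V)) (by
        rw [SimpleGraph.Subgraph.induce_verts, Set.ncard_coe_finset]; exact hX)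
      rw [SimpleGraph.Subgraph.induce_verts, Set.ncard_coe_finset] at this
      have h2 : ((⊤ : G.Subgraph).induce (X : Set V)).edgeSet =
          (G.edgeFinset.filter (fun e => e ∈ X.sym2) : Finset (Sym2 V)) := by
        ext e
        induction e using Sym2.ind with | _ a b =>
        simp
        tauto
      rw [h2, Set.ncard_coe_finset] at this
      unfold slk cnt
      omega
  · intro v _; exact Finset.mem_univ _
  · intro v _; exact hfree v
  · intro e he
    induction e using Sym2.ind with | _ a b =>
    rw [SimpleGraph.mem_edgeFinset, SimpleGraph.mem_edgeSet] at he
    rw [Sym2.map_mk, SimpleGraph.mem_edgeFinset, SimpleGraph.mem_edgeSet]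
    exact γ.map_adj_iff.2 he

structure Ctx (g : V → V) (S : Finset V) (E : Finset (Sym2 V)) : Prop where
  inv : ∀ u ∈ S, g u ∈ S
  free : ∀ u ∈ S, g u ≠ u
  sub : ∀ a b, s(a, b) ∈ E → a ∈ S ∧ b ∈ S ∧ a ≠ b
  einv : ∀ e ∈ E, Sym2.map g e ∈ E

open Classical in
theorem seq_induct {g : V → V} (hg : ∀ v, g (g (g v)) = v)
    (P : Finset V → Finset (Sym2 V) → Prop)
    (base : ∀ x, g x ≠ x → P {x, g x, g (g x)} {s(x, g x), s(g x, g (g x)), s(g (g x), x)})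
    (vadd : ∀ S E v a b, Ctx g S E → v ∉ S → g v ∉ S → g (g v) ∉ S → g v ≠ v → a ∈ S → b ∈ S →
      a ≠ b → P S E → P (S ∪ {v, g v, g (g v)})
        (E ∪ {s(v, a), s(v, b), s(g v, g a), s(g v, g b), s(g (g v), g (g a)), s(g (g v), g (g b))}))
    (split : ∀ S E v a b c, Ctx g S E → v ∉ S → g v ∉ S → g (g v) ∉ S → g v ≠ v → a ∈ S → b ∈ S →
      c ∈ S → a ≠ b → b ≠ c → a ≠ c → s(a, b) ∈ E → P S E → P (S ∪ {v, g v, g (g v)})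
        ((E \ {s(a, b), s(g a, g b), s(g (g a), g (g b))}) ∪
          {s(v, a), s(v, b), s(v, c), s(g v, g a), s(g v, g b), s(g v, g c),
            s(g (g v), g (g a)), s(g (g v), g (g b)), s(g (g v), g (g c))}))
    (delta : ∀ S E v a, Ctx g S E → v ∉ S → g v ∉ S → g (g v) ∉ S → g v ≠ v → a ∈ S →
      P S E → P (S ∪ {v, g v, g (g v)})
        (E ∪ {s(v, g v), s(g v, g (g v)), s(g (g v), v), s(v, a), s(g v, g a), s(g (g v), g (g a))}))
    (G : SimpleGraph V) (h : C3ConstructionSeq G g) :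
    P Finset.univ G.edgeFinset ∧ Ctx g Finset.univ G.edgeFinset := by
  rw [sq_iff] at h
  obtain ⟨k, S, H, h1, h2, h3, h4, h5, h6, h7⟩ := h
  have main : ∀ i ≤ k, P (S i) (H i).edgeFinset ∧ ∀ u ∈ S i, g u ≠ u := by
    intro i
    induction i with
    | zero =>
      intro _
      obtain ⟨x, hx⟩ : (S 0).Nonempty := Finset.card_pos.1 (by omega)
      have e1 := h3 x hx
      have e2 := h3 _ e1.1
      have e3 := hg x
      have hne : x ≠ g (g x) := by
        intro h
        have := congrArg g h
        rw [hg] at this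
        exact e1.2 this
      have hSe : S 0 = {x, g x, g (g x)} := by
        symm
        apply Finset.eq_of_subset_of_card_le
        · intro y hy
          simp only [Finset.mem_insert, Finset.mem_singleton] at hy
          rcases hy with h | h | h <;> subst h
          exacts [hx, e1.1, e2.1]
        · rw [h1, Finset.card_eq_three.2 ⟨_, _, _, e1.2.symm, hne, e2.2.symm, rfl⟩]
      have hEe : (H 0).edgeFinset = {s(x, g x), s(g x, g (g x)), s(g (g x), x)} := by
        ext e
        induction e using Sym2.ind with | _ a b =>
        simp only [SimpleGraph.mem_edgeFinset, SimpleGraph.mem_edgeSet, h2, hSe, Finset.mem_insert,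
          Finset.mem_singleton, Sym2.eq_iff]
        have := e1.2
        have := e2.2
        grind
      refine ⟨?_, fun u hu => (h3 u hu).2⟩
      rw [hSe, hEe]
      exact base x e1.2
    | succ i ih =>
      intro hi
      obtain ⟨hP, hfree⟩ := ih (by omega)
      obtain ⟨v, w, z, nv, nw, nz, hvw, hwz, hvz, rfl, rfl, hzv, hS, hst⟩ := h5 i (by omega)
      obtain ⟨i1, i2, i3⟩ := h4 i (by omega)
      have hctx : Ctx g (S i) (H i).edgeFinset := by
        refine ⟨i1, hfree, ?_, ?_⟩
        · intro a b h
          rw [SimpleGraph.mem_edgeFinset, SimpleGraph.mem_edgeSet] at h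
          exact ⟨(i2 a b h).1, (i2 a b h).2, h.ne⟩
        · intro e he
          induction e using Sym2.ind with | _ a b =>
          rw [SimpleGraph.mem_edgeFinset, SimpleGraph.mem_edgeSet] at he
          rw [Sym2.map_mk, SimpleGraph.mem_edgeFinset, SimpleGraph.mem_edgeSet]
          exact i3 _ _ he
      refine ⟨?_, ?_⟩
      · rw [hS]
        rcases hst with ⟨a, ha, b, hb, hab, he⟩ | ⟨a, ha, b, hb, c, hc, hab, hbc, hac, hadj, -, he⟩ |
          ⟨a, ha, -, he⟩
        · have := vadd _ _ v a b hctx nv nw nz hvw.symm ha hb hab hP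
          convert this
          apply Finset.coe_injective
          rw [SimpleGraph.coe_edgeFinset, he]
          simp only [Finset.coe_union, Finset.coe_insert, Finset.coe_singleton,
            SimpleGraph.coe_edgeFinset]
        · have := split _ _ v a b c hctx nv nw nz hvw.symm ha hb hc hab hbc hac (by
            rw [SimpleGraph.mem_edgeFinset]; exact hadj) hP
          convert this
          apply Finset.coe_injective
          rw [SimpleGraph.coe_edgeFinset, he]
          simp only [Finset.coe_union, Finset.coe_insert, Finset.coe_singleton, Finset.coe_sdiff,
            SimpleGraph.coe_edgeFinset]
        · have := delta _ _ v a hctx nv nw nz hvw.symm ha hP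
          convert this
          apply Finset.coe_injective
          rw [SimpleGraph.coe_edgeFinset, he]
          simp only [Finset.coe_union, Finset.coe_insert, Finset.coe_singleton,
            SimpleGraph.coe_edgeFinset]
      · intro u hu
        rw [hS, Finset.mem_union] at hu
        rcases hu with hu | hu
        · exact hfree u hu
        · simp only [Finset.mem_insert, Finset.mem_singleton] at hu
          rcases hu with h | h | h <;> subst h
          · exact hvw.symm
          · exact hwz.symm
          · rw [hzv]; exact hvz
  obtain ⟨m1, m2⟩ := main k le_rfl
  obtain ⟨i1, i2, i3⟩ := h4 k le_rfl
  rw [h6] at m1 m2 i1 i2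
  rw [h7] at i2 i3
  refine ⟨?_, i1, m2, ?_, ?_⟩
  · convert m1
    exact h7.symm
  · intro a b h
    rw [SimpleGraph.mem_edgeFinset, SimpleGraph.mem_edgeSet] at h
    exact ⟨(i2 a b h).1, (i2 a b h).2, h.ne⟩
  · intro e he
    induction e using Sym2.ind with | _ a b =>
    rw [SimpleGraph.mem_edgeFinset, SimpleGraph.mem_edgeSet] at he
    rw [Sym2.map_mk, SimpleGraph.mem_edgeFinset, SimpleGraph.mem_edgeSet]
    exact i3 _ _ he

/-! single (non-symmetric) steps and edge counts -/

def fresh (v : V) (E : Finset (Sym2 V)) : Prop := ∀ e ∈ E, v ∉ e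

theorem Ctx.fresh {g : V → V} {S : Finset V} {E : Finset (Sym2 V)} (h : Ctx g S E) {v : V}
    (hv : v ∉ S) : fresh v E := by
  intro e he hve
  induction e using Sym2.ind with | _ a b =>
  have := h.sub a b he
  rcases Sym2.mem_iff.1 hve with h | h <;> subst h <;> tauto

def ext2 (E : Finset (Sym2 V)) (v a b : V) : Finset (Sym2 V) := insert s(v, a) (insert s(v, b) E)

def ext3 (E : Finset (Sym2 V)) (v a b c : V) : Finset (Sym2 V) :=
  insert s(v, a) (insert s(v, b) (insert s(v, c) (E.erase s(a, b))))

theorem fresh_ext2 {E : Finset (Sym2 V)} {v a b x : V} (h : fresh x E) (h1 : x ≠ v) (h2 : x ≠ a)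
    (h3 : x ≠ b) : fresh x (ext2 E v a b) := by
  intro e he
  simp only [ext2, Finset.mem_insert] at he
  rcases he with he | he | he
  · subst he; simp [h1, h2]
  · subst he; simp [h1, h3]
  · exact h e he

theorem fresh_ext3 {E : Finset (Sym2 V)} {v a b c x : V} (h : fresh x E) (h1 : x ≠ v) (h2 : x ≠ a)
    (h3 : x ≠ b) (h4 : x ≠ c) : fresh x (ext3 E v a b c) := by
  intro e he
  simp only [ext3, Finset.mem_insert, Finset.mem_erase] at he
  rcases he with he | he | he | he
  · subst he; simp [h1, h2]
  · subst he; simp [h1, h3]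
  · subst he; simp [h1, h4]
  · exact h e he.2

theorem fresh_notMem {E : Finset (Sym2 V)} {v : V} (h : fresh v E) (x : V) : s(v, x) ∉ E :=
  fun hm => h _ hm (by simp)

theorem card_ext2 {E : Finset (Sym2 V)} {v a b : V} (h : fresh v E) (hab : a ≠ b) :
    (ext2 E v a b).card = E.card + 2 := by
  unfold ext2
  rw [Finset.card_insert_of_notMem, Finset.card_insert_of_notMem (fresh_notMem h b)]
  rw [Finset.mem_insert]
  rintro (h' | h')
  · exact hab (Sym2.congr_right.1 h')
  · exact fresh_notMem h a h'

theorem card_ext3 {E : Finset (Sym2 V)} {v a b c : V} (h : fresh v E) (hab : a ≠ b) (hbc : b ≠ c)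
    (hac : a ≠ c) (he : s(a, b) ∈ E) : (ext3 E v a b c).card = E.card + 2 := by
  have n : ∀ x, s(v, x) ∉ E.erase s(a, b) := fun x hx => fresh_notMem h x (Finset.mem_of_mem_erase hx)
  unfold ext3
  rw [Finset.card_insert_of_notMem, Finset.card_insert_of_notMem,
    Finset.card_insert_of_notMem (n c), Finset.card_erase_of_mem he]
  · have := Finset.card_pos.2 ⟨_, he⟩
    omega
  · rw [Finset.mem_insert]
    rintro (h' | h')
    · exact hbc (Sym2.congr_right.1 h')
    · exact n _ h'
  · rw [Finset.mem_insert, Finset.mem_insert]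
    rintro (h' | h' | h')
    · exact hab (Sym2.congr_right.1 h')
    · exact hac (Sym2.congr_right.1 h')
    · exact n _ h'

/-- Unfold the symmetric vertex addition into three single ones. -/
theorem vadd_eq (g : V → V) (E : Finset (Sym2 V)) (v a b : V) :
    E ∪ {s(v, a), s(v, b), s(g v, g a), s(g v, g b), s(g (g v), g (g a)), s(g (g v), g (g b))} =
    ext2 (ext2 (ext2 E v a b) (g v) (g a) (g b)) (g (g v)) (g (g a)) (g (g b)) := by
  ext e
  simp only [ext2, Finset.mem_union, Finset.mem_insert, Finset.mem_singleton]
  tauto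

theorem free3 {g : V → V} (hg : ∀ v, g (g (g v)) = v) {v : V} (h : g v ≠ v) :
    g (g v) ≠ v ∧ g (g v) ≠ g v := by
  constructor
  · intro h'
    apply h
    have := congrArg g h'
    rw [hg] at this
    exact this.symm
  · intro h'; exact h (inj_of_three hg h')

theorem orb_ne {g : V → V} (hg : ∀ v, g (g (g v)) = v) {S : Finset V} {E : Finset (Sym2 V)}
    (c : Ctx g S E) {a b : V} (ha : a ∈ S) (hb : b ∈ S) :
    s(g a, g b) ≠ s(a, b) ∧ s(g (g a), g (g b)) ≠ s(a, b) ∧ s(g (g a), g (g b)) ≠ s(g a, g b) := by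
  have hmf : ∀ x ∈ S, ∀ y ∈ S, s(g x, g y) ≠ s(x, y) := by
    intro x hx y hy
    apply map_free hg s(x, y)
    intro u hu
    rcases Sym2.mem_iff.1 hu with h | h <;> subst h
    exacts [c.free _ hx, c.free _ hy]
  refine ⟨hmf a ha b hb, ?_, hmf _ (c.inv a ha) _ (c.inv b hb)⟩
  have := hmf _ (c.inv _ (c.inv a ha)) _ (c.inv _ (c.inv b hb))
  rw [hg, hg] at this
  exact this.symm

theorem split_eq {g : V → V} (hg : ∀ v, g (g (g v)) = v) {S : Finset V} {E : Finset (Sym2 V)}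
    (ctx : Ctx g S E) {v a b c : V} (hv : v ∉ S) (hv1 : g v ∉ S) (hv2 : g (g v) ∉ S)
    (ha : a ∈ S) (hb : b ∈ S) :
    ((E \ {s(a, b), s(g a, g b), s(g (g a), g (g b))}) ∪
          {s(v, a), s(v, b), s(v, c), s(g v, g a), s(g v, g b), s(g v, g c),
            s(g (g v), g (g a)), s(g (g v), g (g b)), s(g (g v), g (g c))}) =
    ext3 (ext3 (ext3 E v a b c) (g v) (g a) (g b) (g c)) (g (g v)) (g (g a)) (g (g b)) (g (g c)) := by
  have key : ∀ u, u ∉ S → ∀ x, s(u, x) ≠ s(g a, g b) ∧ s(u, x) ≠ s(g (g a), g (g b)) := by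
    intro u hu x
    have h1 := ctx.inv a ha
    have h2 := ctx.inv b hb
    have h3 := ctx.inv _ h1
    have h4 := ctx.inv _ h2
    simp only [ne_eq, Sym2.eq_iff]
    grind
  have k0 := key v hv
  have k1 := key _ hv1
  ext e
  simp only [ext3, Finset.mem_union, Finset.mem_insert, Finset.mem_singleton, Finset.mem_erase,
    Finset.mem_sdiff]
  constructor
  · rintro (h | h | h | h | h | h | h | h | h | h)
    · push Not at h
      simp [h]
    all_goals subst h; simp [k0, k1]
  · rintro (h | h | h | ⟨h, h' | h' | h' | ⟨h', h'' | h'' | h'' | h''⟩⟩)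
    all_goals tauto

theorem card_step {g : V → V} (hg : ∀ v, g (g (g v)) = v) {S : Finset V} {v : V}
    (hv : v ∉ S) (hv1 : g v ∉ S) (hv2 : g (g v) ∉ S) (hf : g v ≠ v) :
    (S ∪ {v, g v, g (g v)}).card = S.card + 3 := by
  have h := free3 hg hf
  rw [Finset.card_union_of_disjoint, Finset.card_eq_three.2 ⟨_, _, _, hf.symm, h.1.symm, h.2.symm, rfl⟩]
  rw [Finset.disjoint_right]
  intro x hx
  simp only [Finset.mem_insert, Finset.mem_singleton] at hx
  rcases hx with h | h | h <;> subst h <;> assumption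

open Classical in
theorem seq_card {g : V → V} (hg : ∀ v, g (g (g v)) = v) (G : SimpleGraph V)
    (h : C3ConstructionSeq G g) : G.edgeFinset.card + 3 = 2 * (Finset.univ : Finset V).card := by
  refine (seq_induct hg (fun S E => E.card + 3 = 2 * S.card) ?_ ?_ ?_ ?_ G h).1
  · intro x hx
    have h := free3 hg hx
    rw [Finset.card_eq_three.2 ⟨x, _, _, hx.symm, h.1.symm, h.2.symm, rfl⟩]
    rw [Finset.card_eq_three.2 ⟨s(x, g x), _, _, ?_, ?_, ?_, rfl⟩]
    all_goals
      simp only [ne_eq, Sym2.eq_iff]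
      grind
  · intro S E v a b ctx hv hv1 hv2 hf ha hb hab ih
    have h := free3 hg hf
    have hgi := inj_of_three hg
    have n0 : ∀ u ∉ S, ∀ x ∈ S, u ≠ x := fun u hu x hx h => hu (h ▸ hx)
    have a1 := ctx.inv a ha
    have b1 := ctx.inv b hb
    rw [vadd_eq, card_step hg hv hv1 hv2 hf, card_ext2, card_ext2, card_ext2, ← add_right_inj 6]
    · omega
    · exact ctx.fresh hv
    · exact hab
    · exact fresh_ext2 (ctx.fresh hv1) hf (n0 _ hv1 _ ha) (n0 _ hv1 _ hb)
    · exact fun h => hab (hgi h)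
    · exact fresh_ext2 (fresh_ext2 (ctx.fresh hv2) h.1 (n0 _ hv2 _ ha) (n0 _ hv2 _ hb)) h.2
        (n0 _ hv2 _ a1) (n0 _ hv2 _ b1)
    · exact fun h => hab (hgi (hgi h))
  · intro S E v a b c ctx hv hv1 hv2 hf ha hb hc hab hbc hac he ih
    have h := free3 hg hf
    have hgi := inj_of_three hg
    have n0 : ∀ u ∉ S, ∀ x ∈ S, u ≠ x := fun u hu x hx h => hu (h ▸ hx)
    have a1 := ctx.inv a ha
    have b1 := ctx.inv b hb
    have c1 := ctx.inv c hc
    have o := orb_ne hg ctx ha hb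
    rw [split_eq hg ctx hv hv1 hv2 ha hb, card_step hg hv hv1 hv2 hf, card_ext3, card_ext3, card_ext3]
    · omega
    · exact ctx.fresh hv
    · exact hab
    · exact hbc
    · exact hac
    · exact he
    · exact fresh_ext3 (ctx.fresh hv1) hf (n0 _ hv1 _ ha) (n0 _ hv1 _ hb) (n0 _ hv1 _ hc)
    · exact fun h => hab (hgi h)
    · exact fun h => hbc (hgi h)
    · exact fun h => hac (hgi h)
    · have := ctx.einv _ he
      simp only [Sym2.map_mk] at this
      simp [ext3, this, o]
    · exact fresh_ext3 (fresh_ext3 (ctx.fresh hv2) h.1 (n0 _ hv2 _ ha) (n0 _ hv2 _ hb) (n0 _ hv2 _ hc))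
        h.2 (n0 _ hv2 _ a1) (n0 _ hv2 _ b1) (n0 _ hv2 _ c1)
    · exact fun h => hab (hgi (hgi h))
    · exact fun h => hbc (hgi (hgi h))
    · exact fun h => hac (hgi (hgi h))
    · have := ctx.einv _ (ctx.einv _ he)
      simp only [Sym2.map_mk] at this
      simp [ext3, this, o]
  · intro S E v a ctx hv hv1 hv2 hf ha ih
    have h := free3 hg hf
    have n0 : ∀ u ∉ S, ∀ x ∈ S, u ≠ x := fun u hu x hx h => hu (h ▸ hx)
    have a1 := ctx.inv a ha
    have a2 := ctx.inv _ a1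
    have f0 := fresh_notMem (ctx.fresh hv)
    have f1 := fresh_notMem (ctx.fresh hv1)
    have f2 := fresh_notMem (ctx.fresh hv2)
    have m := n0 _ hv
    have m1 := n0 _ hv1
    have m2 := n0 _ hv2
    rw [card_step hg hv hv1 hv2 hf, Finset.card_union_of_disjoint]
    · rw [Finset.card_insert_of_notMem, Finset.card_insert_of_notMem, Finset.card_insert_of_notMem,
        Finset.card_insert_of_notMem, Finset.card_insert_of_notMem, Finset.card_singleton]
      · omega
      all_goals
        simp only [Finset.mem_insert, Finset.mem_singleton, Sym2.eq_iff]
        grind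
    · rw [Finset.disjoint_right]
      intro e he
      simp only [Finset.mem_insert, Finset.mem_singleton] at he
      rcases he with h | h | h | h | h | h <;> subst h <;> simp [f0, f1, f2]

theorem R3_0 (x : Fin 2 → ℝ) : R3.mulVec x 0 = -(1/2) * x 0 - √3 / 2 * x 1 := by
  simp [R3, Matrix.mulVec, dotProduct, Fin.sum_univ_two]; ring

theorem R3_1 (x : Fin 2 → ℝ) : R3.mulVec x 1 = √3 / 2 * x 0 - (1/2) * x 1 := by
  simp [R3, Matrix.mulVec, dotProduct, Fin.sum_univ_two]; ring

theorem s3 : √3 * √3 = (3 : ℝ) := Real.mul_self_sqrt (by norm_num)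

def cr (x y : Fin 2 → ℝ) : ℝ := x 0 * y 1 - x 1 * y 0

theorem row_l (p : V → Fin 2 → ℝ) (u w : V) : rigidityRow p s(u, w) u = p u - p w := by
  ext i
  simp [rigidityRow]; ring

theorem row_r (p : V → Fin 2 → ℝ) (u w : V) : rigidityRow p s(u, w) w = p w - p u := by
  rw [Sym2.eq_swap, row_l]

theorem row_off (p : V → Fin 2 → ℝ) {e : Sym2 V} {x : V} (h : x ∉ e) : rigidityRow p e x = 0 := by
  simp [rigidityRow, h]

def SF (E : Finset (Sym2 V)) (p : V → Fin 2 → ℝ) : Prop :=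
  ∀ ω : Sym2 V → ℝ, ∑ e ∈ E, ω e • rigidityRow p e = 0 → ∀ e ∈ E, ω e = 0

theorem sum_fresh {E : Finset (Sym2 V)} {v : V} (h : fresh v E) (p : V → Fin 2 → ℝ) (ω : Sym2 V → ℝ) :
    (∑ e ∈ E, ω e • rigidityRow p e) v = 0 := by
  rw [Finset.sum_apply]
  apply Finset.sum_eq_zero
  intro e he
  rw [Pi.smul_apply, row_off p (h e he), smul_zero]

theorem cr_zero {x y : Fin 2 → ℝ} {a b : ℝ} (h : cr x y ≠ 0) (h0 : a * x 0 + b * y 0 = 0)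
    (h1 : a * x 1 + b * y 1 = 0) : a = 0 ∧ b = 0 := by
  unfold cr at h
  constructor
  · apply (mul_eq_zero.1 (show a * (x 0 * y 1 - x 1 * y 0) = 0 by
      linear_combination y 1 * h0 - y 0 * h1)).resolve_right h
  · apply (mul_eq_zero.1 (show b * (x 0 * y 1 - x 1 * y 0) = 0 by
      linear_combination x 0 * h1 - x 1 * h0)).resolve_right h

theorem sf_add2 {E : Finset (Sym2 V)} {p : V → Fin 2 → ℝ} {v a b : V} (hv : fresh v E)
    (hab : a ≠ b) (hc : cr (p v - p a) (p v - p b) ≠ 0) (h : SF E p) : SF (ext2 E v a b) p := by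
  intro ω hω
  have hva : a ≠ v := by
    rintro rfl; simp [cr] at hc
  have hvb : b ≠ v := by
    rintro rfl; simp [cr] at hc
  unfold ext2 at *
  rw [Finset.sum_insert, Finset.sum_insert (fresh_notMem hv b)] at hω
  · have h1 := congrFun hω v
    rw [Pi.add_apply, Pi.add_apply, sum_fresh hv, Pi.smul_apply, Pi.smul_apply, row_l, row_l] at h1
    obtain ⟨e1, e2⟩ := cr_zero hc (by simpa using congrFun h1 0) (by simpa using congrFun h1 1)
    rw [e1, e2, zero_smul, zero_smul, zero_add, zero_add] at hω
    have := h ω hω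
    intro e he
    simp only [Finset.mem_insert] at he
    rcases he with rfl | rfl | he
    exacts [e1, e2, this e he]
  · rw [Finset.mem_insert]
    rintro (h' | h')
    · exact hab (Sym2.congr_right.1 h')
    · exact fresh_notMem hv _ h'

theorem row_mid {p : V → Fin 2 → ℝ} {v a b : V} (hab : a ≠ b) (hva : v ≠ a) (hvb : v ≠ b)
    (hm : p v = (1/2 : ℝ) • (p a + p b)) :
    rigidityRow p s(v, a) + rigidityRow p s(v, b) = (1/2 : ℝ) • rigidityRow p s(a, b) := by
  funext x
  rw [Pi.add_apply, Pi.smul_apply]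
  by_cases h1 : x = v
  · subst h1
    rw [row_l, row_l, row_off p (e := s(a, b)) (by simp [hva, hvb]), hm]
    ext i; simp; ring
  by_cases h2 : x = a
  · subst h2
    rw [row_l, row_r, row_off p (e := s(v, b)) (by simp [h1, hab]), hm]
    ext i; simp; ring
  by_cases h3 : x = b
  · subst h3
    rw [row_r, row_r, row_off p (e := s(v, a)) (by simp [h1, h2]), hm]
    ext i; simp; ring
  rw [row_off p (by simp [h1, h2]), row_off p (by simp [h1, h3]), row_off p (by simp [h2, h3])]
  simp

theorem sf_split {E : Finset (Sym2 V)} {p : V → Fin 2 → ℝ} {v a b c : V} (hv : fresh v E)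
    (hab : a ≠ b) (hbc : b ≠ c) (hac : a ≠ c) (hva : v ≠ a) (hvb : v ≠ b)
    (he : s(a, b) ∈ E) (hm : p v = (1/2 : ℝ) • (p a + p b))
    (hc : cr (p a - p b) (p a - p c) ≠ 0) (h : SF E p) : SF (ext3 E v a b c) p := by
  intro ω hω
  have n : ∀ x, s(v, x) ∉ E.erase s(a, b) := fun x hx => fresh_notMem hv x (Finset.mem_of_mem_erase hx)
  have hv' : fresh v (E.erase s(a, b)) := fun e he => hv e (Finset.mem_of_mem_erase he)
  unfold ext3 at *
  rw [Finset.sum_insert, Finset.sum_insert, Finset.sum_insert (n c)] at hω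
  · have h1 := congrFun hω v
    rw [Pi.add_apply, Pi.add_apply, Pi.add_apply, sum_fresh hv', Pi.smul_apply, Pi.smul_apply,
      Pi.smul_apply, row_l, row_l, row_l, hm] at h1
    have h10 := congrFun h1 0
    have h11 := congrFun h1 1
    simp at h10 h11
    obtain ⟨e1, e2⟩ := cr_zero (a := (ω s(v, b) - ω s(v, a) - ω s(v, c)) / 2) (b := ω s(v, c)) hc
      (by simp; linear_combination h10) (by simp; linear_combination h11)
    rw [e2] at e1 hω
    have e3 : ω s(v, b) = ω s(v, a) := by linarith
    rw [e3, zero_smul, zero_add, ← add_assoc, ← smul_add, row_mid hab hva hvb hm] at hω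
    have h2 := h (Function.update ω s(a, b) (ω s(v, a) * (1/2))) (by
      rw [← Finset.add_sum_erase _ _ he, Function.update_self, mul_smul]
      rw [← hω]
      congr 1
      apply Finset.sum_congr rfl
      intro e he'
      rw [Function.update_of_ne (Finset.ne_of_mem_erase he')])
    have e4 := h2 _ he
    rw [Function.update_self] at e4
    have e5 : ω s(v, a) = 0 := by linarith
    intro e he'
    simp only [Finset.mem_insert] at he'
    rcases he' with rfl | rfl | rfl | he'
    · exact e5
    · rw [e3, e5]
    · exact e2
    · have := h2 e (Finset.mem_of_mem_erase he')
      rwa [Function.update_of_ne (Finset.ne_of_mem_erase he')] at this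
  · rw [Finset.mem_insert]
    rintro (h' | h')
    · exact hbc (Sym2.congr_right.1 h')
    · exact n _ h'
  · rw [Finset.mem_insert, Finset.mem_insert]
    rintro (h' | h' | h')
    · exact hab (Sym2.congr_right.1 h')
    · exact hac (Sym2.congr_right.1 h')
    · exact n _ h'

theorem sq_pos_of_cr {a b c d : ℝ} (hc : a * d - b * c ≠ 0) :
    a ^ 2 + b ^ 2 ≠ 0 ∧ (a - c) ^ 2 + (b - d) ^ 2 ≠ 0 := by
  constructor
  · intro h
    have h1 : a = 0 := pow_eq_zero_iff (two_ne_zero) |>.1 (by nlinarith [sq_nonneg a, sq_nonneg b])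
    have h2 : b = 0 := pow_eq_zero_iff (two_ne_zero) |>.1 (by nlinarith [sq_nonneg a, sq_nonneg b])
    apply hc; rw [h1, h2]; ring
  · intro h
    have h1 : a - c = 0 := pow_eq_zero_iff (two_ne_zero) |>.1
      (by nlinarith [sq_nonneg (a - c), sq_nonneg (b - d)])
    have h2 : b - d = 0 := pow_eq_zero_iff (two_ne_zero) |>.1
      (by nlinarith [sq_nonneg (a - c), sq_nonneg (b - d)])
    apply hc; rw [sub_eq_zero.1 h1, sub_eq_zero.1 h2]; ring

theorem delta_alg1 {a b c d s α β κ : ℝ} (ss : s * s = 3) (hs : s ≠ 0) (hc : a * d - b * c ≠ 0)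
    (f0 : (α - κ) * (a - c) + (β - κ) * (-(1/2) * (a - c) - s / 2 * (b - d)) = 0)
    (f1 : (α - κ) * (b - d) + (β - κ) * (s / 2 * (a - c) - (1/2) * (b - d)) = 0)
    (tq : (α + β + κ) * (a * d - b * c) = 0) : α = 0 ∧ β = 0 ∧ κ = 0 := by
  have hu := (sq_pos_of_cr hc).2
  have h1 : β - κ = 0 := by
    have : (β - κ) * (s / 2 * ((a - c) ^ 2 + (b - d) ^ 2)) = 0 := by
      linear_combination (a - c) * f1 - (b - d) * f0
    exact (mul_eq_zero.1 this).resolve_right (mul_ne_zero (div_ne_zero hs two_ne_zero) hu)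
  have h2 : α - κ = 0 := by
    have : (α - κ) * ((a - c) ^ 2 + (b - d) ^ 2) = 0 := by
      rw [h1] at f0 f1
      linear_combination (a - c) * f0 + (b - d) * f1
    exact (mul_eq_zero.1 this).resolve_right hu
  have h3 := (mul_eq_zero.1 tq).resolve_right hc
  refine ⟨?_, ?_, ?_⟩ <;> linarith

theorem delta_alg {pv pa : Fin 2 → ℝ} {x y z α β κ : ℝ} (hc : cr pv pa ≠ 0)
    (ev : x • (pv - R3.mulVec pv) + z • (pv - R3.mulVec (R3.mulVec pv)) + α • (pv - pa) = 0)
    (ew : x • (R3.mulVec pv - pv) + y • (R3.mulVec pv - R3.mulVec (R3.mulVec pv))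
      + β • (R3.mulVec pv - R3.mulVec pa) = 0)
    (ez : y • (R3.mulVec (R3.mulVec pv) - R3.mulVec pv) + z • (R3.mulVec (R3.mulVec pv) - pv)
      + κ • (R3.mulVec (R3.mulVec pv) - R3.mulVec (R3.mulVec pa)) = 0) :
    x = 0 ∧ y = 0 ∧ z = 0 ∧ α = 0 ∧ β = 0 ∧ κ = 0 := by
  have v0 := congrFun ev 0
  have v1 := congrFun ev 1
  have w0 := congrFun ew 0
  have w1 := congrFun ew 1
  have z0 := congrFun ez 0
  have z1 := congrFun ez 1
  clear ev ew ez
  simp only [Pi.add_apply, Pi.smul_apply, Pi.sub_apply, smul_eq_mul, R3_0, R3_1, Pi.zero_apply]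
    at v0 v1 w0 w1 z0 z1
  unfold cr at hc
  have hs0 : √3 ≠ (0:ℝ) := by positivity
  have ss := s3
  generalize √3 = s at *
  generalize pv 0 = a at *
  generalize pv 1 = b at *
  generalize pa 0 = c at *
  generalize pa 1 = d at *
  obtain ⟨k3, k2, k1⟩ : α = 0 ∧ β = 0 ∧ κ = 0 := by
    apply delta_alg1 ss hs0 hc
    · linear_combination v0 + w0 + z0 + κ / 4 * (a - c) * ss
    · linear_combination v1 + w1 + z1 + κ / 4 * (b - d) * ss
    · linear_combination b * v0 - a * v1 + (s / 2 * a - (1/2) * b) * w0 - (-(1/2) * a - s / 2 * b) * w1 +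
        (s / 2 * (-(1/2) * a - s / 2 * b) - (1/2) * (s / 2 * a - (1/2) * b)) * z0
        - (-(1/2) * (-(1/2) * a - s / 2 * b) - s / 2 * (s / 2 * a - (1/2) * b)) * z1
        + (-(β / 4) - κ * (s * s + 5) / 16) * (a * d - b * c) * ss
  have hp := (sq_pos_of_cr hc).1
  rw [k3] at v0 v1
  rw [k2] at w0 w1
  have hx : x = 0 := by
    have : x * (s * (a ^ 2 + b ^ 2)) = 0 := by
      linear_combination 2/3 * ((3/2*b + s/2*a) * (v0 - z*a/4*ss) - (3/2*a - s/2*b) * (v1 - z*b/4*ss))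
    exact (mul_eq_zero.1 this).resolve_right (mul_ne_zero hs0 hp)
  have hz : z = 0 := by
    have : z * (s * (a ^ 2 + b ^ 2)) = 0 := by
      linear_combination 2/3 * ((3/2*a + s/2*b) * (v1 - z*b/4*ss) - (3/2*b - s/2*a) * (v0 - z*a/4*ss))
    exact (mul_eq_zero.1 this).resolve_right (mul_ne_zero hs0 hp)
  refine ⟨hx, ?_, hz, k3, k2, k1⟩
  rw [hx] at w0 w1
  have : y * (s * (a ^ 2 + b ^ 2)) = 0 := by
    linear_combination a * w1 - b * w0 +  0 * ss
  exact (mul_eq_zero.1 this).resolve_right (mul_ne_zero hs0 hp)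

theorem sf_delta {g : V → V} (hg : ∀ v, g (g (g v)) = v) {S : Finset V} {E : Finset (Sym2 V)}
    (ctx : Ctx g S E) {v a : V} (hv : v ∉ S) (hv1 : g v ∉ S) (hv2 : g (g v) ∉ S) (hf : g v ≠ v)
    (ha : a ∈ S) {p : V → Fin 2 → ℝ} (hp : ∀ x, p (g x) = R3.mulVec (p x))
    (hc : cr (p v) (p a) ≠ 0) (h : SF E p) :
    SF (E ∪ {s(v, g v), s(g v, g (g v)), s(g (g v), v), s(v, a), s(g v, g a), s(g (g v), g (g a))}) p := by
  intro ω hω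
  have h3 := free3 hg hf
  have f0 := ctx.fresh hv
  have f1 := ctx.fresh hv1
  have f2 := ctx.fresh hv2
  have ha1 := ctx.inv _ ha
  have ha2 := ctx.inv _ ha1
  have hE : E ∪ {s(v, g v), s(g v, g (g v)), s(g (g v), v), s(v, a), s(g v, g a), s(g (g v), g (g a))}
      = insert s(v, g v) (insert s(g v, g (g v)) (insert s(g (g v), v) (insert s(v, a) (insert s(g v, g a)
        (insert s(g (g v), g (g a)) E))))) := by
    ext e; simp only [Finset.mem_union, Finset.mem_insert, Finset.mem_singleton]; tauto
  have n0 := fresh_notMem f0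
  have n1 := fresh_notMem f1
  have n2 := fresh_notMem f2
  have hgv : v ≠ g v := hf.symm
  have hgz : v ≠ g (g v) := h3.1.symm
  have hgw : g v ≠ g (g v) := h3.2.symm
  have b0 : v ≠ a := fun h => hv (h ▸ ha)
  have b1 : v ≠ g a := fun h => hv (h ▸ ha1)
  have b2 : v ≠ g (g a) := fun h => hv (h ▸ ha2)
  have c0 : g v ≠ a := fun h => hv1 (h ▸ ha)
  have c1 : g v ≠ g a := fun h => hv1 (h ▸ ha1)
  have c2 : g v ≠ g (g a) := fun h => hv1 (h ▸ ha2)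
  have d0 : g (g v) ≠ a := fun h => hv2 (h ▸ ha)
  have d1 : g (g v) ≠ g a := fun h => hv2 (h ▸ ha1)
  have d2 : g (g v) ≠ g (g a) := fun h => hv2 (h ▸ ha2)
  rw [hE] at hω ⊢
  rw [Finset.sum_insert, Finset.sum_insert, Finset.sum_insert, Finset.sum_insert, Finset.sum_insert,
    Finset.sum_insert (n2 _)] at hω
  · have ev := congrFun hω v
    have ew := congrFun hω (g v)
    have ez := congrFun hω (g (g v))
    simp only [Pi.add_apply, Pi.smul_apply] at ev ew ez
    rw [sum_fresh f0, row_l, row_l, row_r, row_off p (e := s(g v, g (g v))) (by simp [*]),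
      row_off p (e := s(g v, g a)) (by simp [*]),
      row_off p (e := s(g (g v), g (g a))) (by simp [*]), hp (g v), hp v] at ev
    rw [sum_fresh f1, row_l, row_l, row_r, row_off p (e := s(g (g v), v)) (by simp [*]),
      row_off p (e := s(v, a)) (by simp [*]),
      row_off p (e := s(g (g v), g (g a))) (by simp [*]), hp (g v), hp v, hp a] at ew
    rw [sum_fresh f2, row_l, row_l, row_r, row_off p (e := s(v, g v)) (by simp [*]),
      row_off p (e := s(v, a)) (by simp [*]),
      row_off p (e := s(g v, g a)) (by simp [*]), hp (g v), hp v, hp (g a), hp a] at ez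
    simp only [smul_zero, add_zero, zero_add, Pi.zero_apply, ← add_assoc] at ev ew ez
    obtain ⟨x1, x2, x3, x4, x5, x6⟩ := delta_alg hc ev ew ez
    rw [x1, x2, x3, x4, x5, x6] at hω
    simp only [zero_smul, zero_add] at hω
    have := h ω hω
    intro e he
    simp only [Finset.mem_insert] at he
    rcases he with rfl | rfl | rfl | rfl | rfl | rfl | he
    exacts [x1, x2, x3, x4, x5, x6, this e he]
  all_goals
    simp only [Finset.mem_insert, n0, n1, n2, or_false, Sym2.eq_iff]
    grind

structure Gen (p : V → Fin 2 → ℝ) : Prop where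
  two : ∀ u v, u ≠ v → cr (p u) (p v) ≠ 0
  three : ∀ u v w, u ≠ v → u ≠ w → v ≠ w → cr (p u - p v) (p u - p w) ≠ 0

theorem sf_iff (E : Finset (Sym2 V)) (p : V → Fin 2 → ℝ) :
    SF E p ↔ LinearIndependent ℝ (fun e : E => rigidityRow p (e : Sym2 V)) := by
  change _ ↔ LinearIndepOn ℝ (fun e => rigidityRow p e) (E : Set (Sym2 V))
  rw [linearIndepOn_finset_iff]
  rfl

theorem quad_ev (A B C : ℝ) (hC : C ≠ 0) :
    ∀ᶠ t in nhdsWithin (0 : ℝ) {0}ᶜ, A + B * t + C * t ^ 2 ≠ 0 := by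
  have hfin : {t : ℝ | A + B * t + C * t ^ 2 = 0}.Finite := by
    let P : Polynomial ℝ := Polynomial.C A + Polynomial.C B * Polynomial.X + Polynomial.C C * Polynomial.X ^ 2
    have hP : P ≠ 0 := by
      intro h
      have := congrArg (fun q => Polynomial.coeff q 2) h
      simp [P, Polynomial.coeff_X, Polynomial.coeff_C] at this
      exact hC this
    apply (P.roots.toFinset.finite_toSet).subset
    intro t ht
    simp only [Finset.mem_coe, Multiset.mem_toFinset, Polynomial.mem_roots hP, Polynomial.IsRoot]
    simpa [P] using ht
  have h1 : IsClosed ({t : ℝ | A + B * t + C * t ^ 2 = 0} \ {0}) := (hfin.subset Set.diff_subset).isClosed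
  have h2 : ({t : ℝ | A + B * t + C * t ^ 2 = 0} \ {0})ᶜ ∈ nhds (0 : ℝ) := h1.isOpen_compl.mem_nhds (by simp)
  filter_upwards [nhdsWithin_le_nhds h2, self_mem_nhdsWithin] with t ht ht0 h
  exact ht ⟨h, ht0⟩

theorem perturb {g : V → V} {E : Finset (Sym2 V)} {p q : V → Fin 2 → ℝ}
    (hp : ∀ x, p (g x) = R3.mulVec (p x)) (hq : ∀ x, q (g x) = R3.mulVec (q x)) (hgen : Gen q)
    (h : SF E p) : ∃ p' : V → Fin 2 → ℝ, (∀ x, p' (g x) = R3.mulVec (p' x)) ∧ SF E p' ∧ Gen p' := by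
  have ev1 : ∀ᶠ t in nhds (0 : ℝ), SF E (p + t • q) := by
    have hcont : Continuous (fun t : ℝ => fun e : E => rigidityRow (p + t • q) (e : Sym2 V)) := by
      refine continuous_pi fun e => continuous_pi fun x => ?_
      obtain ⟨e, he⟩ := e
      induction e using Sym2.ind with | _ a b =>
      unfold rigidityRow
      by_cases hx : x ∈ s(a, b)
      · simp only [hx, if_true, Sym2.lift_mk, Pi.add_apply, Pi.smul_apply]
        fun_prop
      · simp only [hx, if_false]
        fun_prop
    have ho := (isOpen_setOf_linearIndependent (𝕜 := ℝ) (E := V → Fin 2 → ℝ) (ι := E)).preimage hcont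
    have := ho.mem_nhds (x := (0 : ℝ)) (by
      simp only [Set.mem_preimage, Set.mem_setOf_eq]
      simpa using (sf_iff E p).1 h)
    filter_upwards [this] with t ht
    exact (sf_iff _ _).2 ht
  have ev2 : ∀ᶠ t in nhdsWithin (0 : ℝ) {0}ᶜ, ∀ u v, u ≠ v → cr ((p + t • q) u) ((p + t • q) v) ≠ 0 := by
    simp only [Filter.eventually_all]
    intro u v huv
    filter_upwards [quad_ev (cr (p u) (p v)) (cr (p u) (q v) + cr (q u) (p v)) _ (hgen.two u v huv)] with t ht h
    apply ht; rw [← h]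
    simp [cr]; ring
  have ev3 : ∀ᶠ t in nhdsWithin (0 : ℝ) {0}ᶜ, ∀ u v w, u ≠ v → u ≠ w → v ≠ w →
      cr ((p + t • q) u - (p + t • q) v) ((p + t • q) u - (p + t • q) w) ≠ 0 := by
    simp only [Filter.eventually_all]
    intro u v w huv huw hvw
    filter_upwards [quad_ev (cr (p u - p v) (p u - p w))
      (cr (p u - p v) (q u - q w) + cr (q u - q v) (p u - p w)) _ (hgen.three u v w huv huw hvw)] with t ht h
    apply ht; rw [← h]
    simp [cr]; ring
  obtain ⟨t, ⟨h1, h2⟩, h3⟩ := (((ev1.filter_mono nhdsWithin_le_nhds).and ev2).and ev3).exists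
  refine ⟨p + t • q, ?_, h1, ⟨h2, h3⟩⟩
  intro x
  simp only [Pi.add_apply, Pi.smul_apply, hp, hq, Matrix.mulVec_add, Matrix.mulVec_smul]

theorem circ_gen {θ : V → ℝ} (h : ∀ u v, u ≠ v → Real.sin (θ v - θ u) ≠ 0) :
    Gen (fun v => ![Real.cos (θ v), Real.sin (θ v)]) := by
  have hh : ∀ u v, u ≠ v → Real.sin ((θ v - θ u) / 2) ≠ 0 := by
    intro u v huv h0
    apply h u v huv
    have := Real.sin_two_mul ((θ v - θ u) / 2)
    rw [h0, mul_div_cancel₀ _ two_ne_zero] at this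
    rw [this]; ring
  constructor
  · intro u v huv
    have := h u v huv
    rw [Real.sin_sub] at this
    simp only [cr, Matrix.cons_val_zero, Matrix.cons_val_one]
    contrapose! this
    linear_combination this
  · intro u v w huv huw hvw
    simp only [cr, Pi.sub_apply, Matrix.cons_val_zero, Matrix.cons_val_one, Real.cos_sub_cos,
      Real.sin_sub_sin]
    have h1 := hh v u huv.symm
    have h2 := hh w u huw.symm
    have h3 := hh v w hvw
    have e : (θ w - θ v) / 2 = (θ u + θ w) / 2 - (θ u + θ v) / 2 := by ring
    rw [e, Real.sin_sub] at h3
    intro h0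
    apply mul_ne_zero (mul_ne_zero h1 h2) h3
    linear_combination (1/4) * h0

theorem exists_gen {g : V → V} (hg : ∀ v, g (g (g v)) = v) (hf : ∀ v, g v ≠ v) :
    ∃ q : V → Fin 2 → ℝ, (∀ x, q (g x) = R3.mulVec (q x)) ∧ Gen q := by
  obtain ⟨r, r1, r2⟩ := exists_rep g hg
  let l : V → ℤ := fun v => ((Fintype.equivFin V (r v) : ℕ) : ℤ)
  let M : ℤ := Fintype.card V
  let k : V → ℤ := fun v => if r v = v then 0 else if g (r v) = v then 1 else 2
  have hl0 : ∀ v, 0 ≤ l v ∧ l v < M := fun v =>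
    ⟨by positivity, by simp only [l, M]; exact_mod_cast (Fintype.equivFin V (r v)).2⟩
  have hlg : ∀ v, l (g v) = l v := fun v => by simp only [l, r1]
  have hli : ∀ u v, l u = l v → r u = r v := fun u v h => by
    simp only [l] at h
    exact (Fintype.equivFin V).injective (Fin.ext (by exact_mod_cast h))
  have hk : ∀ v, 0 ≤ k v ∧ k v ≤ 2 := by intro v; simp only [k]; split_ifs <;> omega
  have hkg : ∀ v, k (g v) = k v + 1 ∨ k (g v) = k v - 2 := by
    intro v
    have := r2 v
    have := r1 v
    have := hg v
    have := hf v
    have := free3 hg (hf v)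
    have := hg (g v)
    simp only [k]
    grind
  have hkl : ∀ u v, r u = r v → k u = k v → u = v := by
    intro u v
    have := r2 v
    have := r2 u
    have := hg v
    have := hg u
    simp only [k]
    grind
  let θ : V → ℝ := fun v => 2 * Real.pi / 3 * k v + Real.pi / (3 * M) * l v
  refine ⟨fun v => ![Real.cos (θ v), Real.sin (θ v)], ?_, circ_gen ?_⟩
  · intro v
    have hc : Real.cos (2 * Real.pi / 3) = - (1/2) := by
      rw [show 2 * Real.pi / 3 = Real.pi - Real.pi / 3 by ring, Real.cos_pi_sub, Real.cos_pi_div_three]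
    have hs : Real.sin (2 * Real.pi / 3) = √3 / 2 := by
      rw [show 2 * Real.pi / 3 = Real.pi - Real.pi / 3 by ring, Real.sin_pi_sub, Real.sin_pi_div_three]
    have key : Real.cos (θ (g v)) = Real.cos (θ v + 2 * Real.pi / 3) ∧
        Real.sin (θ (g v)) = Real.sin (θ v + 2 * Real.pi / 3) := by
      rcases hkg v with h | h
      · have : θ (g v) = θ v + 2 * Real.pi / 3 := by
          simp only [θ, hlg, h]; push_cast; ring
        rw [this]; simp
      · have : θ (g v) = θ v + 2 * Real.pi / 3 - 2 * Real.pi := by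
          simp only [θ, hlg, h]; push_cast; ring
        rw [this, Real.cos_sub_two_pi, Real.sin_sub_two_pi]; simp
    ext i
    fin_cases i
    · change Real.cos (θ (g v)) = R3.mulVec _ 0
      rw [R3_0, key.1, Real.cos_add, hc, hs]
      simp; ring
    · change Real.sin (θ (g v)) = R3.mulVec _ 1
      rw [R3_1, key.2, Real.sin_add, hc, hs]
      simp; ring
  · intro u v huv h0
    rw [Real.sin_eq_zero_iff] at h0
    obtain ⟨n, hn⟩ := h0
    have hM : 0 < M := by have := hl0 u; omega
    have hM' : (M : ℝ) ≠ 0 := by exact_mod_cast hM.ne'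
    have e : n * (3 * M) = 2 * M * (k v - k u) + (l v - l u) := by
      have : (n : ℝ) * (3 * M) = 2 * M * (k v - k u) + (l v - l u) := by
        have hpi := Real.pi_ne_zero
        simp only [θ] at hn
        field_simp at hn
        linear_combination hn
      exact_mod_cast this
    have := hl0 u
    have := hl0 v
    have := hk u
    have := hk v
    have hd : M ∣ (l v - l u) := ⟨3 * n - 2 * (k v - k u), by linear_combination -e⟩
    have hl : l v - l u = 0 := Int.eq_zero_of_abs_lt_dvd hd (by rw [abs_lt]; constructor <;> omega)
    have hkk : 3 * n = 2 * (k v - k u) := by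
      apply mul_left_cancel₀ hM.ne'
      rw [hl] at e
      linear_combination e
    exact huv (hkl u v (hli u v (by omega)) (by omega))

theorem sf_congr {E : Finset (Sym2 V)} {p p' : V → Fin 2 → ℝ}
    (hpp : ∀ a b, s(a, b) ∈ E → p a = p' a ∧ p b = p' b) (h : SF E p) : SF E p' := by
  intro ω hω
  apply h ω
  rw [← hω]
  apply Finset.sum_congr rfl
  intro e he
  congr 1
  induction e using Sym2.ind with | _ a b =>
  obtain ⟨h1, h2⟩ := hpp a b he
  funext x
  by_cases hxa : x = a
  · subst hxa; rw [row_l, row_l, h1, h2]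
  by_cases hxb : x = b
  · subst hxb; rw [row_r, row_r, h1, h2]
  rw [row_off _ (by simp [hxa, hxb]), row_off _ (by simp [hxa, hxb])]

theorem cr_ne_left {x y : Fin 2 → ℝ} (h : cr x y ≠ 0) : x ≠ 0 := by
  rintro rfl; simp [cr] at h

theorem sf_one {p : V → Fin 2 → ℝ} {u w : V} (h : p u ≠ p w) : SF {s(u, w)} p := by
  intro ω hω e he
  rw [Finset.sum_singleton] at hω
  rw [Finset.mem_singleton] at he; subst he
  have := congrFun hω u
  rw [Pi.smul_apply, row_l, Pi.zero_apply, smul_eq_zero] at this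
  exact this.resolve_right (sub_ne_zero.2 h)

theorem Gen.inj {p : V → Fin 2 → ℝ} (hp : Gen p) {u v : V} (h : u ≠ v) : p u ≠ p v := by
  intro he
  apply hp.two u v h
  rw [he]; simp [cr, mul_comm]

open Classical in
theorem seq_sf {g : V → V} (hg : ∀ v, g (g (g v)) = v) (G : SimpleGraph V)
    (h : C3ConstructionSeq G g) : ∃ p : V → Fin 2 → ℝ, (∀ x, p (g x) = R3.mulVec (p x)) ∧
      SF G.edgeFinset p ∧ Gen p := by
  have hfree : ∀ v, g v ≠ v := fun v =>
    (seq_induct hg (fun _ _ => True) (by simp) (by simp) (by simp) (by simp) G h).2.free v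
      (Finset.mem_univ v)
  obtain ⟨q, hq, hgen⟩ := exists_gen hg hfree
  refine (seq_induct hg (fun S E => ∃ p : V → Fin 2 → ℝ, (∀ x, p (g x) = R3.mulVec (p x)) ∧
      SF E p ∧ Gen p) ?_ ?_ ?_ ?_ G h).1
  · intro x hx
    refine ⟨q, hq, ?_, hgen⟩
    have h3 := free3 hg hx
    have : ({s(x, g x), s(g x, g (g x)), s(g (g x), x)} : Finset (Sym2 V)) =
        ext2 {s(g x, g (g x))} x (g x) (g (g x)) := by
      ext e
      simp only [ext2, Finset.mem_insert, Finset.mem_singleton]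
      rw [Sym2.eq_swap (a := g (g x))]
      tauto
    rw [this]
    apply sf_add2
    · intro e he
      rw [Finset.mem_singleton] at he; subst he
      simp [hx.symm, h3.1.symm]
    · exact h3.2.symm
    · exact hgen.three _ _ _ hx.symm h3.1.symm h3.2.symm
    · exact sf_one (hgen.inj h3.2.symm)
  · rintro S E v a b ctx hv hv1 hv2 hf ha hb hab ⟨p, hp, hsf, hgp⟩
    refine ⟨p, hp, ?_, hgp⟩
    have h := free3 hg hf
    have hgi := inj_of_three hg
    have n0 : ∀ u ∉ S, ∀ x ∈ S, u ≠ x := fun u hu x hx h => hu (h ▸ hx)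
    have a1 := ctx.inv a ha
    have b1 := ctx.inv b hb
    have a2 := ctx.inv _ a1
    have b2 := ctx.inv _ b1
    have hab1 : g a ≠ g b := fun h => hab (hgi h)
    have hab2 : g (g a) ≠ g (g b) := fun h => hab1 (hgi h)
    rw [vadd_eq]
    apply sf_add2 _ hab2 (hgp.three _ _ _ (n0 _ hv2 _ a2) (n0 _ hv2 _ b2) hab2)
    · apply sf_add2 _ hab1 (hgp.three _ _ _ (n0 _ hv1 _ a1) (n0 _ hv1 _ b1) hab1)
      · exact sf_add2 (ctx.fresh hv) hab (hgp.three _ _ _ (n0 _ hv _ ha) (n0 _ hv _ hb) hab) hsf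
      · exact fresh_ext2 (ctx.fresh hv1) hf (n0 _ hv1 _ ha) (n0 _ hv1 _ hb)
    · exact fresh_ext2 (fresh_ext2 (ctx.fresh hv2) h.1 (n0 _ hv2 _ ha) (n0 _ hv2 _ hb)) h.2
        (n0 _ hv2 _ a1) (n0 _ hv2 _ b1)
  · rintro S E v a b c ctx hv hv1 hv2 hf ha hb hc hab hbc hac he ⟨p, hp, hsf, hgp⟩
    have h := free3 hg hf
    have hgi := inj_of_three hg
    have n0 : ∀ u ∉ S, ∀ x ∈ S, u ≠ x := fun u hu x hx h => hu (h ▸ hx)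
    have a1 := ctx.inv a ha
    have b1 := ctx.inv b hb
    have c1 := ctx.inv c hc
    have a2 := ctx.inv _ a1
    have b2 := ctx.inv _ b1
    have c2 := ctx.inv _ c1
    have hab1 : g a ≠ g b := fun h => hab (hgi h)
    have hab2 : g (g a) ≠ g (g b) := fun h => hab1 (hgi h)
    have hbc1 : g b ≠ g c := fun h => hbc (hgi h)
    have hbc2 : g (g b) ≠ g (g c) := fun h => hbc1 (hgi h)
    have hac1 : g a ≠ g c := fun h => hac (hgi h)
    have hac2 : g (g a) ≠ g (g c) := fun h => hac1 (hgi h)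
    have o := orb_ne hg ctx ha hb
    let p' : V → Fin 2 → ℝ := fun x => if x = v then (1/2 : ℝ) • (p a + p b) else
      if x = g v then (1/2 : ℝ) • (p (g a) + p (g b)) else
      if x = g (g v) then (1/2 : ℝ) • (p (g (g a)) + p (g (g b))) else p x
    have pS : ∀ x ∈ S, p' x = p x := by
      intro x hx
      simp only [p', (n0 _ hv x hx).symm, (n0 _ hv1 x hx).symm, (n0 _ hv2 x hx).symm, if_false]
    have pv : p' v = (1/2 : ℝ) • (p a + p b) := by simp [p']
    have pv1 : p' (g v) = (1/2 : ℝ) • (p (g a) + p (g b)) := by simp [p', hf]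
    have pv2 : p' (g (g v)) = (1/2 : ℝ) • (p (g (g a)) + p (g (g b))) := by simp [p', h]
    have hp' : ∀ x, p' (g x) = R3.mulVec (p' x) := by
      intro x
      by_cases h1 : x = v
      · subst h1; rw [pv1, pv, Matrix.mulVec_smul, Matrix.mulVec_add, hp, hp]
      by_cases h2 : x = g v
      · subst h2; rw [pv1, pv2, Matrix.mulVec_smul, Matrix.mulVec_add, hp (g a), hp (g b)]
      by_cases h3 : x = g (g v)
      · subst h3; rw [pv2, hg, pv, Matrix.mulVec_smul, Matrix.mulVec_add, ← hp, ← hp, hg, hg]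
      · have e1 : g x ≠ v := fun e => h3 (by rw [← e, hg])
        have e2 : g x ≠ g v := fun e => h1 (hgi e)
        have e3 : g x ≠ g (g v) := fun e => h2 (hgi e)
        simp only [p', h1, h2, h3, e1, e2, e3, if_false, hp]
    have hsf' : SF E p' := sf_congr (fun x y hxy => by
      have := ctx.sub x y hxy
      rw [pS x this.1, pS y this.2.1]; simp) hsf
    have hgp' : ∀ x ∈ S, ∀ y ∈ S, ∀ z ∈ S, x ≠ y → x ≠ z → y ≠ z → cr (p' x - p' y) (p' x - p' z) ≠ 0 := by
      intro x hx y hy z hz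
      rw [pS x hx, pS y hy, pS z hz]
      exact hgp.three x y z
    apply perturb hp' hq hgen
    rw [split_eq hg ctx hv hv1 hv2 ha hb]
    apply sf_split _ hab2 hbc2 hac2 (n0 _ hv2 _ a2) (n0 _ hv2 _ b2) _
      (by rw [pv2, pS _ a2, pS _ b2]) (hgp' _ a2 _ b2 _ c2 hab2 hac2 hbc2)
    · apply sf_split _ hab1 hbc1 hac1 (n0 _ hv1 _ a1) (n0 _ hv1 _ b1) _
        (by rw [pv1, pS _ a1, pS _ b1]) (hgp' _ a1 _ b1 _ c1 hab1 hac1 hbc1)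
      · exact sf_split (ctx.fresh hv) hab hbc hac (n0 _ hv _ ha) (n0 _ hv _ hb) he
          (by rw [pv, pS _ ha, pS _ hb]) (hgp' _ ha _ hb _ hc hab hac hbc) hsf'
      · exact fresh_ext3 (ctx.fresh hv1) hf (n0 _ hv1 _ ha) (n0 _ hv1 _ hb) (n0 _ hv1 _ hc)
      · have := ctx.einv _ he
        simp only [Sym2.map_mk] at this
        simp [ext3, this, o]
    · exact fresh_ext3 (fresh_ext3 (ctx.fresh hv2) h.1 (n0 _ hv2 _ ha) (n0 _ hv2 _ hb) (n0 _ hv2 _ hc))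
        h.2 (n0 _ hv2 _ a1) (n0 _ hv2 _ b1) (n0 _ hv2 _ c1)
    · have := ctx.einv _ (ctx.einv _ he)
      simp only [Sym2.map_mk] at this
      simp [ext3, this, o]
  · rintro S E v a ctx hv hv1 hv2 hf ha ⟨p, hp, hsf, hgp⟩
    exact ⟨p, hp, sf_delta hg ctx hv hv1 hv2 hf ha hp (hgp.two _ _ (fun h => hv (h ▸ ha))) hsf, hgp⟩

/-! ### rank arguments -/

def Rm (F : Finset (Sym2 V)) (p : V → Fin 2 → ℝ) : (V → Fin 2 → ℝ) →ₗ[ℝ] (F → ℝ) where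
  toFun m e := ∑ x, rigidityRow p (e : Sym2 V) x ⬝ᵥ m x
  map_add' m m' := by
    funext e; simp [dotProduct_add, Finset.sum_add_distrib]
  map_smul' c m := by
    funext e; simp [dotProduct_smul, Finset.mul_sum]

theorem row_dot (p m : V → Fin 2 → ℝ) {u w : V} (h : u ≠ w) :
    ∑ x, rigidityRow p s(u, w) x ⬝ᵥ m x = (p u - p w) ⬝ᵥ (m u - m w) := by
  rw [← Finset.sum_subset (Finset.subset_univ {u, w}), Finset.sum_pair h, row_l, row_r]
  · simp [dotProduct, Fin.sum_univ_two]; ring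
  · intro x _ hx
    simp at hx
    rw [row_off _ (by simp [hx]), zero_dotProduct]

theorem Rm_surj {F : Finset (Sym2 V)} {p : V → Fin 2 → ℝ} (h : SF F p) :
    Function.Surjective (Rm F p) := by
  rw [← LinearMap.range_eq_top]
  by_contra hne
  obtain ⟨f, hf0, hf⟩ := Submodule.exists_le_ker_of_lt_top _ (lt_top_iff_ne_top.2 hne)
  apply hf0
  classical
  let ω : Sym2 V → ℝ := fun e => if he : e ∈ F then f (Pi.single ⟨e, he⟩ 1) else 0
  have hfe : ∀ y : F → ℝ, f y = ∑ e : F, y e * ω e := by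
    intro y
    rw [LinearMap.pi_apply_eq_sum_univ f y]
    apply Finset.sum_congr rfl
    intro e _
    simp only [ω, e.2, dif_pos, smul_eq_mul]
    congr 2
    ext j
    simp [Pi.single_apply, eq_comm]
  have h0 : ∑ e ∈ F, ω e • rigidityRow p e = 0 := by
    rw [← Finset.sum_coe_sort F (fun e => ω e • rigidityRow p e)]
    funext x
    ext i
    have := hf (LinearMap.mem_range_self (Rm F p) (Pi.single x (Pi.single i 1)))
    rw [LinearMap.mem_ker, hfe] at this
    simp only [Finset.sum_apply, Pi.smul_apply, smul_eq_mul, Pi.zero_apply]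
    rw [← this]
    apply Finset.sum_congr rfl
    intro e _
    simp only [Rm, LinearMap.coe_mk, AddHom.coe_mk]
    rw [Finset.sum_eq_single x]
    · simp [mul_comm]
    · intro y _ hy; simp [Pi.single_eq_of_ne hy]
    · simp
  have h1 := h ω h0
  ext y
  simp [hfe, h1 _ (Subtype.coe_prop _)]

theorem Rm_ker {F : Finset (Sym2 V)} {p : V → Fin 2 → ℝ} (h : SF F p) :
    F.card + Module.finrank ℝ (LinearMap.ker (Rm F p)) = 2 * Fintype.card V := by
  have h1 := LinearMap.finrank_range_add_finrank_ker (Rm F p)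
  rw [LinearMap.range_eq_top.2 (Rm_surj h), finrank_top] at h1
  simpa [Module.finrank_pi_fintype, mul_comm] using h1

def tau (p : V → Fin 2 → ℝ) : (ℝ × (Fin 2 → ℝ)) →ₗ[ℝ] (V → Fin 2 → ℝ) where
  toFun c v := ![-(c.1 * p v 1) + c.2 0, c.1 * p v 0 + c.2 1]
  map_add' c d := by
    funext v; ext i; fin_cases i <;> simp <;> ring
  map_smul' c d := by
    funext v; ext i; fin_cases i <;> simp <;> ring

theorem tau_inj {p : V → Fin 2 → ℝ} {U : Set V} {u w : V} (hu : u ∈ U) (hw : w ∈ U) (h : p u ≠ p w)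
    {c : ℝ × (Fin 2 → ℝ)}
    (hc : ∀ x ∈ U, tau p c x = 0) : c = 0 := by
  have h1 := hc u hu
  have h2 := hc w hw
  have a0 := congrFun h1 0
  have a1 := congrFun h1 1
  have b0 := congrFun h2 0
  have b1 := congrFun h2 1
  simp [tau] at a0 a1 b0 b1
  have hc1 : c.1 = 0 := by
    by_contra hne
    apply h
    ext i
    fin_cases i
    · exact mul_left_cancel₀ hne (by change c.1 * p u 0 = c.1 * p w 0; linear_combination a1 - b1)
    · exact mul_left_cancel₀ hne (by change c.1 * p u 1 = c.1 * p w 1; linear_combination b0 - a0)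
  rw [hc1] at a0 a1
  simp at a0 a1
  apply Prod.ext hc1
  ext i; fin_cases i <;> simp [a0, a1]

theorem tau_rot (p : V → Fin 2 → ℝ) (c) (u w : V) :
    (p u - p w) ⬝ᵥ (tau p c u - tau p c w) = 0 := by
  simp [tau, dotProduct, Fin.sum_univ_two]; ring

open Classical in
theorem three_one (G : SimpleGraph V) (hV : 3 ≤ Fintype.card V) (γ : G ≃g G)
    (hγ : ∀ v, γ (γ (γ v)) = v) (h : C3ConstructionSeq G (fun v => γ v)) :
    ∃ p : V → Fin 2 → ℝ, Isostatic G p ∧ C3Symmetric G γ p := by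
  obtain ⟨p, hp, hsf, hgen⟩ := seq_sf (g := fun v => γ v) hγ G h
  have hcard := seq_card (g := fun v => γ v) hγ G h
  refine ⟨p, ⟨fun u w huw => hgen.inj huw.ne, ?_, ?_⟩, hp⟩
  · intro m hm
    have hk := Rm_ker hsf
    rw [Finset.card_univ] at hcard
    have hle : LinearMap.range (tau p) ≤ LinearMap.ker (Rm G.edgeFinset p) := by
      rintro _ ⟨c, rfl⟩
      rw [LinearMap.mem_ker]
      funext ⟨e, he⟩
      induction e using Sym2.ind with | _ a b =>
      rw [SimpleGraph.mem_edgeFinset, SimpleGraph.mem_edgeSet] at he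
      exact (row_dot p _ he.ne).trans (tau_rot p c a b)
    obtain ⟨u, w, huw⟩ := Fintype.exists_pair_of_one_lt_card (α := V) (by omega)
    have hinj : Function.Injective (tau p) := by
      rw [injective_iff_map_eq_zero]
      intro c hc
      exact tau_inj (Set.mem_univ u) (Set.mem_univ w) (hgen.inj huw) (fun x _ => by rw [hc]; rfl)
    have hr := LinearMap.finrank_range_of_inj hinj
    have heq := Submodule.eq_of_le_of_finrank_eq hle (by rw [hr]; simp; omega)
    have hmk : m ∈ LinearMap.range (tau p) := by
      rw [heq, LinearMap.mem_ker]
      funext ⟨e, he⟩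
      induction e using Sym2.ind with | _ a b =>
      rw [SimpleGraph.mem_edgeFinset, SimpleGraph.mem_edgeSet] at he
      exact (row_dot p _ he.ne).trans (hm a b he)
    obtain ⟨c, rfl⟩ := hmk
    refine ⟨!![0, -c.1; c.1, 0], ?_, c.2, ?_⟩
    · ext i j; fin_cases i <;> fin_cases j <;> simp
    · intro v; ext i; fin_cases i <;> simp [tau, Matrix.mulVec, dotProduct, Fin.sum_univ_two]
  · have := (sf_iff _ _).1 hsf
    unfold Independent
    have e : (G.edgeFinset : Set (Sym2 V)) = G.edgeSet := by simp
    change LinearIndepOn ℝ (fun e => rigidityRow p e) (G.edgeFinset : Set (Sym2 V)) at this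
    rw [e] at this
    exact this

theorem SF.mono {E F : Finset (Sym2 V)} {p : V → Fin 2 → ℝ} (h : SF E p) (hF : F ⊆ E) : SF F p := by
  intro ω hω e he
  classical
  have := h (fun e => if e ∈ F then ω e else 0) (by
    rw [← hω, ← Finset.sum_subset hF]
    · apply Finset.sum_congr rfl
      intro e he; simp [he]
    · intro e _ he; simp [he]) e (hF he)
  simpa [he] using this

def locmap (U : Finset V) (p : V → Fin 2 → ℝ) :
    ((ℝ × (Fin 2 → ℝ)) × ({x // x ∉ U} → Fin 2 → ℝ)) →ₗ[ℝ] (V → Fin 2 → ℝ) where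
  toFun c x := if h : x ∈ U then tau p c.1 x else c.2 ⟨x, h⟩
  map_add' c d := by
    funext x; by_cases h : x ∈ U <;> simp [h]
  map_smul' c d := by
    funext x; by_cases h : x ∈ U <;> simp [h]

theorem sf_bound {F : Finset (Sym2 V)} {p : V → Fin 2 → ℝ} (h : SF F p) (U : Finset V)
    (hU : ∀ a b, s(a, b) ∈ F → a ∈ U ∧ b ∈ U ∧ a ≠ b) {u w : V} (hu : u ∈ U) (hw : w ∈ U)
    (huw : p u ≠ p w) : F.card + 3 ≤ 2 * U.card := by
  have hk := Rm_ker h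
  have hinj : Function.Injective (locmap U p) := by
    rw [injective_iff_map_eq_zero]
    rintro ⟨c, y⟩ hc
    have h1 : c = 0 := tau_inj (U := (U : Set V)) hu hw huw (fun x hx => by
      have := congrFun hc x
      simpa [locmap, Finset.mem_coe.1 hx] using this)
    have h2 : y = 0 := by
      funext ⟨x, hx⟩
      have := congrFun hc x
      simpa [locmap, hx] using this
    rw [h1, h2]; rfl
  have hle : LinearMap.range (locmap U p) ≤ LinearMap.ker (Rm F p) := by
    rintro _ ⟨c, rfl⟩
    rw [LinearMap.mem_ker]
    funext ⟨e, he⟩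
    induction e using Sym2.ind with | _ a b =>
    obtain ⟨ha, hb, hab⟩ := hU a b he
    refine (row_dot p _ hab).trans ?_
    simp only [locmap, LinearMap.coe_mk, AddHom.coe_mk, ha, hb, dif_pos]
    exact tau_rot p c.1 a b
  have hr := LinearMap.finrank_range_of_inj hinj
  have hl := Submodule.finrank_mono hle
  rw [hr] at hl
  have hcard : Fintype.card {x // x ∉ U} = Fintype.card V - U.card := by
    rw [Fintype.card_subtype_compl, Fintype.card_coe]
  have := Finset.card_le_univ U
  simp [Module.finrank_pi_fintype, hcard] at hl
  omega

theorem row_map {g : V → V} (hgi : Function.Injective g) {p : V → Fin 2 → ℝ}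
    (hp : ∀ x, p (g x) = R3.mulVec (p x)) (e : Sym2 V) (x : V) :
    rigidityRow p (Sym2.map g e) (g x) = R3.mulVec (rigidityRow p e x) := by
  induction e using Sym2.ind with | _ a b =>
  rw [Sym2.map_mk]
  by_cases h1 : x = a
  · subst h1; rw [row_l, row_l, hp, hp, Matrix.mulVec_sub]
  by_cases h2 : x = b
  · subst h2; rw [row_r, row_r, hp, hp, Matrix.mulVec_sub]
  rw [row_off _ (show x ∉ s(a, b) by simp [h1, h2]),
    row_off _ (show g x ∉ s(g a, g b) by simp [h1, h2, hgi.eq_iff]), Matrix.mulVec_zero]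

theorem R3_fix {x : Fin 2 → ℝ} (h : x = R3.mulVec x) : x = 0 := by
  have h0 := congrFun h 0
  have h1 := congrFun h 1
  rw [R3_0] at h0
  rw [R3_1] at h1
  have ss := s3
  ext i; fin_cases i
  · simp; linear_combination (1/2) * h0 - (√3 / 6) * h1 - x 0 / 12 * ss
  · simp; linear_combination (1/2) * h1 + (√3 / 6) * h0 - x 1 / 12 * ss

def jj (x : Fin 2 → ℝ) : Fin 2 → ℝ := ![-x 1, x 0]

theorem jj_R3 (x : Fin 2 → ℝ) : jj (R3.mulVec x) = R3.mulVec (jj x) := by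
  ext i; fin_cases i
  · change - R3.mulVec x 1 = R3.mulVec (jj x) 0
    rw [R3_0, R3_1]; simp [jj]
    try ring
  · change R3.mulVec x 0 = R3.mulVec (jj x) 1
    rw [R3_0, R3_1]; simp [jj]
    try ring

def theta (E DE : Finset (Sym2 V)) (rE : Sym2 V → Sym2 V) (hr : ∀ e : E, rE e ∈ DE) (p : V → Fin 2 → ℝ) :
    ((DE → ℝ) × ℝ) →ₗ[ℝ] (V → Fin 2 → ℝ) where
  toFun c x := ∑ e : E, c.1 ⟨rE e, hr e⟩ • rigidityRow p (e : Sym2 V) x + c.2 • jj (p x)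
  map_add' c d := by
    funext x; simp [add_smul, Finset.sum_add_distrib]; abel
  map_smul' c d := by
    funext x; simp [mul_smul, Finset.smul_sum]

theorem jj_dot (p : V → Fin 2 → ℝ) (e : Sym2 V) : ∑ x, rigidityRow p e x ⬝ᵥ jj (p x) = 0 := by
  induction e using Sym2.ind with | _ a b =>
  by_cases h : a = b
  · subst h
    apply Finset.sum_eq_zero
    intro x _
    by_cases h1 : x = a
    · subst h1; rw [row_l]; simp
    · rw [row_off _ (by simp [h1])]; simp
  · rw [row_dot p (fun x => jj (p x)) h]
    simp [jj, dotProduct, Fin.sum_univ_two]; ring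

theorem sym_count {g : V → V} (hg : ∀ v, g (g (g v)) = v) {E : Finset (Sym2 V)}
    (hE : ∀ e ∈ E, Sym2.map g e ∈ E) (hEf : ∀ e ∈ E, Sym2.map g e ≠ e) {p : V → Fin 2 → ℝ}
    (hp : ∀ x, p (g x) = R3.mulVec (p x)) (hp0 : ∃ x, p x ≠ 0) (h : SF E p) :
    E.card + 3 ≤ 2 * (Finset.univ.filter (fun x => g x ≠ x)).card := by
  have hgi := inj_of_three hg
  obtain ⟨r, r1, r2⟩ := exists_rep g hg
  obtain ⟨rE, e1, e2⟩ := exists_rep (Sym2.map g) (map3 hg)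
  have c1 := card_rep (Sym2.map g) rE (map3 hg) e1 e2 E hE hEf
  have c2 := card_rep g r hg r1 r2 (Finset.univ.filter (fun x => g x ≠ x))
    (fun x hx => by
      simp only [Finset.mem_filter, Finset.mem_univ, true_and] at hx ⊢
      exact fun h => hx (hgi h))
    (fun x hx => by simpa using hx)
  set DE := E.image rE with hDE
  set DV := (Finset.univ.filter (fun x => g x ≠ x)).image r with hDV
  have hr : ∀ e : E, rE e ∈ DE := fun e => Finset.mem_image_of_mem _ e.2
  have hsym : ∀ c x, theta E DE rE hr p c (g x) = R3.mulVec (theta E DE rE hr p c x) := by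
    intro c x
    simp only [theta, LinearMap.coe_mk, AddHom.coe_mk, Matrix.mulVec_add, Matrix.mulVec_sum,
      Matrix.mulVec_smul, hp, jj_R3]
    congr 1
    symm
    apply Finset.sum_bij (fun (e : E) _ => (⟨Sym2.map g e, hE _ e.2⟩ : E))
    · simp
    · rintro ⟨a, ha⟩ _ ⟨b, hb⟩ _ hab
      simp only [Subtype.mk.injEq] at hab ⊢
      exact Sym2.map.injective hgi hab
    · rintro ⟨b, hb⟩ _
      refine ⟨⟨Sym2.map g (Sym2.map g b), hE _ (hE _ hb)⟩, Finset.mem_univ _, ?_⟩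
      simp only [map3 hg]
    · rintro ⟨e, he⟩ _
      simp only [row_map hgi hp, e1]
  let L : ((DE → ℝ) × ℝ) →ₗ[ℝ] (DV → Fin 2 → ℝ) :=
    (LinearMap.funLeft ℝ (Fin 2 → ℝ) (fun x : DV => (x : V))) ∘ₗ theta E DE rE hr p
  have hinj : Function.Injective L := by
    rw [injective_iff_map_eq_zero]
    rintro c hc
    have hz : ∀ x, theta E DE rE hr p c x = 0 := by
      intro x
      by_cases hx : g x = x
      · apply R3_fix
        rw [← hsym, hx]
      · have hm : r x ∈ DV := Finset.mem_image_of_mem _ (by simpa using hx)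
        have h0 : theta E DE rE hr p c (r x) = 0 := congrFun hc ⟨r x, hm⟩
        rcases r2 x with h | h | h
        · rwa [h] at h0
        · rw [← hg x, hsym, hsym, ← h, h0]; simp
        · rw [← hg x, hsym, ← h, h0]; simp
    have hc2 : c.2 = 0 := by
      have h1 : ∑ x, theta E DE rE hr p c x ⬝ᵥ jj (p x) = 0 := by simp [hz]
      simp only [theta, LinearMap.coe_mk, AddHom.coe_mk, add_dotProduct, Finset.sum_add_distrib,
        sum_dotProduct, smul_dotProduct] at h1
      rw [Finset.sum_comm] at h1
      simp only [smul_eq_mul, ← Finset.mul_sum, jj_dot, mul_zero, Finset.sum_const_zero, zero_add] at h1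
      refine (mul_eq_zero.1 h1).resolve_right ?_
      obtain ⟨x, hx⟩ := hp0
      apply ne_of_gt
      have hnn : ∀ x, jj (p x) ⬝ᵥ jj (p x) = p x 0 ^ 2 + p x 1 ^ 2 := by
        intro x; simp [jj, dotProduct, Fin.sum_univ_two]; ring
      apply Finset.sum_pos'
      · intro x _; rw [hnn]; positivity
      · refine ⟨x, Finset.mem_univ _, ?_⟩
        rw [hnn]
        by_contra hle
        apply hx
        have z0 : p x 0 = 0 := pow_eq_zero_iff two_ne_zero |>.1
          (by nlinarith [sq_nonneg (p x 0), sq_nonneg (p x 1)])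
        have z1 : p x 1 = 0 := pow_eq_zero_iff two_ne_zero |>.1
          (by nlinarith [sq_nonneg (p x 0), sq_nonneg (p x 1)])
        ext i; fin_cases i
        exacts [z0, z1]
    have hc1 : c.1 = 0 := by
      let ω : Sym2 V → ℝ := fun e => if he : e ∈ E then c.1 ⟨rE e, hr ⟨e, he⟩⟩ else 0
      have := h ω (by
        rw [← Finset.sum_coe_sort E (fun e => ω e • rigidityRow p e)]
        funext x
        have := hz x
        simp only [theta, LinearMap.coe_mk, AddHom.coe_mk, hc2, zero_smul, add_zero] at this
        rw [Pi.zero_apply, ← this, Finset.sum_apply]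
        apply Finset.sum_congr rfl
        intro e _
        simp [ω])
      funext ⟨d, hd⟩
      obtain ⟨e, he, rfl⟩ := Finset.mem_image.1 hd
      have := this e he
      simpa [ω, he] using this
    exact Prod.ext hc1 hc2
  have := LinearMap.finrank_le_finrank_of_injective hinj
  simp [Module.finrank_pi_fintype] at this
  omega

open Classical in
theorem one_two (G : SimpleGraph V) (hV : 3 ≤ Fintype.card V) (γ : G ≃g G)
    (hγ : ∀ v, γ (γ (γ v)) = v) (p : V → Fin 2 → ℝ) (hiso : Isostatic G p) (hp : C3Symmetric G γ p) :
    Laman G ∧ ∀ v, γ v ≠ v := by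
  obtain ⟨hfw, hrig, hind⟩ := hiso
  have hsf : SF G.edgeFinset p := by
    rw [sf_iff]
    have e : (G.edgeFinset : Set (Sym2 V)) = G.edgeSet := by simp
    change LinearIndepOn ℝ (fun e => rigidityRow p e) (G.edgeFinset : Set (Sym2 V))
    rw [e]; exact hind
  have hk := Rm_ker hsf
  have hker : Module.finrank ℝ (LinearMap.ker (Rm G.edgeFinset p)) ≤ 3 := by
    have hle : LinearMap.ker (Rm G.edgeFinset p) ≤ LinearMap.range (tau p) := by
      intro m hm
      have hm' : IsInfMotion G p m := by
        intro u w huw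
        rw [← row_dot p m huw.ne]
        exact congrFun (LinearMap.mem_ker.1 hm) ⟨s(u, w), by simpa using huw⟩
      obtain ⟨S, hS, t, ht⟩ := hrig m hm'
      have h00 := congrFun (congrFun hS 0) 0
      have h01 := congrFun (congrFun hS 0) 1
      have h11 := congrFun (congrFun hS 1) 1
      simp only [Matrix.transpose_apply, Matrix.neg_apply] at h00 h01 h11
      have h00 : S 0 0 = 0 := by linarith
      have h11 : S 1 1 = 0 := by linarith
      have h01 : S 0 1 = - S 1 0 := by linarith
      refine ⟨(S 1 0, t), ?_⟩
      funext v
      rw [ht v]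
      ext i; fin_cases i <;> simp [tau, Matrix.mulVec, dotProduct, Fin.sum_univ_two, h00, h01, h11]
    have := Submodule.finrank_mono hle
    have h2 := LinearMap.finrank_range_le (tau p)
    simp at h2
    omega
  have bound : ∀ (F : Finset (Sym2 V)) (U : Finset V), F ⊆ G.edgeFinset →
      (∀ a b, s(a, b) ∈ F → a ∈ U ∧ b ∈ U) → 2 ≤ U.card → F.card + 3 ≤ 2 * U.card := by
    intro F U hF hU h2
    rcases F.eq_empty_or_nonempty with h | ⟨e, he⟩
    · subst h; simp; omega
    · induction e using Sym2.ind with | _ a b =>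
      have hadj : ∀ a b, s(a, b) ∈ F → G.Adj a b := fun a b h => by simpa using hF h
      exact sf_bound (hsf.mono hF) U (fun a b h => ⟨(hU a b h).1, (hU a b h).2, (hadj a b h).ne⟩)
        (hU a b he).1 (hU a b he).2 (hfw a b (hadj a b he))
  have htot := bound G.edgeFinset Finset.univ subset_rfl (by simp) (by rw [Finset.card_univ]; omega)
  rw [Finset.card_univ] at htot
  have hnc : G.edgeSet.ncard = G.edgeFinset.card := by
    rw [← SimpleGraph.coe_edgeFinset, Set.ncard_coe_finset]
  refine ⟨⟨by rw [hnc]; omega, ?_⟩, ?_⟩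
  · intro H hH
    have := bound H.edgeSet.toFinset H.verts.toFinset
      (by intro e he; simp at he ⊢; exact H.edgeSet_subset he)
      (by
        intro a b hab
        simp only [Set.mem_toFinset, SimpleGraph.Subgraph.mem_edgeSet] at hab ⊢
        exact ⟨H.edge_vert hab, H.edge_vert hab.symm⟩)
      (by rwa [← Set.ncard_eq_toFinset_card'])
    rw [← Set.ncard_eq_toFinset_card', ← Set.ncard_eq_toFinset_card'] at this
    omega
  · have hp0 : ∃ x, p x ≠ 0 := by
      have : 0 < G.edgeFinset.card := by omega
      obtain ⟨e, he⟩ := Finset.card_pos.1 this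
      induction e using Sym2.ind with | _ a b =>
      have := hfw a b (by simpa using he)
      by_contra! hall
      rw [hall, hall] at this
      exact this rfl
    have hfix0 : ∀ v, γ v = v → p v = 0 := fun v hv => R3_fix (by rw [← hp, hv])
    have hs := sym_count (g := fun v => γ v) hγ (E := G.edgeFinset) (p := p)
      (by
        intro e he
        induction e using Sym2.ind with | _ a b =>
        simp at he ⊢
        exact γ.map_rel_iff.2 he)
      (by
        intro e he heq
        induction e using Sym2.ind with | _ a b =>
        have hadj : G.Adj a b := by simpa using he
        rw [Sym2.map_mk, Sym2.eq_iff] at heq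
        have : γ a = a ∧ γ b = b := by
          have := hγ a
          grind
        apply hfw a b hadj
        rw [hfix0 a this.1, hfix0 b this.2]) hp hp0 hsf
    have hle : (Finset.univ : Finset V).card ≤ (Finset.univ.filter (fun x => γ x ≠ x)).card := by
      rw [Finset.card_univ]; omega
    have heq := Finset.eq_of_subset_of_card_le (Finset.filter_subset _ _) hle
    intro v
    have := Finset.mem_univ v
    rw [← heq] at this
    simpa using this

structure Tr (A : Finset V) (F : Finset (Sym2 V)) : Prop where
  ne : A.Nonempty
  sub : ∀ a b, s(a, b) ∈ F → a ∈ A ∧ b ∈ A ∧ a ≠ b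
  crd : F.card + 1 = A.card
  con : ∀ P : V → Prop, (∀ x y, s(x, y) ∈ F → (P x ↔ P y)) → ∀ a ∈ A, ∀ b ∈ A, P a → P b

theorem Tr.notMem {A : Finset V} {F : Finset (Sym2 V)} (h : Tr A F) {u : V} (hu : u ∉ A) (x : V) :
    s(u, x) ∉ F := fun hm => hu (h.sub _ _ hm).1

theorem Tr.leaf {A : Finset V} {F : Finset (Sym2 V)} (h : Tr A F) {u a : V} (hu : u ∉ A)
    (ha : a ∈ A) : Tr (insert u A) (insert s(u, a) F) := by
  have hua : u ≠ a := fun h => hu (h ▸ ha)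
  refine ⟨⟨u, by simp⟩, ?_, ?_, ?_⟩
  · intro x y hxy
    rw [Finset.mem_insert] at hxy
    rcases hxy with hxy | hxy
    · rw [Sym2.eq_iff] at hxy
      rcases hxy with ⟨rfl, rfl⟩ | ⟨rfl, rfl⟩
      · simp [ha, hua]
      · simp [ha, hua.symm]
    · have := h.sub x y hxy
      simp [this]
  · rw [Finset.card_insert_of_notMem (h.notMem hu a), Finset.card_insert_of_notMem hu, h.crd]
  · intro P hP
    have h0 := hP u a (by simp)
    have h1 := h.con P (fun x y hxy => hP x y (Finset.mem_insert_of_mem hxy))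
    intro x hx y hy hx'
    rw [Finset.mem_insert] at hx hy
    rcases hx with rfl | hx <;> rcases hy with rfl | hy
    · exact hx'
    · exact h1 a ha y hy (h0.1 hx')
    · exact h0.2 (h1 x hx a ha hx')
    · exact h1 x hx y hy hx'

theorem Tr.subdiv {A : Finset V} {F : Finset (Sym2 V)} (h : Tr A F) {u a b : V} (hu : u ∉ A)
    (hab : s(a, b) ∈ F) : Tr (insert u A) (insert s(u, a) (insert s(u, b) (F.erase s(a, b)))) := by
  obtain ⟨ha, hb, hne⟩ := h.sub _ _ hab
  have hua : u ≠ a := fun h => hu (h ▸ ha)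
  have hub : u ≠ b := fun h => hu (h ▸ hb)
  refine ⟨⟨u, by simp⟩, ?_, ?_, ?_⟩
  · intro x y hxy
    rw [Finset.mem_insert, Finset.mem_insert, Finset.mem_erase] at hxy
    rcases hxy with hxy | hxy | hxy
    · rw [Sym2.eq_iff] at hxy
      rcases hxy with ⟨rfl, rfl⟩ | ⟨rfl, rfl⟩
      · simp [ha, hua]
      · simp [ha, hua.symm]
    · rw [Sym2.eq_iff] at hxy
      rcases hxy with ⟨rfl, rfl⟩ | ⟨rfl, rfl⟩
      · simp [hb, hub]
      · simp [hb, hub.symm]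
    · have := h.sub x y hxy.2
      simp [this]
  · have n : ∀ x, s(u, x) ∉ F.erase s(a, b) := fun x hx => h.notMem hu x (Finset.mem_of_mem_erase hx)
    have := Finset.card_pos.2 ⟨_, hab⟩
    rw [Finset.card_insert_of_notMem, Finset.card_insert_of_notMem (n b),
      Finset.card_insert_of_notMem hu, ← h.crd, Finset.card_erase_of_mem hab]
    · omega
    · rw [Finset.mem_insert]
      rintro (h' | h')
      · exact hne (Sym2.congr_right.1 h')
      · exact n _ h'
  · intro P hP
    have h0 := hP u a (by simp)
    have h0' := hP u b (by simp)
    have h1 := h.con P (fun x y hxy => by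
      by_cases hh : s(x, y) = s(a, b)
      · rw [Sym2.eq_iff] at hh
        rcases hh with ⟨rfl, rfl⟩ | ⟨rfl, rfl⟩
        · rw [← h0, h0']
        · rw [← h0, h0']
      · exact hP x y (by simp [hh, hxy]))
    intro x hx y hy hx'
    rw [Finset.mem_insert] at hx hy
    rcases hx with rfl | hx <;> rcases hy with rfl | hy
    · exact hx'
    · exact h1 a ha y hy (h0.1 hx')
    · exact h0.2 (h1 x hx a ha hx')
    · exact h1 x hx y hy hx'

def Cov (g : V → V) (F : Finset (Sym2 V)) (e : Sym2 V) : Prop :=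
  e ∈ F ∨ Sym2.map g e ∈ F ∨ Sym2.map g (Sym2.map g e) ∈ F

theorem Cov.mono {g : V → V} {F F' : Finset (Sym2 V)} {e : Sym2 V} (h : Cov g F e) (hF : F ⊆ F') :
    Cov g F' e := by
  rcases h with h | h | h
  · exact Or.inl (hF h)
  · exact Or.inr (Or.inl (hF h))
  · exact Or.inr (Or.inr (hF h))

theorem Cov.map {g : V → V} (hg : ∀ v, g (g (g v)) = v) {F : Finset (Sym2 V)} {a b : V} :
    (Cov g F s(g a, g b) ↔ Cov g F s(a, b)) := by
  unfold Cov
  simp only [Sym2.map_mk, hg]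
  tauto

def Two (g : V → V) (A : Finset V) (x : V) : Prop :=
  (x ∈ A ∧ g x ∈ A ∧ g (g x) ∉ A) ∨ (x ∉ A ∧ g x ∈ A ∧ g (g x) ∈ A) ∨
    (x ∈ A ∧ g x ∉ A ∧ g (g x) ∈ A)

theorem Two.map {g : V → V} (hg : ∀ v, g (g (g v)) = v) {A : Finset V} {a : V} :
    (Two g A (g a) ↔ Two g A a) := by
  unfold Two
  simp only [hg]
  tauto

def TP (g : V → V) (S : Finset V) (E : Finset (Sym2 V)) : Prop :=
  ∃ A F, Tr A F ∧ A ⊆ S ∧ (∀ x ∈ S, Two g A x) ∧ ∀ e ∈ E, Cov g F e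

/-- Adding two of the three vertices of an orbit: all but the edge conditions. -/
theorem tp_aux {g : V → V} (hg : ∀ v, g (g (g v)) = v) {S : Finset V} {E : Finset (Sym2 V)}
    (ctx : Ctx g S E) {A : Finset V} (hA : A ⊆ S) (h2 : ∀ x ∈ S, Two g A x) {v : V}
    (hv : v ∉ S) (hv1 : g v ∉ S) (hv2 : g (g v) ∉ S) (hf : g v ≠ v) :
    insert (g v) (insert v A) ⊆ S ∪ {v, g v, g (g v)} ∧
    ∀ x ∈ S ∪ {v, g v, g (g v)}, Two g (insert (g v) (insert v A)) x := by
  have h := free3 hg hf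
  refine ⟨?_, ?_⟩
  · intro x hx
    simp only [Finset.mem_insert, Finset.mem_union, Finset.mem_singleton] at hx ⊢
    rcases hx with h | h | h
    · simp [h]
    · simp [h]
    · exact Or.inl (hA h)
  · have hh : Two g (insert (g v) (insert v A)) v := by
      left
      simp only [Finset.mem_insert, h.1, h.2, false_or]
      simp only [true_or, or_true, true_and]
      exact fun h => hv2 (hA h)
    intro x hx
    simp only [Finset.mem_insert, Finset.mem_union, Finset.mem_singleton] at hx
    rcases hx with hx | rfl | rfl | rfl
    · have hx1 := ctx.inv _ hx
      have hx2 := ctx.inv _ hx1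
      have n0 : ∀ u ∉ S, ∀ x ∈ S, x ≠ u := fun u hu x hx h => hu (h ▸ hx)
      have := h2 x hx
      unfold Two at this ⊢
      simp only [Finset.mem_insert, n0 _ hv _ hx, n0 _ hv _ hx1, n0 _ hv _ hx2, n0 _ hv1 _ hx,
        n0 _ hv1 _ hx1, n0 _ hv1 _ hx2, false_or]
      exact this
    · exact hh
    · rwa [Two.map hg]
    · rwa [Two.map hg, Two.map hg]

theorem orb_rot {g : V → V} (hg : ∀ v, g (g (g v)) = v) (v : V) :
    ({g v, g (g v), g (g (g v))} : Finset V) = {v, g v, g (g v)} := by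
  rw [hg]
  ext x
  simp only [Finset.mem_insert, Finset.mem_singleton]
  tauto

/-- the general step, after rotation: `v` hangs in tree 0, `g v` hangs in tree 0. -/
theorem tp_vadd0 {g : V → V} (hg : ∀ v, g (g (g v)) = v) {S : Finset V} {E E' : Finset (Sym2 V)}
    (ctx : Ctx g S E) {A : Finset V} {F : Finset (Sym2 V)} (hT : Tr A F) (hA : A ⊆ S)
    (h2 : ∀ x ∈ S, Two g A x) (hE : ∀ e ∈ E, Cov g F e) {v : V}
    (hv : v ∉ S) (hv1 : g v ∉ S) (hv2 : g (g v) ∉ S) (hf : g v ≠ v) {a b : V} (ha : a ∈ A)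
    (hb : g b ∈ A)
    (hE' : ∀ F' , (∀ e ∈ E, Cov g F' e) → Cov g F' s(v, a) → Cov g F' s(v, b) → ∀ e ∈ E', Cov g F' e) :
    TP g (S ∪ {v, g v, g (g v)}) E' := by
  refine ⟨insert (g v) (insert v A), insert s(g v, g b) (insert s(v, a) F), ?_, ?_, ?_, ?_⟩
  · refine (hT.leaf (fun h => hv (hA h)) ha).leaf ?_ (by simp [hb])
    simp only [Finset.mem_insert, hf, false_or]
    exact fun h => hv1 (hA h)
  · exact (tp_aux hg ctx hA h2 hv hv1 hv2 hf).1
  · exact (tp_aux hg ctx hA h2 hv hv1 hv2 hf).2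
  · apply hE'
    · intro e he
      exact (hE e he).mono (fun x hx => by simp [hx])
    · left; simp
    · right; left; simp

theorem tp_split0 {g : V → V} (hg : ∀ v, g (g (g v)) = v) {S : Finset V} {E E' : Finset (Sym2 V)}
    (ctx : Ctx g S E) {A : Finset V} {F : Finset (Sym2 V)} (hT : Tr A F) (hA : A ⊆ S)
    (h2 : ∀ x ∈ S, Two g A x) (hE : ∀ e ∈ E, Cov g F e) {v : V}
    (hv : v ∉ S) (hv1 : g v ∉ S) (hv2 : g (g v) ∉ S) (hf : g v ≠ v) {a b c : V} (hab : s(a, b) ∈ F)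
    (hc : g c ∈ A)
    (hE' : ∀ F' , (∀ e ∈ E \ {s(a, b), s(g a, g b), s(g (g a), g (g b))}, Cov g F' e) →
      Cov g F' s(v, a) → Cov g F' s(v, b) → Cov g F' s(v, c) → ∀ e ∈ E', Cov g F' e) :
    TP g (S ∪ {v, g v, g (g v)}) E' := by
  refine ⟨insert (g v) (insert v A),
    insert s(g v, g c) (insert s(v, a) (insert s(v, b) (F.erase s(a, b)))), ?_, ?_, ?_, ?_⟩
  · refine (hT.subdiv (fun h => hv (hA h)) hab).leaf ?_ (by simp [hc])
    simp only [Finset.mem_insert, hf, false_or]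
    exact fun h => hv1 (hA h)
  · exact (tp_aux hg ctx hA h2 hv hv1 hv2 hf).1
  · exact (tp_aux hg ctx hA h2 hv hv1 hv2 hf).2
  · apply hE'
    · intro e he
      simp only [Finset.mem_sdiff, Finset.mem_insert, Finset.mem_singleton, not_or] at he
      obtain ⟨he, n0, n1, n2⟩ := he
      have key : ∀ e', e' ∈ F → e' ≠ s(a, b) →
          e' ∈ insert s(g v, g c) (insert s(v, a) (insert s(v, b) (F.erase s(a, b)))) := by
        intro e' h h'
        simp [h, h']
      rcases hE e he with h | h | h
      · exact Or.inl (key _ h n0)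
      · refine Or.inr (Or.inl (key _ h ?_))
        intro h'
        apply n2
        rw [← map3 hg e, h']
        simp
      · refine Or.inr (Or.inr (key _ h ?_))
        intro h'
        apply n1
        rw [← map3 hg e, h']
        simp
    · left; simp
    · left; simp
    · right; left; simp

theorem tp_delta0 {g : V → V} (hg : ∀ v, g (g (g v)) = v) {S : Finset V} {E E' : Finset (Sym2 V)}
    (ctx : Ctx g S E) {A : Finset V} {F : Finset (Sym2 V)} (hT : Tr A F) (hA : A ⊆ S)
    (h2 : ∀ x ∈ S, Two g A x) (hE : ∀ e ∈ E, Cov g F e) {v : V}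
    (hv : v ∉ S) (hv1 : g v ∉ S) (hv2 : g (g v) ∉ S) (hf : g v ≠ v) {a : V} (ha : a ∈ A)
    (hE' : ∀ F' , (∀ e ∈ E, Cov g F' e) → Cov g F' s(v, a) → Cov g F' s(v, g v) →
      ∀ e ∈ E', Cov g F' e) :
    TP g (S ∪ {v, g v, g (g v)}) E' := by
  refine ⟨insert (g v) (insert v A), insert s(g v, v) (insert s(v, a) F), ?_, ?_, ?_, ?_⟩
  · refine (hT.leaf (fun h => hv (hA h)) ha).leaf ?_ (by simp)
    simp only [Finset.mem_insert, hf, false_or]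
    exact fun h => hv1 (hA h)
  · exact (tp_aux hg ctx hA h2 hv hv1 hv2 hf).1
  · exact (tp_aux hg ctx hA h2 hv hv1 hv2 hf).2
  · apply hE'
    · intro e he
      exact (hE e he).mono (fun x hx => by simp [hx])
    · left; simp
    · left; simp [Sym2.eq_swap]

theorem tp_split1 {g : V → V} (hg : ∀ v, g (g (g v)) = v) {S : Finset V} {E E' : Finset (Sym2 V)}
    (ctx : Ctx g S E) {A : Finset V} {F : Finset (Sym2 V)} (hT : Tr A F) (hA : A ⊆ S)
    (h2 : ∀ x ∈ S, Two g A x) (hE : ∀ e ∈ E, Cov g F e) {v : V}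
    (hv : v ∉ S) (hv1 : g v ∉ S) (hv2 : g (g v) ∉ S) (hf : g v ≠ v) {a b c : V}
    (hab : s(g a, g b) ∈ F) (hc : c ∈ A)
    (hE' : ∀ F' , (∀ e ∈ E \ {s(a, b), s(g a, g b), s(g (g a), g (g b))}, Cov g F' e) →
      Cov g F' s(v, a) → Cov g F' s(v, b) → Cov g F' s(v, c) → ∀ e ∈ E', Cov g F' e) :
    TP g (S ∪ {v, g v, g (g v)}) E' := by
  refine ⟨insert (g v) (insert v A),
    insert s(v, c) (insert s(g v, g a) (insert s(g v, g b) (F.erase s(g a, g b)))), ?_, ?_, ?_, ?_⟩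
  · rw [Finset.insert_comm]
    refine (hT.subdiv (fun h => hv1 (hA h)) hab).leaf ?_ (by simp [hc])
    simp only [Finset.mem_insert, hf.symm, false_or]
    exact fun h => hv (hA h)
  · exact (tp_aux hg ctx hA h2 hv hv1 hv2 hf).1
  · exact (tp_aux hg ctx hA h2 hv hv1 hv2 hf).2
  · apply hE'
    · intro e he
      simp only [Finset.mem_sdiff, Finset.mem_insert, Finset.mem_singleton, not_or] at he
      obtain ⟨he, n0, n1, n2⟩ := he
      have key : ∀ e', e' ∈ F → e' ≠ s(g a, g b) →
          e' ∈ insert s(v, c) (insert s(g v, g a) (insert s(g v, g b) (F.erase s(g a, g b)))) := by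
        intro e' h h'
        simp [h, h']
      rcases hE e he with h | h | h
      · exact Or.inl (key _ h n1)
      · refine Or.inr (Or.inl (key _ h ?_))
        intro h'
        apply n0
        rw [← map3 hg e, h']
        simp [hg]
      · refine Or.inr (Or.inr (key _ h ?_))
        intro h'
        apply n2
        rw [← map3 hg e, h']
        simp
    · right; left; simp
    · right; left; simp
    · left; simp

def Rot (g r : V → V) : Prop := r = id ∨ r = g ∨ r = g ∘ g

theorem Rot.two {g r : V → V} (hg : ∀ v, g (g (g v)) = v) (h : Rot g r) :
    Rot g (fun x => g (g (r x))) := by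
  rcases h with rfl | rfl | rfl
  · exact Or.inr (Or.inr rfl)
  · left; funext x; simp [hg]
  · right; left; funext x; simp [hg]

theorem Rot.cov {g r : V → V} (hg : ∀ v, g (g (g v)) = v) (h : Rot g r) {F : Finset (Sym2 V)}
    {a b : V} (hc : Cov g F s(r a, r b)) : Cov g F s(a, b) := by
  rcases h with rfl | rfl | rfl
  · exact hc
  · exact (Cov.map hg).1 hc
  · exact (Cov.map hg).1 ((Cov.map hg).1 hc)

theorem Rot.orb {g r : V → V} (hg : ∀ v, g (g (g v)) = v) (h : Rot g r) (v : V) :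
    ({v, g v, g (g v)} : Finset V) = {r v, g (r v), g (g (r v))} := by
  rcases h with rfl | rfl | rfl
  · rfl
  · rw [orb_rot hg]
  · simp only [Function.comp]
    rw [orb_rot hg, orb_rot hg]

theorem Rot.fr {g r : V → V} (hg : ∀ v, g (g (g v)) = v) (h : Rot g r) {S : Finset V} {v : V}
    (hv : v ∉ S) (hv1 : g v ∉ S) (hv2 : g (g v) ∉ S) (hf : g v ≠ v) :
    r v ∉ S ∧ g (r v) ∉ S ∧ g (g (r v)) ∉ S ∧ g (r v) ≠ r v := by
  have hh := free3 hg hf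
  rcases h with rfl | rfl | rfl
  · exact ⟨hv, hv1, hv2, hf⟩
  · refine ⟨hv1, hv2, ?_, hh.2⟩
    rwa [hg]
  · simp only [Function.comp, hg]
    exact ⟨hv2, hv, hv1, hh.1.symm⟩

theorem Rot.mem {g r : V → V} (h : Rot g r) {S : Finset V} {E : Finset (Sym2 V)} (ctx : Ctx g S E)
    {a : V} (ha : a ∈ S) : r a ∈ S := by
  rcases h with rfl | rfl | rfl
  · exact ha
  · exact ctx.inv _ ha
  · exact ctx.inv _ (ctx.inv _ ha)

theorem tp_vadd {g : V → V} (hg : ∀ v, g (g (g v)) = v) (S : Finset V) (E : Finset (Sym2 V))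
    (v a b : V) (ctx : Ctx g S E) (hv : v ∉ S) (hv1 : g v ∉ S) (hv2 : g (g v) ∉ S) (hf : g v ≠ v)
    (ha : a ∈ S) (hb : b ∈ S) (hT : TP g S E) : TP g (S ∪ {v, g v, g (g v)})
        (E ∪ {s(v, a), s(v, b), s(g v, g a), s(g v, g b), s(g (g v), g (g a)), s(g (g v), g (g b))}) := by
  obtain ⟨A, F, hT, hA, h2, hE⟩ := hT
  have main : ∀ r : V → V, Rot g r → ∀ x y, ((x = a ∧ y = b) ∨ (x = b ∧ y = a)) →
        r x ∈ A → g (r y) ∈ A → TP g (S ∪ {v, g v, g (g v)})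
        (E ∪ {s(v, a), s(v, b), s(g v, g a), s(g v, g b), s(g (g v), g (g a)), s(g (g v), g (g b))}) := by
    intro r hr x y hxy hx hy
    obtain ⟨f1, f2, f3, f4⟩ := hr.fr hg hv hv1 hv2 hf
    rw [hr.orb hg v]
    refine tp_vadd0 hg ctx hT hA h2 hE (v := r v) f1 f2 f3 f4 hx hy ?_
    · intro F' c1 c2 c3
      have c2' : Cov g F' s(v, x) := hr.cov hg c2
      have c3' : Cov g F' s(v, y) := hr.cov hg c3
      have c4 : Cov g F' s(v, a) := by rcases hxy with ⟨rfl, rfl⟩ | ⟨rfl, rfl⟩ <;> assumption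
      have c5 : Cov g F' s(v, b) := by rcases hxy with ⟨rfl, rfl⟩ | ⟨rfl, rfl⟩ <;> assumption
      intro e he
      simp only [Finset.mem_union, Finset.mem_insert, Finset.mem_singleton] at he
      rcases he with he | rfl | rfl | rfl | rfl | rfl | rfl
      · exact c1 e he
      all_goals simpa only [Cov.map hg]
  have m0 := fun r hr => main r hr a b (by simp)
  have m1 := fun r hr => main r hr b a (by simp)
  have q0 := m0 id (Or.inl rfl)
  have q1 := m0 g (Or.inr (Or.inl rfl))
  have q2 := m0 (g ∘ g) (Or.inr (Or.inr rfl))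
  have p0 := m1 id (Or.inl rfl)
  have p1 := m1 g (Or.inr (Or.inl rfl))
  have p2 := m1 (g ∘ g) (Or.inr (Or.inr rfl))
  simp only [id, Function.comp, hg] at q0 q1 q2 p0 p1 p2
  have ta := h2 a ha
  have tb := h2 b hb
  unfold Two at ta tb
  by_contra hcon
  simp only [hcon, imp_false] at q0 q1 q2 p0 p1 p2
  clear main m0 m1 hE h2 hcon
  rcases ta with ⟨a1, a2, a3⟩ | ⟨a1, a2, a3⟩ | ⟨a1, a2, a3⟩ <;>
  rcases tb with ⟨b1, b2, b3⟩ | ⟨b1, b2, b3⟩ | ⟨b1, b2, b3⟩ <;>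
  first | exact q0 a1 b2 | exact q1 a2 b3 | exact q2 a3 b1 | exact p0 b1 a2 | exact p1 b2 a3 |
    exact p2 b3 a1

theorem tp_split {g : V → V} (hg : ∀ v, g (g (g v)) = v) (S : Finset V) (E : Finset (Sym2 V))
    (v a b c : V) (ctx : Ctx g S E) (hv : v ∉ S) (hv1 : g v ∉ S) (hv2 : g (g v) ∉ S) (hf : g v ≠ v)
    (hc : c ∈ S) (he : s(a, b) ∈ E) (hT : TP g S E) : TP g (S ∪ {v, g v, g (g v)})
        ((E \ {s(a, b), s(g a, g b), s(g (g a), g (g b))}) ∪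
          {s(v, a), s(v, b), s(v, c), s(g v, g a), s(g v, g b), s(g v, g c),
            s(g (g v), g (g a)), s(g (g v), g (g b)), s(g (g v), g (g c))}) := by
  obtain ⟨A, F, hT, hA, h2, hE⟩ := hT
  obtain ⟨r, hr, hx⟩ : ∃ r, Rot g r ∧ s(r a, r b) ∈ F := by
    rcases hE _ he with h | h | h
    · exact ⟨id, Or.inl rfl, h⟩
    · exact ⟨g, Or.inr (Or.inl rfl), h⟩
    · exact ⟨g ∘ g, Or.inr (Or.inr rfl), h⟩
  have horb : ∀ r, Rot g r → ({s(r a, r b), s(g (r a), g (r b)), s(g (g (r a)), g (g (r b)))} :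
      Finset (Sym2 V)) = {s(a, b), s(g a, g b), s(g (g a), g (g b))} := by
    intro r hr
    ext e
    rcases hr with rfl | rfl | rfl
    · rfl
    all_goals
      simp only [Finset.mem_insert, Finset.mem_singleton, Function.comp, hg]
      tauto
  have fin : ∀ r, Rot g r → ∀ F' : Finset (Sym2 V),
      (∀ e ∈ E \ {s(r a, r b), s(g (r a), g (r b)), s(g (g (r a)), g (g (r b)))}, Cov g F' e) →
      Cov g F' s(r v, r a) → Cov g F' s(r v, r b) → Cov g F' s(r v, r c) →
      ∀ e ∈ ((E \ {s(a, b), s(g a, g b), s(g (g a), g (g b))}) ∪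
          {s(v, a), s(v, b), s(v, c), s(g v, g a), s(g v, g b), s(g v, g c),
            s(g (g v), g (g a)), s(g (g v), g (g b)), s(g (g v), g (g c))}), Cov g F' e := by
    intro r hr F' c0 c1 c2 c3 e he
    rw [horb r hr] at c0
    have c1' := hr.cov hg c1
    have c2' := hr.cov hg c2
    have c3' := hr.cov hg c3
    rw [Finset.mem_union] at he
    rcases he with he | he
    · exact c0 e he
    simp only [Finset.mem_insert, Finset.mem_singleton] at he
    rcases he with rfl | rfl | rfl | rfl | rfl | rfl | rfl | rfl | rfl
    all_goals simpa only [Cov.map hg]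
  have ht := h2 _ (hr.mem ctx hc)
  by_cases hcc : g (r c) ∈ A
  · obtain ⟨f1, f2, f3, f4⟩ := hr.fr hg hv hv1 hv2 hf
    rw [hr.orb hg v]
    exact tp_split0 hg ctx hT hA h2 hE f1 f2 f3 f4 hx hcc (fin r hr)
  · have hcc2 : g (g (r c)) ∈ A := by
      unfold Two at ht
      tauto
    have hr2 := hr.two hg
    obtain ⟨f1, f2, f3, f4⟩ := hr2.fr hg hv hv1 hv2 hf
    rw [hr2.orb hg v]
    refine tp_split1 hg ctx hT hA h2 hE f1 f2 f3 f4 ?_ hcc2 (fin _ hr2)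
    rwa [hg, hg]

theorem tp_delta {g : V → V} (hg : ∀ v, g (g (g v)) = v) (S : Finset V) (E : Finset (Sym2 V))
    (v a : V) (ctx : Ctx g S E) (hv : v ∉ S) (hv1 : g v ∉ S) (hv2 : g (g v) ∉ S) (hf : g v ≠ v)
    (ha : a ∈ S) (hT : TP g S E) : TP g (S ∪ {v, g v, g (g v)})
        (E ∪ {s(v, g v), s(g v, g (g v)), s(g (g v), v), s(v, a), s(g v, g a), s(g (g v), g (g a))}) := by
  obtain ⟨A, F, hT, hA, h2, hE⟩ := hT
  obtain ⟨r, hr, hx⟩ : ∃ r, Rot g r ∧ r a ∈ A := by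
    rcases h2 a ha with h | h | h
    · exact ⟨id, Or.inl rfl, h.1⟩
    · exact ⟨g, Or.inr (Or.inl rfl), h.2.1⟩
    · exact ⟨id, Or.inl rfl, h.1⟩
  obtain ⟨f1, f2, f3, f4⟩ := hr.fr hg hv hv1 hv2 hf
  rw [hr.orb hg v]
  refine tp_delta0 hg ctx hT hA h2 hE f1 f2 f3 f4 hx ?_
  intro F' c1 c2 c3
  have c4 : Cov g F' s(v, a) := hr.cov hg c2
  have hcomm : g (r v) = r (g v) := by rcases hr with rfl | rfl | rfl <;> rfl
  have c5 : Cov g F' s(v, g v) := by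
    rw [hcomm] at c3
    exact hr.cov hg c3
  have c6 := (Cov.map hg).2 c5
  have c7 := (Cov.map hg).2 c6
  rw [hg] at c7
  intro e he
  simp only [Finset.mem_union, Finset.mem_insert, Finset.mem_singleton] at he
  rcases he with he | rfl | rfl | rfl | rfl | rfl | rfl
  · exact c1 e he
  · exact c5
  · exact c6
  · exact c7
  all_goals simpa only [Cov.map hg]

open Classical in
theorem tp_seq {g : V → V} (hg : ∀ v, g (g (g v)) = v) (G : SimpleGraph V)
    (h : C3ConstructionSeq G g) : TP g Finset.univ G.edgeFinset := by
  refine (seq_induct hg (TP g) ?_ ?_ ?_ ?_ G h).1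
  · intro x hx
    have h := free3 hg hx
    refine ⟨{g x, x}, {s(g x, x)}, ?_, ?_, ?_, ?_⟩
    · have t0 : Tr ({x} : Finset V) ∅ :=
        ⟨by simp, by simp, by simp, by simp⟩
      exact t0.leaf (by simpa using hx) (by simp)
    · intro y hy
      simp only [Finset.mem_insert, Finset.mem_singleton] at hy ⊢
      tauto
    · have hh : Two g {g x, x} x := by
        left
        simp [h]
      intro y hy
      simp only [Finset.mem_insert, Finset.mem_singleton] at hy
      rcases hy with rfl | rfl | rfl
      · exact hh
      · rwa [Two.map hg]
      · rwa [Two.map hg, Two.map hg]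
    · have hh : Cov g {s(g x, x)} s(x, g x) := Or.inl (by simp [Sym2.eq_swap])
      have h2 := (Cov.map hg).2 hh
      have h3 := (Cov.map hg).2 h2
      rw [hg] at h3
      intro e he
      simp only [Finset.mem_insert, Finset.mem_singleton] at he
      rcases he with rfl | rfl | rfl <;> assumption
  · intro S E v a b ctx hv hv1 hv2 hf ha hb hab ih
    exact tp_vadd hg S E v a b ctx hv hv1 hv2 hf ha hb ih
  · intro S E v a b c ctx hv hv1 hv2 hf ha hb hc hab hbc hac he ih
    exact tp_split hg S E v a b c ctx hv hv1 hv2 hf hc he ih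
  · intro S E v a ctx hv hv1 hv2 hf ha ih
    exact tp_delta hg S E v a ctx hv hv1 hv2 hf ha ih

theorem sub_edge {G : SimpleGraph V} (H : G.Subgraph) :
    Nat.card H.coe.edgeSet = H.edgeSet.ncard := by
  rw [← SimpleGraph.Subgraph.image_coe_edgeSet_coe,
    Set.ncard_image_of_injective _ (Sym2.map.injective Subtype.val_injective)]
  rfl

theorem tree_card {G : SimpleGraph V} (H : G.Subgraph) (h : H.coe.IsTree) :
    H.edgeSet.ncard + 1 = H.verts.ncard := by
  have := (SimpleGraph.isTree_iff_connected_and_card.1 h).2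
  rw [sub_edge] at this
  exact this

theorem acyc_card {G : SimpleGraph V} (H : G.Subgraph) (h : H.coe.IsAcyclic)
    (hne : H.verts.Nonempty) : H.edgeSet.ncard + 1 ≤ H.verts.ncard ∧
      (H.edgeSet.ncard + 1 = H.verts.ncard → H.coe.IsTree) := by
  classical
  have : Nonempty H.verts := hne.to_subtype
  obtain ⟨F, h1, -, h3⟩ := (SimpleGraph.connected_top (V := H.verts)).exists_isTree_le_of_le_of_isAcyclic
    le_top h
  have hc := (SimpleGraph.isTree_iff_connected_and_card.1 h3).2
  have hv : Nat.card H.verts = H.verts.ncard := rfl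
  have hF : Nat.card F.edgeSet = F.edgeSet.ncard := rfl
  have hH : H.coe.edgeSet.ncard = H.edgeSet.ncard := sub_edge H
  have hsub : H.coe.edgeSet ⊆ F.edgeSet := SimpleGraph.edgeSet_mono h1
  have hle := Set.ncard_le_ncard hsub (Set.toFinite _)
  refine ⟨by omega, fun heq => ?_⟩
  have := Set.eq_of_subset_of_ncard_le hsub (by omega) (Set.toFinite _)
  rw [SimpleGraph.edgeSet_inj.1 this]
  exact h3

theorem dcount {α : Type*} [Finite α] (W : Fin 3 → Set α) (U : Set α) (k : ℕ)
    (h : ∀ x ∈ U, ({i : Fin 3 | x ∈ W i}).ncard = k) :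
    (U ∩ W 0).ncard + (U ∩ W 1).ncard + (U ∩ W 2).ncard = k * U.ncard := by
  classical
  have := Fintype.ofFinite α
  have hn : ∀ s : Set α, s.ncard = ∑ x, if x ∈ s then 1 else 0 := by
    intro s
    rw [Set.ncard_eq_toFinset_card', ← Finset.card_filter]
    congr 1
    ext x; simp
  rw [hn, hn, hn, hn, Finset.mul_sum, ← Finset.sum_add_distrib, ← Finset.sum_add_distrib]
  apply Finset.sum_congr rfl
  intro x _
  by_cases hx : x ∈ U
  · have h1 := h x hx
    have h2 : ({i : Fin 3 | x ∈ W i}).ncard = ∑ i, if x ∈ W i then 1 else 0 := by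
      rw [Set.ncard_eq_toFinset_card', ← Finset.card_filter]
      congr 1
      ext x; simp
    rw [h2, Fin.sum_univ_three] at h1
    simp only [Set.mem_inter_iff, hx, true_and, if_true, mul_one]
    exact h1
  · simp [hx]

theorem eu_ncard {P : Fin 3 → Prop} (h : ∃! i, P i) : ({i : Fin 3 | P i}).ncard = 1 := by
  rw [Set.ncard_eq_one]
  obtain ⟨i, h1, h2⟩ := h
  refine ⟨i, ?_⟩
  ext j
  simp only [Set.mem_ofPred_eq, Set.mem_singleton_iff]
  exact ⟨h2 j, fun h => h ▸ h1⟩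

theorem four_two (G : SimpleGraph V) (hV : 3 ≤ Fintype.card V) (γ : G ≃g G)
    (T : Fin 3 → G.Subgraph) (h1 : IsC3_3Tree2Partition G γ T) (h2 : IsProper3Tree2Partition G T) :
    Laman G ∧ ∀ v, γ v ≠ v := by
  classical
  obtain ⟨⟨ht, he, hv⟩, hprop⟩ := h2
  have hmap := h1.2
  have hc : ∀ i, (T i).edgeSet.ncard + 1 = (T i).verts.ncard := fun i => tree_card _ (ht i)
  have vc : ∀ U : Set V, (U ∩ (T 0).verts).ncard + (U ∩ (T 1).verts).ncard + (U ∩ (T 2).verts).ncard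
      = 2 * U.ncard := fun U => dcount (fun i => (T i).verts) U 2 (fun x _ => hv x)
  have ec : ∀ X : Set (Sym2 V), X ⊆ G.edgeSet → (X ∩ (T 0).edgeSet).ncard +
      (X ∩ (T 1).edgeSet).ncard + (X ∩ (T 2).edgeSet).ncard = X.ncard := fun X hX => by
    have := dcount (fun i => (T i).edgeSet) X 1 (fun x hx => eu_ncard (he x (hX hx)))
    rwa [one_mul] at this
  refine ⟨⟨?_, ?_⟩, ?_⟩
  · have a1 := vc Set.univ
    have a2 := ec G.edgeSet subset_rfl
    simp only [Set.univ_inter, Set.ncard_univ, Nat.card_eq_fintype_card] at a1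
    simp only [Set.inter_eq_right.2 (SimpleGraph.Subgraph.edgeSet_subset _)] at a2
    have := hc 0
    have := hc 1
    have := hc 2
    omega
  · intro H hH
    have a1 := vc H.verts
    have a2 := ec H.edgeSet H.edgeSet_subset
    have hac : ∀ i, (H ⊓ T i).coe.IsAcyclic := fun i =>
      (ht i).isAcyclic.comap (SimpleGraph.Subgraph.inclusion inf_le_right)
        (SimpleGraph.Subgraph.inclusion.injective _)
    have hcd : ∀ i, (H.verts ∩ (T i).verts).Nonempty →
        (H.edgeSet ∩ (T i).edgeSet).ncard + 1 ≤ (H.verts ∩ (T i).verts).ncard ∧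
        ((H.edgeSet ∩ (T i).edgeSet).ncard + 1 = (H.verts ∩ (T i).verts).ncard →
          (H ⊓ T i).coe.IsTree) := by
      intro i hi
      have := acyc_card (H ⊓ T i) (hac i) hi
      rw [SimpleGraph.Subgraph.edgeSet_inf] at this
      exact this
    by_cases hall : ∀ i, (H.verts ∩ (T i).verts).Nonempty
    · have := (hcd 0 (hall 0)).1
      have := (hcd 1 (hall 1)).1
      have := (hcd 2 (hall 2)).1
      omega
    · push Not at hall
      obtain ⟨k, hk⟩ := hall
      have hke : H.edgeSet ∩ (T k).edgeSet = ∅ := by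
        ext e
        induction e using Sym2.ind with | _ a b =>
        simp only [Set.mem_inter_iff, SimpleGraph.Subgraph.mem_edgeSet, Set.mem_empty_iff_false,
          iff_false]
        rintro ⟨e1, e2⟩
        have : a ∈ H.verts ∩ (T k).verts := ⟨e1.fst_mem, e2.fst_mem⟩
        rw [hk] at this
        exact this
      -- the remaining two trees
      have main : ∀ i j : Fin 3, i ≠ j → (H.verts ∩ (T i).verts).ncard +
          (H.verts ∩ (T j).verts).ncard = 2 * H.verts.ncard →
          (H.edgeSet ∩ (T i).edgeSet).ncard + (H.edgeSet ∩ (T j).edgeSet).ncard = H.edgeSet.ncard →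
          (H.edgeSet.ncard : ℤ) ≤ 2 * (H.verts.ncard : ℤ) - 3 := by
        intro i j hij q1 q2
        have l : ∀ i, (H.verts ∩ (T i).verts).ncard ≤ H.verts.ncard := fun i =>
          Set.ncard_le_ncard Set.inter_subset_left (Set.toFinite _)
        have li := l i
        have lj := l j
        have ei : H.verts ∩ (T i).verts = H.verts :=
          Set.eq_of_subset_of_ncard_le Set.inter_subset_left (by omega) (Set.toFinite _)
        have ej : H.verts ∩ (T j).verts = H.verts :=
          Set.eq_of_subset_of_ncard_le Set.inter_subset_left (by omega) (Set.toFinite _)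
        have hne : H.verts.Nonempty := by
          rw [← Set.ncard_pos (Set.toFinite _)]
          omega
        have ci := hcd i (by rwa [ei])
        have cj := hcd j (by rwa [ej])
        rw [ei] at ci
        rw [ej] at cj
        by_contra hcon
        refine hprop i j hij (H ⊓ T i) (H ⊓ T j) inf_le_right inf_le_right (ci.2 (by omega))
          (cj.2 (by omega)) ?_ ?_ ?_
        · rw [SimpleGraph.Subgraph.verts_inf, ei]; exact hH
        · rw [SimpleGraph.Subgraph.verts_inf, ej]; exact hH
        · rw [SimpleGraph.Subgraph.verts_inf, SimpleGraph.Subgraph.verts_inf, ei, ej]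
      fin_cases k <;> simp only [Fin.zero_eta, Fin.mk_one, Fin.reduceFinMk] at hk hke <;>
        rw [hk, Set.ncard_empty] at a1 <;> rw [hke, Set.ncard_empty] at a2
      · exact main 1 2 (by decide) (by omega) (by omega)
      · exact main 0 2 (by decide) (by omega) (by omega)
      · exact main 0 1 (by decide) (by omega) (by omega)
  · intro v hfix
    have step : ∀ i, v ∈ (T i).verts → v ∈ (T (i + 1)).verts := by
      intro i hi
      rw [← hmap i, SimpleGraph.Subgraph.map_verts]
      exact ⟨v, hi, hfix⟩
    have h2 := hv v
    have hne : ({i : Fin 3 | v ∈ (T i).verts}).Nonempty := by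
      rw [← Set.ncard_pos (Set.toFinite _), h2]
      omega
    obtain ⟨i, hi⟩ := hne
    have s1 := step i hi
    have s2 := step _ s1
    have : ({i : Fin 3 | v ∈ (T i).verts}) = Set.univ := by
      ext j
      simp only [Set.mem_ofPred_eq, Set.mem_univ, iff_true]
      have hj : j = i ∨ j = i + 1 ∨ j = i + 1 + 1 := by
        clear * -
        revert i j
        decide
      rcases hj with rfl | rfl | rfl
      exacts [hi, s1, s2]
    rw [this, Set.ncard_univ, Nat.card_eq_fintype_card, Fintype.card_fin] at h2
    omega

theorem Tr.image {A : Finset V} {F : Finset (Sym2 V)} (h : Tr A F) {g : V → V}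
    (hg : Function.Injective g) : Tr (A.image g) (F.image (Sym2.map g)) := by
  refine ⟨h.ne.image g, ?_, ?_, ?_⟩
  · intro a b hab
    obtain ⟨e, he, hm⟩ := Finset.mem_image.1 hab
    induction e using Sym2.ind with | _ x y =>
    have := h.sub x y he
    rw [Sym2.map_mk, Sym2.eq_iff] at hm
    rcases hm with ⟨rfl, rfl⟩ | ⟨rfl, rfl⟩
    · exact ⟨Finset.mem_image_of_mem g this.1, Finset.mem_image_of_mem g this.2.1,
        fun h => this.2.2 (hg h)⟩
    · exact ⟨Finset.mem_image_of_mem g this.2.1, Finset.mem_image_of_mem g this.1,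
        fun h => this.2.2 (hg h).symm⟩
  · rw [Finset.card_image_of_injective _ (Sym2.map.injective hg), Finset.card_image_of_injective _ hg]
    exact h.crd
  · intro P hP a ha b hb hPa
    obtain ⟨x, hx, rfl⟩ := Finset.mem_image.1 ha
    obtain ⟨y, hy, rfl⟩ := Finset.mem_image.1 hb
    refine h.con (fun x => P (g x)) ?_ x hx y hy hPa
    intro x y hxy
    exact hP _ _ (Finset.mem_image_of_mem (Sym2.map g) hxy)

/-- subgraph from a finset tree -/
def mkSub (G : SimpleGraph V) (A : Finset V) (F : Finset (Sym2 V)) (h : Tr A F)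
    (hF : ∀ e ∈ F, e ∈ G.edgeSet) : G.Subgraph where
  verts := A
  Adj a b := s(a, b) ∈ F
  adj_sub h := hF _ h
  edge_vert hab := (h.sub _ _ hab).1
  symm := ⟨fun a b hab => by rw [Sym2.eq_swap]; exact hab⟩

theorem mkSub_edgeSet (G : SimpleGraph V) (A : Finset V) (F : Finset (Sym2 V)) (h : Tr A F)
    (hF : ∀ e ∈ F, e ∈ G.edgeSet) : (mkSub G A F h hF).edgeSet = F := by
  ext e
  induction e using Sym2.ind with | _ a b => exact Iff.rfl

theorem mkSub_tree (G : SimpleGraph V) (A : Finset V) (F : Finset (Sym2 V)) (h : Tr A F)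
    (hF : ∀ e ∈ F, e ∈ G.edgeSet) : (mkSub G A F h hF).coe.IsTree := by
  rw [SimpleGraph.isTree_iff_connected_and_card]
  constructor
  · rw [SimpleGraph.connected_iff]
    refine ⟨?_, ?_⟩
    · rintro ⟨a, ha⟩ ⟨b, hb⟩
      have := h.con (fun x => ∃ hx : x ∈ (mkSub G A F h hF).verts,
        (mkSub G A F h hF).coe.Reachable ⟨a, ha⟩ ⟨x, hx⟩) ?_ a ha b hb ⟨ha, .rfl⟩
      · exact this.2
      · intro x y hxy
        obtain ⟨hx, hy, hne⟩ := h.sub x y hxy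
        have hadj : (mkSub G A F h hF).coe.Adj ⟨x, hx⟩ ⟨y, hy⟩ := hxy
        constructor
        · rintro ⟨_, hr⟩
          exact ⟨hy, hr.trans hadj.reachable⟩
        · rintro ⟨_, hr⟩
          exact ⟨hx, hr.trans hadj.symm.reachable⟩
    · obtain ⟨a, ha⟩ := h.ne
      exact ⟨⟨a, ha⟩⟩
  · rw [sub_edge, mkSub_edgeSet, Set.ncard_coe_finset, h.crd]
    exact (Set.ncard_coe_finset A).symm

theorem part_of_card {α : Type*} [DecidableEq α] {E F0 F1 F2 : Finset α} {f : ℕ} (h0 : F0.card = f)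
    (h1 : F1.card = f) (h2 : F2.card = f) (hE : E.card = 3 * f) (hs : E ⊆ F0 ∪ F1 ∪ F2) :
    E = F0 ∪ F1 ∪ F2 ∧ Disjoint F0 F1 ∧ Disjoint F0 F2 ∧ Disjoint F1 F2 := by
  have c1 := Finset.card_le_card hs
  have c2 := Finset.card_union_add_card_inter F0 F1
  have c3 := Finset.card_union_add_card_inter (F0 ∪ F1) F2
  have hd : Disjoint (F0 ∪ F1) F2 := by
    rw [Finset.disjoint_iff_inter_eq_empty, ← Finset.card_eq_zero]
    omega
  refine ⟨Finset.eq_of_subset_of_card_le hs (by omega), ?_, ?_, ?_⟩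
  · rw [Finset.disjoint_iff_inter_eq_empty, ← Finset.card_eq_zero]
    omega
  · exact hd.mono_left Finset.subset_union_left
  · exact hd.mono_left Finset.subset_union_right

open Classical in
theorem three_four (G : SimpleGraph V) (γ : G ≃g G) (hγ : ∀ v, γ (γ (γ v)) = v) (hL : Laman G)
    (h : C3ConstructionSeq G (fun v => γ v)) :
    ∃ T : Fin 3 → G.Subgraph, IsC3_3Tree2Partition G γ T ∧ IsProper3Tree2Partition G T := by
  set g : V → V := fun v => γ v with hgdef
  have hg : ∀ v, g (g (g v)) = v := hγ
  have hgi := inj_of_three hg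
  obtain ⟨A, F, hT, -, h2, hE⟩ := tp_seq hg G h
  have hcard := seq_card hg G h
  let A1 := A.image g
  let A2 := A1.image g
  let F1 := F.image (Sym2.map g)
  let F2 := F1.image (Sym2.map g)
  have hT1 : Tr A1 F1 := hT.image hgi
  have hT2 : Tr A2 F2 := hT1.image hgi
  have mA1 : ∀ x, x ∈ A1 ↔ g (g x) ∈ A := by
    intro x
    constructor
    · intro hx
      obtain ⟨y, hy, rfl⟩ := Finset.mem_image.1 hx
      rwa [hg]
    · intro hx
      exact Finset.mem_image.2 ⟨_, hx, hg x⟩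
  have mA2 : ∀ x, x ∈ A2 ↔ g x ∈ A := by
    intro x
    constructor
    · intro hx
      obtain ⟨y, hy, rfl⟩ := Finset.mem_image.1 hx
      obtain ⟨z, hz, rfl⟩ := Finset.mem_image.1 hy
      rwa [hg]
    · intro hx
      exact Finset.mem_image.2 ⟨_, Finset.mem_image_of_mem g hx, hg x⟩
  let AA : Fin 3 → Finset V := ![A, A1, A2]
  let FF : Fin 3 → Finset (Sym2 V) := ![F, F1, F2]
  have tr : ∀ i, Tr (AA i) (FF i) := by
    intro i
    fin_cases i
    exacts [hT, hT1, hT2]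
  have two : ∀ v, ({i : Fin 3 | v ∈ AA i}).ncard = 2 := by
    intro v
    rw [Set.ncard_eq_two]
    have e0 : v ∈ AA 0 ↔ v ∈ A := Iff.rfl
    have e1 : v ∈ AA 1 ↔ g (g v) ∈ A := mA1 v
    have e2 : v ∈ AA 2 ↔ g v ∈ A := mA2 v
    rcases h2 v (Finset.mem_univ v) with h | h | h
    · refine ⟨0, 2, by decide, ?_⟩
      ext i
      fin_cases i <;> simp [e0, e1, e2, h]
    · refine ⟨1, 2, by decide, ?_⟩
      ext i
      fin_cases i <;> simp [e0, e1, e2, h]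
    · refine ⟨0, 1, by decide, ?_⟩
      ext i
      fin_cases i <;> simp [e0, e1, e2, h]
  have cA1 : A1.card = A.card := Finset.card_image_of_injective _ hgi
  have cA2 : A2.card = A.card := (Finset.card_image_of_injective _ hgi).trans cA1
  have cF1 : F1.card = F.card := Finset.card_image_of_injective _ (Sym2.map.injective hgi)
  have cF2 : F2.card = F.card := (Finset.card_image_of_injective _ (Sym2.map.injective hgi)).trans cF1
  have hA3 : 3 * A.card = 2 * (Finset.univ : Finset V).card := by
    have := dcount (fun i => (AA i : Set V)) Set.univ 2 (fun x _ => two x)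
    simp only [Set.univ_inter, Set.ncard_coe_finset, Set.ncard_univ, Nat.card_eq_fintype_card] at this
    have b0 : (AA 0).card = A.card := rfl
    have b1 : (AA 1).card = A.card := cA1
    have b2 : (AA 2).card = A.card := cA2
    rw [Finset.card_univ]
    omega
  have hcrd := hT.crd
  obtain ⟨hEq, d1, d2, d3⟩ := part_of_card (E := G.edgeFinset) (F0 := F) (F1 := F1) (F2 := F2) rfl cF1 cF2
    (by omega) (by
      intro e he
      have m3 := map3 hg e
      rcases hE e he with h | h | h
      · simp [h]
      · have : e ∈ F2 := by
          rw [← m3]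
          exact Finset.mem_image_of_mem _ (Finset.mem_image_of_mem _ h)
        simp [this]
      · have : e ∈ F1 := by
          rw [← m3]
          exact Finset.mem_image_of_mem _ h
        simp [this])
  have hFE : ∀ i, ∀ e ∈ FF i, e ∈ G.edgeSet := by
    intro i e he
    rw [← SimpleGraph.mem_edgeFinset, hEq]
    fin_cases i
    · have : e ∈ F := he
      simp [this]
    · have : e ∈ F1 := he
      simp [this]
    · have : e ∈ F2 := he
      simp [this]
  have hdis : ∀ i j, i ≠ j → Disjoint (FF i) (FF j) := by
    intro i j hij
    fin_cases i <;> fin_cases j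
    · exact absurd rfl hij
    · exact d1
    · exact d2
    · exact d1.symm
    · exact absurd rfl hij
    · exact d3
    · exact d2.symm
    · exact d3.symm
    · exact absurd rfl hij
  have hnextA : ∀ i, (AA i).image g = AA (i + 1) := by
    intro i
    fin_cases i
    · rfl
    · rfl
    · show A2.image g = A
      ext x
      constructor
      · intro hx
        obtain ⟨y, hy, rfl⟩ := Finset.mem_image.1 hx
        exact (mA2 y).1 hy
      · intro hx
        exact Finset.mem_image.2 ⟨g (g x), (mA2 _).2 (by rwa [hg]), hg x⟩
  have hnextF : ∀ i, (FF i).image (Sym2.map g) = FF (i + 1) := by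
    intro i
    fin_cases i
    · rfl
    · rfl
    · show F2.image (Sym2.map g) = F
      ext e
      constructor
      · intro hx
        obtain ⟨y, hy, rfl⟩ := Finset.mem_image.1 hx
        obtain ⟨z, hz, rfl⟩ := Finset.mem_image.1 hy
        obtain ⟨w, hw, rfl⟩ := Finset.mem_image.1 hz
        rwa [map3 hg]
      · intro hx
        rw [← map3 hg e]
        exact Finset.mem_image_of_mem _ (Finset.mem_image_of_mem _ (Finset.mem_image_of_mem _ hx))
  let T : Fin 3 → G.Subgraph := fun i => mkSub G (AA i) (FF i) (tr i) (hFE i)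
  have hTe : ∀ i, (T i).edgeSet = FF i := fun i => mkSub_edgeSet _ _ _ _ _
  have hpart : Is3Tree2Partition G T := by
    refine ⟨fun i => mkSub_tree _ _ _ _ _, ?_, ?_⟩
    · intro e he
      have hex : ∃ i, e ∈ FF i := by
        rw [← SimpleGraph.mem_edgeFinset, hEq, Finset.mem_union, Finset.mem_union] at he
        rcases he with (he | he) | he
        · exact ⟨0, he⟩
        · exact ⟨1, he⟩
        · exact ⟨2, he⟩
      obtain ⟨i, hi⟩ := hex
      refine ⟨i, by show e ∈ (T i).edgeSet; rw [hTe]; exact hi, ?_⟩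
      intro j hj
      simp only [hTe] at hj
      by_contra hij
      exact Finset.disjoint_left.1 (hdis j i hij) hj hi
    · exact two
  refine ⟨T, ⟨hpart, ?_⟩, hpart, ?_⟩
  · intro i
    ext x y
    · rw [SimpleGraph.Subgraph.map_verts]
      show x ∈ g '' (AA i : Set V) ↔ x ∈ (AA (i + 1) : Set V)
      rw [← hnextA i, Finset.coe_image]
    · rw [SimpleGraph.Subgraph.map_adj]
      show Relation.Map (fun a b => s(a, b) ∈ FF i) g g x y ↔ s(x, y) ∈ FF (i + 1)
      rw [← hnextF i, Finset.mem_image]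
      constructor
      · rintro ⟨a, b, hab, rfl, rfl⟩
        exact ⟨_, hab, rfl⟩
      · rintro ⟨e, he, hm⟩
        induction e using Sym2.ind with | _ a b =>
        rw [Sym2.map_mk, Sym2.eq_iff] at hm
        rcases hm with ⟨rfl, rfl⟩ | ⟨rfl, rfl⟩
        · exact ⟨a, b, he, rfl, rfl⟩
        · exact ⟨b, a, by show s(b, a) ∈ FF i; rw [Sym2.eq_swap]; exact he, rfl, rfl⟩
  · intro i j hij Si Sj hSi hSj ti tj ci cj hv
    have ei := tree_card _ ti
    have ej := tree_card _ tj
    have hl := hL.2 (Si ⊔ Sj)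
    rw [SimpleGraph.Subgraph.verts_sup, SimpleGraph.Subgraph.edgeSet_sup, ← hv, Set.union_self,
      Set.ncard_union_eq] at hl
    · have := hl ci
      rw [← hv] at ej
      push_cast at this
      omega
    · rw [Set.disjoint_left]
      intro e he he'
      have q1 := SimpleGraph.Subgraph.edgeSet_mono hSi he
      have q2 := SimpleGraph.Subgraph.edgeSet_mono hSj he'
      rw [hTe] at q1 q2
      exact Finset.disjoint_left.1 (hdis i j hij) q1 q2

/-- **Symmetric Laman/Henneberg/Crapo theorem for `C₃`.**
Let `G` be a finite simple graph with at least 3 vertices and `γ` an automorphism of `G`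
with `γ³ = id`.  The following are equivalent:
(i) there is an isostatic framework `(G, p)` in `ℝ²` that is `C₃`-symmetric of type `γ`;
(ii) `G` satisfies the Laman conditions and `γ` fixes no vertex;
(iii) there is a `(C₃, Φ)` construction sequence for `(G, γ)`;
(iv) `G` has a proper `(C₃, γ)` 3Tree2 partition. -/
theorem c3_laman_tfae {V : Type*} [Fintype V] [DecidableEq V]
    (G : SimpleGraph V) (hV : 3 ≤ Fintype.card V)
    (γ : G ≃g G) (hγ3 : ∀ v, γ (γ (γ v)) = v) :
    List.TFAE
      [∃ p : V → Fin 2 → ℝ, Isostatic G p ∧ C3Symmetric G γ p,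
       Laman G ∧ ∀ v, γ v ≠ v,
       C3ConstructionSeq G (fun v => γ v),
       ∃ T : Fin 3 → G.Subgraph,
         IsC3_3Tree2Partition G γ T ∧ IsProper3Tree2Partition G T] := by
  have h12 : (∃ p : V → Fin 2 → ℝ, Isostatic G p ∧ C3Symmetric G γ p) →
      Laman G ∧ ∀ v, γ v ≠ v := by
    rintro ⟨p, h1, h2⟩
    exact one_two G hV γ hγ3 p h1 h2
  have h31 := three_one G hV γ hγ3
  tfae_have 1 → 2 := h12
  tfae_have 2 → 3 := fun h => two_three G hV γ hγ3 h.1 h.2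
  tfae_have 3 → 1 := h31
  tfae_have 3 → 4 := fun h => three_four G γ hγ3 (h12 (h31 h)).1 h
  tfae_have 4 → 2 := by
    rintro ⟨T, h1, h2⟩
    exact four_two G hV γ T h1 h2
  tfae_finish

end C3Laman
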